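/- Let s ≥ 10 and let F₁, F₂ be quadratic forms in s variables with integer coefficients such that the pair (F₁,F₂) is nonsingular. Let w ∈ C_c^∞(ℝ^s). Define the singular series 𝔖 = Σ_{q=1}^∞ q^{−s} D_q(0) and the singular integral 𝔍 = ∫_{ℝ²} ( ∫_{ℝ^s} w(x) e(α₁F₁(x)+α₂F₂(x)) dx ) dα; both converge absolutely. Then for every Δ < 1/6 there is a constant C = C(Δ, F₁, F₂, w) such that for all P ≥ 1 one has | Σ_{x ∈ ℤ^s : F₁(x)=F₂(x)=0} w(x/P) − 𝔖·𝔍·P^{s−4} | ≤ C P^{s−4−Δ}. -/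

import Mathlib

open MeasureTheory Real Matrix Finset

noncomputable section

/-- `e(x) = exp(2πix)`. -/
def e2pi (x : ℝ) : ℂ := Complex.exp (2 * Real.pi * Complex.I * x)

/-- Euclidean norm on `ℝ²`. -/
def nrm2 (x : ℝ × ℝ) : ℝ := Real.sqrt (x.1 ^ 2 + x.2 ^ 2)

/-- Dot product on `ℝ²`. -/
def dot2 (x y : ℝ × ℝ) : ℝ := x.1 * y.1 + x.2 * y.2

/-- `x^⊥ = (x₂, -x₁)`. -/
def perp2 (x : ℝ × ℝ) : ℝ × ℝ := (x.2, -x.1)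

/-- `δ_n` for `n ∈ ℤ²`. -/
def deltaInt (n : ℤ × ℤ) : ℂ := if n = 0 then 1 else 0

/-- `h(y,z) = Σ_{j ≥ 1} (1/(yj)) (ω(yj) − ω(|z|/(yj)))`. -/
def hFun (ω : ℝ → ℝ) (y z : ℝ) : ℝ :=
  ∑' j : ℕ+, (1 / (y * ((j : ℕ) : ℝ))) *
    (ω (y * ((j : ℕ) : ℝ)) - ω (|z| / (y * ((j : ℕ) : ℝ))))

/-- `c = (∫_{ℝ²} ω(|x|) dx)⁻¹`. -/
def cConst (ω : ℝ → ℝ) : ℝ := (∫ x : ℝ × ℝ, ω (nrm2 x))⁻¹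

/-- The function `p_{1,q}`. -/
def p1 (ω ω₀ : ℝ → ℝ) (Q : ℝ) (q : ℕ) (w : ℝ × ℝ) : ℂ :=
  -(cConst ω / Q : ℝ) * ∫ x : ℝ × ℝ,
    (((ω₀ (nrm2 x / Q ^ ((3 : ℝ) / 2)) *
      ∑' j : ℕ+, (1 / ((q : ℝ) * ((j : ℕ) : ℝ)) ^ 2) *
        ω (nrm2 x / (((j : ℕ) : ℝ) * (q : ℝ) * Q ^ ((1 : ℝ) / 2)))) : ℝ) : ℂ) *
      e2pi (-(dot2 w x))

/-- The function `p_{2,r,k,q}` (with `q` allowed to be a real parameter). -/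
def p2 (ω ω₀ : ℝ → ℝ) (Q : ℝ) (r : ℤ × ℤ) (k : ℕ) (q : ℝ) (w : ℝ × ℝ) : ℂ :=
  ((cConst ω / Q ^ 3 : ℝ) : ℂ) * ∫ x : ℝ × ℝ,
    (((ω₀ (nrm2 x / Q ^ ((3 : ℝ) / 2)) *
      hFun ω ((k : ℝ) * q / Q) (((r.1 : ℝ) * x.1 + (r.2 : ℝ) * x.2) / Q ^ 2)) : ℝ) : ℂ) *
      e2pi (-(dot2 w x))

/-- The lattice `Λ(a,q) = {k a + q y}` as a subset of `ℤ²`. -/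
def Lambda (a : ℤ × ℤ) (q : ℕ) : Set (ℤ × ℤ) :=
  {v | ∃ k : ℤ, ∃ y : ℤ × ℤ, v = (k * a.1 + (q : ℤ) * y.1, k * a.2 + (q : ℤ) * y.2)}

/-- `k(r) = gcd(r₁,r₂)/gcd(gcd(r₁,r₂),q)`. -/
def kOf (r : ℤ × ℤ) (q : ℕ) : ℕ := Int.gcd r.1 r.2 / Nat.gcd (Int.gcd r.1 r.2) q

/-- The function `p_{Λ(a,q)}`. -/
def pLambda (ω ω₀ : ℝ → ℝ) (Q : ℝ) (q : ℕ) (a : ℤ × ℤ) (w : ℝ × ℝ) : ℂ :=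
  p1 ω ω₀ Q q w +
    ∑' r : ℤ × ℤ,
      Set.indicator {r : ℤ × ℤ | r ∈ Lambda a q ∧ r ≠ 0}
        (fun r => ((ω (nrm2 ((r.1 : ℝ), (r.2 : ℝ)) / Q ^ ((1 : ℝ) / 2)) : ℝ) : ℂ) *
          p2 ω ω₀ Q r (kOf r q) (q : ℝ) w) r

/-- Reduced residues `a mod q` (canonical representatives) with `gcd(a₁,a₂,q)=1`. -/
def residues (q : ℕ) : Finset (ℕ × ℕ) :=
  ((Finset.range q) ×ˢ (Finset.range q)).filter (fun a => Nat.gcd (Nat.gcd a.1 a.2) q = 1)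

/-- Normalized directional derivative along `ξ`. -/
def dirDeriv (ξ : ℝ × ℝ) (f : ℝ × ℝ → ℂ) : ℝ × ℝ → ℂ :=
  fun w => fderiv ℝ f w (ξ.1 / nrm2 ξ, ξ.2 / nrm2 ξ)

/-- Fourier transform `ω̂₀(t) = ∫ ω₀(x) e(−xt) dx`. -/
def fourierW0 (ω₀ : ℝ → ℝ) (t : ℝ) : ℂ := ∫ x : ℝ, ((ω₀ x : ℝ) : ℂ) * e2pi (-(x * t))

/-- `|M(w)x|` for the 3×2 matrix `M(w)`. -/
def Mnorm (Q : ℝ) (w : ℝ × ℝ) (x : ℝ × ℝ) : ℝ :=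
  Real.sqrt (x.1 ^ 2 / Q + x.2 ^ 2 / Q + Q ^ 2 * (w.1 * x.2 - w.2 * x.1) ^ 2)

/-- `μ_{M(w)}(Λ(a,q))`: infimum of `|M(w)x|` over nonzero lattice points. -/
def muM (Q : ℝ) (w : ℝ × ℝ) (a : ℤ × ℤ) (q : ℕ) : ℝ :=
  sInf {t : ℝ | ∃ v : ℤ × ℤ, v ∈ Lambda a q ∧ v ≠ 0 ∧ t = Mnorm Q w ((v.1 : ℝ), (v.2 : ℝ))}

/-- Quadratic form attached to an integer matrix, over any commutative ring. -/
def quadEval {s : ℕ} {R : Type*} [CommRing R] (M : Matrix (Fin s) (Fin s) ℤ)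
    (x : Fin s → R) : R :=
  ∑ i, ∑ j, (M i j : R) * x i * x j

/-- `e_q(n) = exp(2πin/q)` for an integer `n`. -/
def eqc (q : ℕ) (n : ℤ) : ℂ := e2pi ((n : ℝ) / (q : ℝ))

/-- The exponential sum `D_q(u)`. -/
def Dq (s : ℕ) (M₁ M₂ : Matrix (Fin s) (Fin s) ℤ) (q : ℕ) (u : Fin s → ℤ) : ℂ :=
  ∑ a ∈ residues q, ∑ b ∈ Fintype.piFinset (fun _ : Fin s => Finset.range q),
    eqc q ((a.1 : ℤ) * quadEval M₁ (fun i => (b i : ℤ)) +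
      (a.2 : ℤ) * quadEval M₂ (fun i => (b i : ℤ)) + ∑ i, (b i : ℤ) * u i)

/-- The exponential sum `S_{q,dc}(u)`. -/
def Sq (s : ℕ) (M₁ M₂ : Matrix (Fin s) (Fin s) ℤ) (q d : ℕ) (c : ℤ × ℤ)
    (u : Fin s → ℤ) : ℂ :=
  ∑ a ∈ (residues q).filter
      (fun a => (q : ℤ) ∣ (d : ℤ) * (c.1 * (a.2 : ℤ) - c.2 * (a.1 : ℤ))),
    ∑ b ∈ Fintype.piFinset (fun _ : Fin s => Finset.range q),
      eqc q ((a.1 : ℤ) * quadEval M₁ (fun i => (b i : ℤ)) +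
        (a.2 : ℤ) * quadEval M₂ (fun i => (b i : ℤ)) + ∑ i, (b i : ℤ) * u i)

/-- The pair of quadratic forms given by `M₁, M₂` is nonsingular: at every nonzero
complex common zero the gradients (equivalently `M₁x`, `M₂x`) are linearly independent. -/
def NonsingularPair (s : ℕ) (M₁ M₂ : Matrix (Fin s) (Fin s) ℤ) : Prop :=
  ∀ x : Fin s → ℂ, x ≠ 0 →
    quadEval M₁ x = 0 → quadEval M₂ x = 0 →
    LinearIndependent ℂ
      ![(M₁.map (fun z : ℤ => (z : ℂ))).mulVec x, (M₂.map (fun z : ℤ => (z : ℂ))).mulVec x]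

/-- Euclidean norm on `Fin m → ℝ`. -/
def enorm' {m : ℕ} (v : Fin m → ℝ) : ℝ := Real.sqrt (∑ i, v i ^ 2)

end

/-- Simultaneous diagonalisation data for a pair of integer symmetric matrices. -/
structure Pencil (s : ℕ) (B₁ B₂ : Matrix (Fin s) (Fin s) ℤ) where
  V : Matrix (Fin s) (Fin s) ℂ
  W : Matrix (Fin s) (Fin s) ℂ
  ρ : Fin s → ℂ
  σ : Fin s → ℂ
  Θ : Matrix (Fin s) (Fin s) ℤ
  θ : Fin s → ℂ
  VW : V * W = 1
  WV : W * V = 1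
  hB₁ : Vᵀ * B₁.map (fun z : ℤ => (z : ℂ)) = diagonal ρ * W
  hB₂ : Vᵀ * B₂.map (fun z : ℤ => (z : ℂ)) = diagonal σ * W
  hΘ : W * Θ.map (fun z : ℤ => (z : ℂ)) = diagonal θ * W
  θ_inj : Function.Injective θ
  indep : ∀ l m, l ≠ m → ρ l * σ m - ρ m * σ l ≠ 0

section PencilExistence

variable {s : ℕ} {M₁ M₂ : Matrix (Fin s) (Fin s) ℤ}

lemma quadEval_complex (M : Matrix (Fin s) (Fin s) ℤ) (x : Fin s → ℂ) :
    quadEval M x = x ⬝ᵥ (M.map (fun z : ℤ => (z : ℂ)) *ᵥ x) := by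
  simp only [quadEval, dotProduct, mulVec, Finset.mul_sum, map_apply]
  refine Finset.sum_congr rfl fun i _ => Finset.sum_congr rfl fun j _ => by ring

/-- A vector annihilated by a nonzero member of the pencil is not a common isotropic vector. -/
lemma NonsingularPair.not_isotropic (hns : NonsingularPair s M₁ M₂) {x : Fin s → ℂ} (hx : x ≠ 0)
    {a b : ℂ} (hab : a ≠ 0 ∨ b ≠ 0)
    (hker : a • (M₁.map (fun z : ℤ => (z : ℂ)) *ᵥ x) + b • (M₂.map (fun z : ℤ => (z : ℂ)) *ᵥ x) = 0)
    (h₁ : x ⬝ᵥ (M₁.map (fun z : ℤ => (z : ℂ)) *ᵥ x) = 0)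
    (h₂ : x ⬝ᵥ (M₂.map (fun z : ℤ => (z : ℂ)) *ᵥ x) = 0) : False := by
  have h := hns x hx (by rw [quadEval_complex, h₁]) (by rw [quadEval_complex, h₂])
  rw [LinearIndependent.pair_iff] at h
  obtain ⟨ha, hb⟩ := h a b hker
  rcases hab with h | h
  · exact h ha
  · exact h hb

lemma exists_det_pencil_ne_zero (hM₁ : M₁.IsSymm) (hM₂ : M₂.IsSymm)
    (hns : NonsingularPair s M₁ M₂) : ∃ t : ℤ, (M₁ + t • M₂).det ≠ 0 := by
  by_contra! hcon
  set N₁ := M₁.map (fun z : ℤ => (z : ℂ)) with hN₁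
  set N₂ := M₂.map (fun z : ℤ => (z : ℂ)) with hN₂
  let Q : Matrix (Fin s) (Fin s) (Polynomial ℂ) :=
    N₁.map Polynomial.C + (Polynomial.X : Polynomial ℂ) • N₂.map Polynomial.C
  have hQeval : ∀ z : ℂ, Q.map (Polynomial.eval z) = N₁ + z • N₂ := by
    intro z
    ext i j
    simp [Q, mul_comm (N₂ i j)]
  have hdet : ∀ z : ℂ, Polynomial.eval z Q.det = (N₁ + z • N₂).det := by
    intro z
    have := RingHom.map_det (Polynomial.evalRingHom z) Q
    rw [Polynomial.coe_evalRingHom] at this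
    rw [this, ← hQeval z]
    rfl
  have hzero : Q.det = 0 := by
    apply Polynomial.eq_zero_of_infinite_isRoot
    apply Set.Infinite.mono (s := Set.range (fun t : ℤ => (t : ℂ)))
    · rintro _ ⟨t, rfl⟩
      show Polynomial.eval _ _ = 0
      rw [hdet]
      have h := congrArg (Int.castRingHom ℂ) (hcon t)
      rw [RingHom.map_det, map_zero] at h
      rw [← h]
      congr 1
      ext i j
      simp [hN₁, hN₂, Matrix.smul_apply, -zsmul_eq_mul]
    · exact Set.infinite_range_of_injective Int.cast_injective
  obtain ⟨v, hv, hQv⟩ := Matrix.exists_mulVec_eq_zero_iff.mpr hzero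
  obtain ⟨i, hi⟩ : ∃ i, v i ≠ 0 := by
    by_contra! h
    exact hv (funext h)
  obtain ⟨z, hz⟩ : ∃ z, Polynomial.eval z (v i) ≠ 0 := by
    by_contra! h
    exact hi (Polynomial.funext (by simpa using h))
  let x : Fin s → ℂ := fun j => Polynomial.eval z (v j)
  let y : Fin s → ℂ := fun j => Polynomial.eval z (Polynomial.derivative (v j))
  have hx : x ≠ 0 := fun h => hz (congrFun h i)
  have hxk : N₁ *ᵥ x + z • (N₂ *ᵥ x) = 0 := by
    ext j
    have h := congrArg (Polynomial.eval z) (congrFun hQv j)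
    simp only [Q, mulVec, dotProduct, Matrix.add_apply, Matrix.map_apply, Matrix.smul_apply,
      Polynomial.eval_finsetSum, Polynomial.eval_mul, Polynomial.eval_add, Polynomial.eval_C,
      smul_eq_mul, Polynomial.eval_X, Pi.zero_apply, Polynomial.eval_zero] at h
    simp only [mulVec, dotProduct, Pi.add_apply, Pi.smul_apply, smul_eq_mul, Pi.zero_apply, x,
      Finset.mul_sum, ← Finset.sum_add_distrib]
    rw [← h]
    refine Finset.sum_congr rfl fun k _ => by ring
  have hyk : N₁ *ᵥ y + z • (N₂ *ᵥ y) + N₂ *ᵥ x = 0 := by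
    ext j
    have h := congrArg (fun p => Polynomial.eval z (Polynomial.derivative p)) (congrFun hQv j)
    simp only [Q, mulVec, dotProduct, Matrix.add_apply, Matrix.map_apply, Matrix.smul_apply,
      Polynomial.derivative_sum, Polynomial.derivative_mul, Polynomial.derivative_add,
      Polynomial.derivative_C, Polynomial.derivative_X,
      Polynomial.eval_finsetSum, Polynomial.eval_mul, Polynomial.eval_add, Polynomial.eval_C,
      smul_eq_mul, Polynomial.eval_X, Pi.zero_apply, Polynomial.eval_zero,
      Polynomial.derivative_zero, Polynomial.eval_one] at h
    simp only [mulVec, dotProduct, Pi.add_apply, Pi.smul_apply, smul_eq_mul, Pi.zero_apply, x, y,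
      Finset.mul_sum, ← Finset.sum_add_distrib]
    rw [← h]
    refine Finset.sum_congr rfl fun k _ => by ring
  have hs₁ : N₁ᵀ = N₁ := by rw [hN₁, ← Matrix.transpose_map, hM₁.eq]
  have hs₂ : N₂ᵀ = N₂ := by rw [hN₂, ← Matrix.transpose_map, hM₂.eq]
  have e₁ : x ⬝ᵥ (N₁ *ᵥ y) = y ⬝ᵥ (N₁ *ᵥ x) := by
    rw [dotProduct_comm, ← Matrix.vecMul_transpose, hs₁, ← Matrix.dotProduct_mulVec]
  have e₂ : x ⬝ᵥ (N₂ *ᵥ y) = y ⬝ᵥ (N₂ *ᵥ x) := by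
    rw [dotProduct_comm, ← Matrix.vecMul_transpose, hs₂, ← Matrix.dotProduct_mulVec]
  have i₂ : x ⬝ᵥ (N₂ *ᵥ x) = 0 := by
    have h := congrArg (fun u => x ⬝ᵥ u) hyk
    simp only [dotProduct_add, dotProduct_smul, e₁, e₂, dotProduct_zero] at h
    have h' := congrArg (fun u => y ⬝ᵥ u) hxk
    simp only [dotProduct_add, dotProduct_smul, dotProduct_zero] at h'
    rwa [h', zero_add] at h
  have i₁ : x ⬝ᵥ (N₁ *ᵥ x) = 0 := by
    have h' := congrArg (fun u => x ⬝ᵥ u) hxk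
    simp only [dotProduct_add, dotProduct_smul, dotProduct_zero, i₂, smul_zero, add_zero] at h'
    exact h'
  exact hns.not_isotropic hx (a := 1) (b := z) (Or.inl one_ne_zero) (by simpa using hxk) i₁ i₂


/-- A symmetric bilinear form without isotropic eigenvectors forces distinct eigenvalues. -/
lemma exists_eigenbasis_of_not_isotropic {A T : Matrix (Fin s) (Fin s) ℂ} (hA : Aᵀ = A)
    (hAT : (A * T)ᵀ = A * T)
    (hiso : ∀ (μ : ℂ) (v : Fin s → ℂ), v ≠ 0 → T *ᵥ v = μ • v → v ⬝ᵥ (A *ᵥ v) ≠ 0) :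
    ∃ (b : Module.Basis (Fin s) ℂ (Fin s → ℂ)) (μ : Fin s → ℂ), Function.Injective μ ∧
      ∀ l, T *ᵥ b l = μ l • b l := by
  obtain ⟨f, hfv⟩ : ∃ f : Module.End ℂ (Fin s → ℂ), ∀ v, f v = T *ᵥ v :=
    ⟨Matrix.toLin' T, fun v => Matrix.toLin'_apply T v⟩
  have hsymm : ∀ u v : Fin s → ℂ, u ⬝ᵥ (A *ᵥ v) = v ⬝ᵥ (A *ᵥ u) := fun u v => by
    rw [dotProduct_comm, ← Matrix.vecMul_transpose, hA, ← Matrix.dotProduct_mulVec]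
  have hself : ∀ u v : Fin s → ℂ, u ⬝ᵥ (A *ᵥ (f v)) = f u ⬝ᵥ (A *ᵥ v) := fun u v => by
    rw [hfv, hfv, hsymm (T *ᵥ u), Matrix.mulVec_mulVec, Matrix.mulVec_mulVec,
      dotProduct_comm, ← Matrix.vecMul_transpose, hAT, ← Matrix.dotProduct_mulVec]
  have hker2 : ∀ (μ : ℂ) (v : Fin s → ℂ), (f - algebraMap ℂ _ μ) ((f - algebraMap ℂ _ μ) v) = 0 →
      (f - algebraMap ℂ _ μ) v = 0 := by
    intro μ v hv
    by_contra hw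
    set w := (f - algebraMap ℂ (Module.End ℂ (Fin s → ℂ)) μ) v with hwdef
    have hfw : f w = μ • w := by
      have : f w - μ • w = 0 := by simpa using hv
      exact sub_eq_zero.mp this
    refine hiso μ w hw (by rw [← hfv, hfw]) ?_
    have hw' : w = f v - μ • v := by simp [hwdef]
    calc w ⬝ᵥ (A *ᵥ w) = w ⬝ᵥ (A *ᵥ (f v - μ • v)) := by rw [← hw']
      _ = 0 := by
        rw [Matrix.mulVec_sub, dotProduct_sub, hself, hfw, Matrix.mulVec_smul, dotProduct_smul,
          smul_dotProduct, sub_self]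
  have hmax : ∀ μ : ℂ, f.maxGenEigenspace μ ≤ f.eigenspace μ := by
    intro μ v hv
    rw [Module.End.mem_maxGenEigenspace] at hv
    obtain ⟨k, hk⟩ := hv
    have hk' : ((f - algebraMap ℂ _ μ) ^ (k + 1)) v = 0 := by
      rw [pow_succ']
      have : ((f - algebraMap ℂ (Module.End ℂ (Fin s → ℂ)) μ) ^ k) v = 0 := hk
      rw [Module.End.mul_apply, this, map_zero]
    clear hk
    have hgoal : (f - algebraMap ℂ (Module.End ℂ (Fin s → ℂ)) μ) v = 0 := by
      induction k with
      | zero => simpa using hk'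
      | succ k ih =>
        apply ih
        rw [pow_succ', Module.End.mul_apply]
        apply hker2
        rw [pow_succ', Module.End.mul_apply, pow_succ', Module.End.mul_apply] at hk'
        exact hk'
    rw [Module.End.mem_eigenspace_iff]
    have : f v - μ • v = 0 := by simpa using hgoal
    exact sub_eq_zero.mp this
  have htop : ⨆ μ, f.eigenspace μ = ⊤ := by
    rw [eq_top_iff, ← Module.End.iSup_maxGenEigenspace_eq_top f]
    exact iSup_mono hmax
  have hex : ∀ μ : {z : ℂ // f.HasEigenvalue z}, ∃ v, f.HasEigenvector μ v := fun μ =>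
    Module.End.HasEigenvalue.exists_hasEigenvector μ.2
  choose e he using hex
  have hspan1 : ∀ μ : {z : ℂ // f.HasEigenvalue z}, f.eigenspace μ ≤ ℂ ∙ (e μ) := by
    intro μ v hv
    have hv' : f v = (μ : ℂ) • v := Module.End.mem_eigenspace_iff.mp hv
    have hee : f (e μ) = (μ : ℂ) • e μ := (he μ).apply_eq_smul
    have hne := hiso μ (e μ) (he μ).2 (by rw [← hfv]; exact hee)
    -- an isotropic combination in the eigenspace
    by_contra hnot
    have hcomb : ∀ c : ℂ, (v - c • e μ) ⬝ᵥ (A *ᵥ (v - c • e μ)) ≠ 0 := by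
      intro c
      refine hiso μ _ ?_ ?_
      · intro h0
        exact hnot (Submodule.mem_span_singleton.mpr ⟨c, (sub_eq_zero.mp h0).symm⟩)
      · rw [← hfv, map_sub, map_smul, hv', hee, smul_sub, smul_comm]
    obtain ⟨c, hc⟩ := IsAlgClosed.exists_root
      (Polynomial.C (e μ ⬝ᵥ (A *ᵥ e μ)) * Polynomial.X ^ 2
        + Polynomial.C (-2 * (e μ ⬝ᵥ (A *ᵥ v))) * Polynomial.X
        + Polynomial.C (v ⬝ᵥ (A *ᵥ v))) (by rw [Polynomial.degree_quadratic hne]; norm_num)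
    apply hcomb c
    have hc' : (e μ ⬝ᵥ (A *ᵥ e μ)) * c ^ 2 + (-2 * (e μ ⬝ᵥ (A *ᵥ v))) * c + v ⬝ᵥ (A *ᵥ v) = 0 := by
      simpa [Polynomial.IsRoot] using hc
    rw [Matrix.mulVec_sub, dotProduct_sub, sub_dotProduct, sub_dotProduct, Matrix.mulVec_smul,
      dotProduct_smul, dotProduct_smul, smul_dotProduct, smul_dotProduct, hsymm v (e μ)]
    simp only [smul_eq_mul]
    linear_combination hc'
  have hli : LinearIndependent ℂ e :=
    Module.End.eigenvectors_linearIndependent' f (fun μ : {z : ℂ // f.HasEigenvalue z} => μ.1)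
      Subtype.val_injective e he
  have hsp : ⊤ ≤ Submodule.span ℂ (Set.range e) := by
    rw [← htop]
    refine iSup_le fun μ => ?_
    by_cases hμ : f.HasEigenvalue μ
    · refine (hspan1 ⟨μ, hμ⟩).trans (Submodule.span_mono ?_)
      rintro _ rfl
      exact ⟨_, rfl⟩
    · have : f.eigenspace μ = ⊥ := by
        by_contra h
        exact hμ h
      rw [this]
      exact bot_le
  obtain ⟨b, hb⟩ : ∃ b : Module.Basis {z : ℂ // f.HasEigenvalue z} ℂ (Fin s → ℂ), ∀ μ, b μ = e μ :=
    ⟨Module.Basis.mk hli hsp, fun μ => Module.Basis.mk_apply hli hsp μ⟩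
  have : Finite {z : ℂ // f.HasEigenvalue z} := Module.Finite.finite_basis b
  have hcard : Nat.card {z : ℂ // f.HasEigenvalue z} = Nat.card (Fin s) := by
    rw [← Module.finrank_eq_nat_card_basis b, Module.finrank_fintype_fun_eq_card,
      Nat.card_eq_fintype_card]
  obtain ⟨ee⟩ : Nonempty ({z : ℂ // f.HasEigenvalue z} ≃ Fin s) := Finite.card_eq.mp hcard
  refine ⟨b.reindex ee, fun l => (ee.symm l).1, ?_, ?_⟩
  · intro l m h
    exact ee.symm.injective (Subtype.ext h)
  · intro l
    rw [← hfv, Module.Basis.reindex_apply, hb]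
    exact (he _).apply_eq_smul

theorem exists_pencil (hM₁ : M₁.IsSymm) (hM₂ : M₂.IsSymm) (hns : NonsingularPair s M₁ M₂) :
    Nonempty (Pencil s (2 • M₁) (2 • M₂)) := by
  obtain ⟨t, ht⟩ := exists_det_pencil_ne_zero hM₁ hM₂ hns
  set N₁ := M₁.map (fun z : ℤ => (z : ℂ)) with hN₁
  set N₂ := M₂.map (fun z : ℤ => (z : ℂ)) with hN₂
  set A₀ := M₁ + t • M₂ with hA₀
  set A := A₀.map (fun z : ℤ => (z : ℂ)) with hA
  have hAeq : A = N₁ + (t : ℂ) • N₂ := by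
    ext i j
    simp [hA, hA₀, hN₁, hN₂, Matrix.smul_apply, -zsmul_eq_mul]
  set D : ℂ := (A₀.det : ℂ) with hD
  have hD0 : D ≠ 0 := by rw [hD]; exact_mod_cast ht
  have hdetA : A.det = D := ((Int.castRingHom ℂ).map_det A₀).symm
  set R := A₀.adjugate.map (fun z : ℤ => (z : ℂ)) with hR
  have hAR : A * R = D • (1 : Matrix (Fin s) (Fin s) ℂ) := by
    have h := congrArg (fun M : Matrix (Fin s) (Fin s) ℤ => M.map (Int.castRingHom ℂ))
      (Matrix.mul_adjugate A₀)
    rw [Matrix.map_mul] at h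
    ext i j
    have h2 := congrFun (congrFun h i) j
    refine Eq.trans h2 ?_
    rw [Matrix.map_apply, Matrix.smul_apply, Matrix.smul_apply, one_apply, one_apply]
    split_ifs <;> simp [hD]
  have hsN₁ : N₁ᵀ = N₁ := by rw [hN₁, ← Matrix.transpose_map, hM₁.eq]
  have hsN₂ : N₂ᵀ = N₂ := by rw [hN₂, ← Matrix.transpose_map, hM₂.eq]
  have hsA : Aᵀ = A := by rw [hAeq, Matrix.transpose_add, Matrix.transpose_smul, hsN₁, hsN₂]
  set T := D⁻¹ • (R * N₂) with hT
  have hATN : A * T = N₂ := by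
    rw [hT, Matrix.mul_smul, ← Matrix.mul_assoc, hAR, Matrix.smul_mul, Matrix.one_mul, smul_smul,
      inv_mul_cancel₀ hD0, one_smul]
  have hinj : ∀ u v : Fin s → ℂ, A *ᵥ u = A *ᵥ v → u = v := by
    intro u v huv
    have : A *ᵥ (u - v) = 0 := by rw [Matrix.mulVec_sub, huv, sub_self]
    have h0 := Matrix.eq_zero_of_mulVec_eq_zero (by rw [hdetA]; exact hD0) this
    exact sub_eq_zero.mp h0
  have hpen : ∀ (μ : ℂ) (v : Fin s → ℂ), T *ᵥ v = μ • v →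
      N₂ *ᵥ v = μ • (A *ᵥ v) ∧ N₁ *ᵥ v = (1 - t * μ) • (A *ᵥ v) := by
    intro μ v hv
    have h₂ : N₂ *ᵥ v = μ • (A *ᵥ v) := by
      rw [← hATN, ← Matrix.mulVec_mulVec, hv, Matrix.mulVec_smul]
    refine ⟨h₂, ?_⟩
    have : N₁ = A - (t : ℂ) • N₂ := by rw [hAeq, add_sub_cancel_right]
    rw [this, Matrix.sub_mulVec, Matrix.smul_mulVec, h₂, sub_smul, one_smul, smul_smul]
  have hiso : ∀ (μ : ℂ) (v : Fin s → ℂ), v ≠ 0 → T *ᵥ v = μ • v → v ⬝ᵥ (A *ᵥ v) ≠ 0 := by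
    intro μ v hv hTv h0
    obtain ⟨h₂, h₁⟩ := hpen μ v hTv
    refine hns.not_isotropic hv (a := μ) (b := -(1 - t * μ)) ?_ ?_ ?_ ?_
    · by_contra! h
      obtain ⟨h, h'⟩ := h
      rw [h] at h'
      simp at h'
    · rw [← hN₁, ← hN₂, h₁, h₂, smul_smul, smul_smul, ← add_smul]
      ring_nf
      simp
    · rw [← hN₁, h₁, dotProduct_smul, h0, smul_zero]
    · rw [← hN₂, h₂, dotProduct_smul, h0, smul_zero]
  obtain ⟨b, μ, hμ, hb⟩ := exists_eigenbasis_of_not_isotropic hsA (by rw [hATN, hsN₂]) hiso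
  let V : Matrix (Fin s) (Fin s) ℂ := Matrix.of fun i l => b l i
  let W : Matrix (Fin s) (Fin s) ℂ := Matrix.of fun l i => b.repr (Pi.single i 1) l
  have hWV : W * V = 1 := by
    have : (Pi.basisFun ℂ (Fin s)).toMatrix b = V := by
      ext i j; simp [V, Module.Basis.toMatrix_apply]
    rw [← this]
    have : b.toMatrix (Pi.basisFun ℂ (Fin s)) = W := by
      ext i j; simp [W, Module.Basis.toMatrix_apply]
    rw [← this]
    exact Module.Basis.toMatrix_mul_toMatrix_flip _ _
  have hVW : V * W = 1 := mul_eq_one_comm.mp hWV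
  have hTV : T * V = V * diagonal μ := by
    ext i l
    rw [Matrix.mul_diagonal]
    have := congrFun (hb l) i
    simp only [mulVec, dotProduct, Pi.smul_apply, smul_eq_mul] at this
    rw [Matrix.mul_apply]
    simp only [V, Matrix.of_apply]
    rw [this, mul_comm]
  have hWT : W * T = diagonal μ * W := by
    calc W * T = W * T * (V * W) := by rw [hVW, Matrix.mul_one]
      _ = W * (T * V) * W := by simp only [Matrix.mul_assoc]
      _ = diagonal μ * W := by rw [hTV, ← Matrix.mul_assoc, hWV, Matrix.one_mul]
  let ω : Fin s → ℂ := fun l => b l ⬝ᵥ (A *ᵥ b l)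
  have hω0 : ∀ l, ω l ≠ 0 := fun l => hiso (μ l) (b l) (b.ne_zero l) (hb l)
  have hVA : Vᵀ * A * V = diagonal ω := by
    have hsym : (Vᵀ * A * V) * diagonal μ = diagonal μ * (Vᵀ * A * V) := by
      have h1 : (Vᵀ * A * V) * diagonal μ = Vᵀ * N₂ * V := by
        rw [Matrix.mul_assoc, ← hTV, ← hATN]; simp only [Matrix.mul_assoc]
      have h2 : (Vᵀ * N₂ * V)ᵀ = Vᵀ * N₂ * V := by
        simp only [Matrix.transpose_mul, Matrix.transpose_transpose, hsN₂, Matrix.mul_assoc]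
      have h3 : (Vᵀ * A * V)ᵀ = Vᵀ * A * V := by
        simp only [Matrix.transpose_mul, Matrix.transpose_transpose, hsA, Matrix.mul_assoc]
      rw [h1, ← h2, ← h1, Matrix.transpose_mul, h3, Matrix.diagonal_transpose]
    ext l m
    by_cases hlm : l = m
    · subst hlm
      rw [diagonal_apply_eq, Matrix.mul_assoc, Matrix.mul_apply]
      simp only [ω, dotProduct, mulVec, V, Matrix.transpose_apply, Matrix.of_apply,
        Matrix.mul_apply]
    · rw [diagonal_apply_ne _ hlm]
      have h := congrFun (congrFun hsym l) m
      rw [Matrix.mul_diagonal, Matrix.diagonal_mul] at h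
      have hne : μ m - μ l ≠ 0 := sub_ne_zero.mpr fun h => hlm (hμ h.symm)
      have : (μ m - μ l) * (Vᵀ * A * V) l m = 0 := by linear_combination h
      exact (mul_eq_zero.mp this).resolve_left hne
  have hVAW : Vᵀ * A = diagonal ω * W := by
    rw [← hVA, Matrix.mul_assoc _ V W, hVW, Matrix.mul_one]
  have hVN₂ : Vᵀ * N₂ = diagonal (fun l => ω l * μ l) * W := by
    rw [← hATN, ← Matrix.mul_assoc, hVAW, Matrix.mul_assoc, hWT, ← Matrix.mul_assoc,
      Matrix.diagonal_mul_diagonal]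
  have hVN₁ : Vᵀ * N₁ = diagonal (fun l => ω l * (1 - t * μ l)) * W := by
    have : N₁ = A - (t : ℂ) • N₂ := by rw [hAeq, add_sub_cancel_right]
    rw [this, Matrix.mul_sub, Matrix.mul_smul, hVAW, hVN₂]
    ext l m
    simp only [Matrix.sub_apply, Matrix.smul_apply, Matrix.diagonal_mul, smul_eq_mul]
    ring
  have hmap2 : ∀ M : Matrix (Fin s) (Fin s) ℤ, (2 • M).map (fun z : ℤ => (z : ℂ)) =
      (2 : ℂ) • M.map (fun z : ℤ => (z : ℂ)) := by
    intro M; ext i j; simp [Matrix.smul_apply, -nsmul_eq_mul]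
  refine ⟨⟨V, W, fun l => 2 * (ω l * (1 - t * μ l)), fun l => 2 * (ω l * μ l),
    A₀.adjugate * M₂, fun l => D * μ l, hVW, hWV, ?_, ?_, ?_, ?_, ?_⟩⟩
  · rw [hmap2, Matrix.mul_smul, hVN₁]
    ext l m
    simp only [Matrix.smul_apply, Matrix.diagonal_mul, smul_eq_mul]
    ring
  · rw [hmap2, Matrix.mul_smul, hVN₂]
    ext l m
    simp only [Matrix.smul_apply, Matrix.diagonal_mul, smul_eq_mul]
    ring
  · have h1 : (A₀.adjugate * M₂).map (fun z : ℤ => (z : ℂ)) = D • T := by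
      rw [hT, smul_smul, mul_inv_cancel₀ hD0, one_smul]
      exact Matrix.map_mul (f := Int.castRingHom ℂ)
    rw [h1, Matrix.mul_smul, hWT]
    ext l m
    simp only [Matrix.smul_apply, Matrix.diagonal_mul, smul_eq_mul]
    ring
  · intro l m h
    exact hμ (mul_left_cancel₀ hD0 h)
  · intro l m hlm h
    have hne : μ m - μ l ≠ 0 := sub_ne_zero.mpr fun h => hlm (hμ h.symm)
    have : 4 * ω l * ω m * (μ m - μ l) = 0 := by linear_combination h
    simp [hω0, hne] at this

end PencilExistence

/-- The real vector with given integer coordinates. -/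
def realVec {s : ℕ} (h : Fin s → ℤ) : Fin s → ℝ := fun i => (h i : ℝ)

lemma realVec_apply {s : ℕ} (h : Fin s → ℤ) (i : Fin s) : realVec h i = (h i : ℝ) := rfl

lemma realVec_sub {s : ℕ} (h k : Fin s → ℤ) : realVec (h - k) = realVec h - realVec k := by
  ext i; simp [realVec]

lemma realVec_injective {s : ℕ} : Function.Injective (realVec (s := s)) := fun h k hk => by
  ext i
  have := congrFun hk i
  simpa [realVec] using this

/-- The linear map `h ↦ α₁ B₁ h + α₂ B₂ h`. -/
noncomputable def pencilMap {s : ℕ} (B₁ B₂ : Matrix (Fin s) (Fin s) ℤ) (α : ℝ × ℝ) :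
    (Fin s → ℝ) →ₗ[ℝ] (Fin s → ℝ) :=
  α.1 • (B₁.map (fun z : ℤ => (z : ℝ))).mulVecLin + α.2 • (B₂.map (fun z : ℤ => (z : ℝ))).mulVecLin

lemma pencilMap_apply {s : ℕ} (B₁ B₂ : Matrix (Fin s) (Fin s) ℤ) (α : ℝ × ℝ) (h : Fin s → ℝ)
    (i : Fin s) : pencilMap B₁ B₂ α h i = ∑ j, (α.1 * B₁ i j + α.2 * B₂ i j) * h j := by
  simp only [pencilMap, LinearMap.add_apply, LinearMap.smul_apply, Matrix.mulVecLin_apply,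
    Pi.add_apply, Pi.smul_apply, mulVec, dotProduct, smul_eq_mul, map_apply, Finset.mul_sum,
    ← Finset.sum_add_distrib]
  exact Finset.sum_congr rfl fun j _ => by ring

/-- The linear map from real vectors to complex vectors given by a complex matrix. -/
noncomputable def realToComplexLin {s : ℕ} (M : Matrix (Fin s) (Fin s) ℂ) :
    (Fin s → ℝ) →ₗ[ℝ] (Fin s → ℂ) where
  toFun h l := ∑ i, M l i * (h i : ℂ)
  map_add' h k := by
    ext l
    simp [mul_add, Finset.sum_add_distrib]
  map_smul' c h := by
    ext l
    simp only [Pi.smul_apply, smul_eq_mul, Complex.ofReal_mul, RingHom.id_apply, Complex.real_smul,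
      Finset.mul_sum]
    exact Finset.sum_congr rfl fun j _ => by ring

lemma norm_realToComplexLin_le {s : ℕ} (M : Matrix (Fin s) (Fin s) ℂ) :
    ∃ C : ℝ, 1 ≤ C ∧ ∀ h l, ‖realToComplexLin M h l‖ ≤ C * ‖h‖ := by
  refine ⟨1 + ∑ l, ∑ i, ‖M l i‖, by
    have : 0 ≤ ∑ l, ∑ i, ‖M l i‖ := by positivity
    linarith, fun h l => ?_⟩
  calc ‖realToComplexLin M h l‖ ≤ ∑ i, ‖M l i‖ * ‖h‖ := by
        change ‖∑ i, M l i * (h i : ℂ)‖ ≤ _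
        refine (norm_sum_le _ _).trans (Finset.sum_le_sum fun i _ => ?_)
        rw [norm_mul, Complex.norm_real]
        exact mul_le_mul_of_nonneg_left (norm_le_pi_norm h i) (norm_nonneg _)
    _ = (∑ i, ‖M l i‖) * ‖h‖ := by rw [Finset.sum_mul]
    _ ≤ _ := by
        refine mul_le_mul_of_nonneg_right ?_ (norm_nonneg _)
        have := Finset.single_le_sum (f := fun l => ∑ i, ‖M l i‖)
           (fun l _ => Finset.sum_nonneg fun i _ => norm_nonneg _)
          (Finset.mem_univ l)
        linarith

namespace Pencil

variable {s : ℕ} {B₁ B₂ : Matrix (Fin s) (Fin s) ℤ} (D : Pencil s B₁ B₂)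

/-- Coordinates with respect to the common eigenbasis. -/
noncomputable def x : (Fin s → ℝ) →ₗ[ℝ] (Fin s → ℂ) := realToComplexLin D.W

/-- Dual coordinates. -/
noncomputable def y : (Fin s → ℝ) →ₗ[ℝ] (Fin s → ℂ) := realToComplexLin D.Vᵀ

/-- The eigenvalues of the pencil. -/
noncomputable def L (α : ℝ × ℝ) (l : Fin s) : ℂ := α.1 * D.ρ l + α.2 * D.σ l

lemma L_sub (α β : ℝ × ℝ) (l : Fin s) : D.L (α - β) l = D.L α l - D.L β l := by
  simp [L]; ring


lemma x_eq_mulVec (h : Fin s → ℝ) : D.x h = D.W *ᵥ (fun i => (h i : ℂ)) := rfl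
lemma y_eq_mulVec (h : Fin s → ℝ) : D.y h = D.Vᵀ *ᵥ (fun i => (h i : ℂ)) := rfl

lemma y_pencilMap (α : ℝ × ℝ) (h : Fin s → ℝ) (l : Fin s) :
    D.y (pencilMap B₁ B₂ α h) l = D.L α l * D.x h l := by
  have e₁ := congrFun (congrArg (fun M => M *ᵥ (fun i => (h i : ℂ))) D.hB₁) l
  have e₂ := congrFun (congrArg (fun M => M *ᵥ (fun i => (h i : ℂ))) D.hB₂) l
  simp only [← Matrix.mulVec_mulVec, Matrix.mulVec_diagonal, ← x_eq_mulVec] at e₁ e₂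
  have : (fun i => ((pencilMap B₁ B₂ α h i : ℝ) : ℂ)) =
      (α.1 : ℂ) • (B₁.map (fun z : ℤ => (z : ℂ)) *ᵥ (fun i => (h i : ℂ))) +
      (α.2 : ℂ) • (B₂.map (fun z : ℤ => (z : ℂ)) *ᵥ (fun i => (h i : ℂ))) := by
    ext i
    rw [pencilMap_apply]
    simp only [Pi.add_apply, Pi.smul_apply, mulVec, dotProduct, smul_eq_mul, map_apply,
      Finset.mul_sum, ← Finset.sum_add_distrib]
    push_cast
    exact Finset.sum_congr rfl fun j _ => by ring
  rw [y_eq_mulVec, this, Matrix.mulVec_add, Matrix.mulVec_smul, Matrix.mulVec_smul]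
  simp only [Pi.add_apply, Pi.smul_apply, smul_eq_mul, e₁, e₂, L]
  ring

lemma dot_eq (h n : Fin s → ℝ) : ((∑ i, h i * n i : ℝ) : ℂ) = ∑ l, D.x h l * D.y n l := by
  have : ∑ l, D.x h l * D.y n l = (D.W *ᵥ fun i => (h i : ℂ)) ⬝ᵥ (D.Vᵀ *ᵥ fun i => (n i : ℂ)) := rfl
  rw [this, Matrix.dotProduct_mulVec, Matrix.vecMul_transpose, Matrix.mulVec_mulVec, D.VW,
    Matrix.one_mulVec]
  simp [dotProduct]

lemma x_theta (h : Fin s → ℤ) (l : Fin s) :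
    D.x (realVec (D.Θ *ᵥ h)) l = D.θ l * D.x (realVec h) l := by
  have e := congrFun (congrArg (fun M => M *ᵥ (fun i => (h i : ℂ))) D.hΘ) l
  simp only [← Matrix.mulVec_mulVec, Matrix.mulVec_diagonal] at e
  rw [x_eq_mulVec, x_eq_mulVec]
  refine Eq.trans ?_ e
  congr 2
  ext i
  simp [realVec, mulVec, dotProduct]

lemma x_theta_pow (u : ℕ) (h : Fin s → ℤ) (l : Fin s) :
    D.x (realVec ((D.Θ ^ u) *ᵥ h)) l = D.θ l ^ u * D.x (realVec h) l := by
  induction u with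
  | zero => simp
  | succ u ih => rw [pow_succ', ← Matrix.mulVec_mulVec, x_theta, ih, pow_succ']; ring

/-- The integers `(Θᵘ h) · n`. -/
def twist (u : ℕ) (h n : Fin s → ℤ) : ℤ := ((D.Θ ^ u) *ᵥ h) ⬝ᵥ n

lemma twist_eq (u : ℕ) (h n : Fin s → ℤ) :
    (D.twist u h n : ℂ) = ∑ l, D.θ l ^ u * (D.x (realVec h) l * D.y (realVec n) l) := by
  have := D.dot_eq (realVec ((D.Θ ^ u) *ᵥ h)) (realVec n)
  simp only [x_theta_pow] at this
  simp only [mul_assoc] at this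
  rw [← this]
  simp [twist, dotProduct, realVec]

lemma eq_zero_of_vandermonde {v : Fin s → ℂ} (hv : ∀ u : Fin s, ∑ l, D.θ l ^ (u : ℕ) * v l = 0) :
    v = 0 :=
  Matrix.eq_zero_of_forall_pow_sum_mul_pow_eq_zero D.θ_inj fun u => by
    rw [← hv u]
    exact Finset.sum_congr rfl fun l _ => mul_comm _ _

/-- A bound for all the powers of the eigenvalues of `Θ` that occur. -/
lemma exists_theta_bound : ∃ C : ℝ, 1 ≤ C ∧ ∀ (u : Fin s) l, ‖D.θ l ^ (u : ℕ)‖ ≤ C := by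
  refine ⟨1 + ∑ u : Fin s, ∑ l, ‖D.θ l ^ (u : ℕ)‖, by
    have : 0 ≤ ∑ u : Fin s, ∑ l, ‖D.θ l ^ (u : ℕ)‖ := by positivity
    linarith, fun u l => ?_⟩
  have h₁ := Finset.single_le_sum (f := fun u : Fin s => ∑ l, ‖D.θ l ^ (u : ℕ)‖)
    (fun l _ => by positivity) (Finset.mem_univ u)
  have h₂ := Finset.single_le_sum (f := fun l => ‖D.θ l ^ (u : ℕ)‖)
    (fun l _ => by positivity) (Finset.mem_univ l)
  linarith

/-- The eigencoordinates of `h'·n − h·n'` vanish as soon as they are small. -/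
lemma exists_gap : ∃ c : ℝ, 0 < c ∧ ∀ h n h' n' : Fin s → ℤ,
    (∀ l, ‖D.x (realVec h') l * D.y (realVec n) l - D.x (realVec h) l * D.y (realVec n') l‖ < c) →
    ∀ l, D.x (realVec h') l * D.y (realVec n) l = D.x (realVec h) l * D.y (realVec n') l := by
  obtain ⟨C, hC1, hC⟩ := D.exists_theta_bound
  refine ⟨1 / ((s + 1) * C), by positivity, fun h n h' n' hsmall => ?_⟩
  have hv := D.eq_zero_of_vandermonde
    (v := fun l => D.x (realVec h') l * D.y (realVec n) l - D.x (realVec h) l * D.y (realVec n') l)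
    fun u => by
      have hInt : ∑ l, D.θ l ^ (u : ℕ) * (D.x (realVec h') l * D.y (realVec n) l -
          D.x (realVec h) l * D.y (realVec n') l) =
          ((D.twist u h' n - D.twist u h n' : ℤ) : ℂ) := by
        push_cast
        rw [twist_eq, twist_eq, ← Finset.sum_sub_distrib]
        exact Finset.sum_congr rfl fun l _ => by ring
      have hlt : ‖((D.twist u h' n - D.twist u h n' : ℤ) : ℂ)‖ < 1 := by
        rw [← hInt]
        calc _ ≤ ∑ l : Fin s, C * (1 / ((s + 1) * C)) := by
              refine (norm_sum_le _ _).trans (Finset.sum_le_sum fun l _ => ?_)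
              rw [norm_mul]
              exact mul_le_mul (hC u l) (hsmall l).le (norm_nonneg _) (by linarith)
          _ = s / (s + 1) := by
              rw [Finset.sum_const, Finset.card_univ, Fintype.card_fin, nsmul_eq_mul]
              field_simp
          _ < 1 := by rw [div_lt_one (by positivity)]; linarith
      rw [hInt]
      rw [Complex.norm_intCast] at hlt
      have : D.twist u h' n - D.twist u h n' = 0 := Int.abs_lt_one_iff.mp (by exact_mod_cast hlt)
      rw [this, Int.cast_zero]
  exact fun l => sub_eq_zero.mp (congrFun hv l)

lemma eq_mulVec_x (h : Fin s → ℝ) (i : Fin s) : (h i : ℂ) = ∑ l, D.V i l * D.x h l := by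
  have : D.V *ᵥ D.x h = fun i => (h i : ℂ) := by
    rw [x_eq_mulVec, Matrix.mulVec_mulVec, D.VW, Matrix.one_mulVec]
  exact (congrFun this i).symm

lemma x_injective : Function.Injective D.x := fun h k hk => by
  ext i
  have h₁ := D.eq_mulVec_x h i
  rw [hk, ← D.eq_mulVec_x k i] at h₁
  exact_mod_cast h₁

/-- A common constant controlling the coordinate changes. -/
lemma exists_coord_bound : ∃ C : ℝ, 1 ≤ C ∧ (∀ h l, ‖D.x h l‖ ≤ C * ‖h‖) ∧
    (∀ h l, ‖D.y h l‖ ≤ C * ‖h‖) ∧ (∀ h, ‖h‖ ≤ C * ‖D.x h‖) ∧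
    (∀ α l, ‖D.L α l‖ ≤ C * ‖α‖) ∧ (∀ i l, ‖D.V i l‖ ≤ C) := by
  obtain ⟨C₁, h₁, hx⟩ := norm_realToComplexLin_le D.W
  obtain ⟨C₂, h₂, hy⟩ := norm_realToComplexLin_le D.Vᵀ
  set C₃ := ∑ i, ∑ l, ‖D.V i l‖ with hC₃
  set C₄ := ∑ l, (‖D.ρ l‖ + ‖D.σ l‖) with hC₄
  have h₃ : 0 ≤ C₃ := by positivity
  have h₄ : 0 ≤ C₄ := by positivity
  have hrow : ∀ i, ∑ l, ‖D.V i l‖ ≤ C₃ := fun i =>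
    Finset.single_le_sum (f := fun i => ∑ l, ‖D.V i l‖) (fun l _ => by positivity)
      (Finset.mem_univ i)
  refine ⟨C₁ + C₂ + C₃ + C₄, by linarith, fun h l => (hx h l).trans ?_,
    fun h l => (hy h l).trans ?_, fun h => ?_, fun α l => ?_, fun i l => ?_⟩
  · gcongr; linarith
  · gcongr; linarith
  · refine (pi_norm_le_iff_of_nonneg (by positivity)).mpr fun i => ?_
    rw [← Complex.norm_real, D.eq_mulVec_x h i]
    calc _ ≤ ∑ l, ‖D.V i l‖ * ‖D.x h‖ := by
          refine (norm_sum_le _ _).trans (Finset.sum_le_sum fun l _ => ?_)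
          rw [norm_mul]
          gcongr
          exact norm_le_pi_norm _ l
      _ = (∑ l, ‖D.V i l‖) * ‖D.x h‖ := by rw [Finset.sum_mul]
      _ ≤ _ := by
          gcongr
          linarith [hrow i]
  · have hl : ‖D.ρ l‖ + ‖D.σ l‖ ≤ C₄ :=
      Finset.single_le_sum (f := fun l => ‖D.ρ l‖ + ‖D.σ l‖) (fun l _ => by positivity)
        (Finset.mem_univ l)
    calc ‖D.L α l‖ ≤ ‖α.1‖ * ‖D.ρ l‖ + ‖α.2‖ * ‖D.σ l‖ := by
          refine (norm_add_le _ _).trans ?_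
          rw [norm_mul, norm_mul, Complex.norm_real, Complex.norm_real]
      _ ≤ ‖α‖ * ‖D.ρ l‖ + ‖α‖ * ‖D.σ l‖ := by
          gcongr
          · exact norm_fst_le α
          · exact norm_snd_le α
      _ = (‖D.ρ l‖ + ‖D.σ l‖) * ‖α‖ := by ring
      _ ≤ _ := by exact mul_le_mul_of_nonneg_right (by linarith) (norm_nonneg _)
  · have := Finset.single_le_sum (f := fun l => ‖D.V i l‖) (fun l _ => by positivity)
      (Finset.mem_univ l)
    have := hrow i
    linarith

end Pencil

/-- A finite set injecting into the integers of absolute value at most `y` has at most `2 * y + 1`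
elements. -/
lemma card_le_of_injOn_int {ι : Type*} (S : Finset ι) (f : ι → ℤ) {y : ℝ}
    (hy0 : 0 ≤ y) (hf : Set.InjOn f S) (hy : ∀ i ∈ S, |(f i : ℝ)| ≤ y) :
    (S.card : ℝ) ≤ 2 * y + 1 := by
  have hsub : S.image f ⊆ Finset.Icc (-⌊y⌋) ⌊y⌋ := by
    intro z hz
    obtain ⟨i, hi, rfl⟩ := Finset.mem_image.mp hz
    have := abs_le.mp (hy i hi)
    rw [Finset.mem_Icc]
    refine ⟨?_, Int.le_floor.mpr this.2⟩
    rw [neg_le]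
    exact Int.le_floor.mpr (by push_cast; linarith [this.1])
  have hcard := Finset.card_le_card hsub
  rw [Finset.card_image_of_injOn hf, Int.card_Icc] at hcard
  have h0 : 0 ≤ ⌊y⌋ := Int.floor_nonneg.mpr hy0
  have : (S.card : ℝ) ≤ ((⌊y⌋ + 1 - -⌊y⌋).toNat : ℝ) := by exact_mod_cast hcard
  have e : ((⌊y⌋ + 1 - -⌊y⌋).toNat : ℝ) = ((⌊y⌋ + 1 - -⌊y⌋ : ℤ) : ℝ) := by
    exact_mod_cast Int.toNat_of_nonneg (by omega)
  rw [e] at this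
  push_cast at this
  linarith [Int.floor_le y]

lemma finite_int_ball {s : ℕ} (R : ℝ) : {h : Fin s → ℤ | ‖realVec h‖ ≤ R}.Finite := by
  refine (Set.Finite.pi' (fun _ : Fin s => Set.finite_Icc (-⌊R⌋) ⌊R⌋)).subset fun h hh i => ?_
  have : |(h i : ℝ)| ≤ R := (norm_le_pi_norm (realVec h) i).trans hh
  obtain ⟨h₁, h₂⟩ := abs_le.mp this
  exact ⟨neg_le.mp (Int.le_floor.mpr (by push_cast; linarith)), Int.le_floor.mpr h₂⟩

/-- The integer vectors counted after Weyl differencing. -/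
def weylSet {s : ℕ} (B₁ B₂ : Matrix (Fin s) (Fin s) ℤ) (c P : ℝ) (α : ℝ × ℝ) :
    Set (Fin s → ℤ) :=
  {h | ‖realVec h‖ ≤ c * P ∧
    ∃ n : Fin s → ℤ, ‖pencilMap B₁ B₂ α (realVec h) - realVec n‖ ≤ c / P}

lemma weylSet_finite {s : ℕ} (B₁ B₂ : Matrix (Fin s) (Fin s) ℤ) (c P : ℝ) (α : ℝ × ℝ) :
    (weylSet B₁ B₂ c P α).Finite :=
  (finite_int_ball (c * P)).subset fun _ h => h.1

open scoped Pointwise in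
/-- Packing bound for points that are separated relative to the body `|(X t)_l| ≤ a_l`. -/
lemma packing_bound {s : ℕ} (X : (Fin s → ℝ) →ₗ[ℝ] (Fin s → ℂ)) {C : ℝ} (hC : 0 < C)
    (hX : ∀ h l, ‖X h l‖ ≤ C * ‖h‖) (hX' : ∀ h, ‖h‖ ≤ C * ‖X h‖)
    {a : Fin s → ℝ} (ha : ∀ l, 0 < a l) {Z : ℝ} (hZ : 0 < Z) (T : Finset (Fin s → ℝ))
    (hT : ∀ t ∈ T, ∀ l, ‖X t l‖ ≤ a l)
    (hsep : ∀ t ∈ T, ∀ t' ∈ T, t ≠ t' → ∃ l, a l / Z < ‖X (t - t') l‖) :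
    (T.card : ℝ) ≤ (2 * Z + 1) ^ s := by
  set B : ℝ → Set (Fin s → ℝ) := fun r => {y | ∀ l, ‖X y l‖ ≤ r * a l} with hB
  have hXc : Continuous X := X.continuous_of_finiteDimensional
  have hmeas : ∀ r, MeasurableSet (B r) := fun r => by
    have : B r = ⋂ l, {y | ‖X y l‖ ≤ r * a l} := by ext y; simp [hB]
    rw [this]
    refine (isClosed_iInter fun l => isClosed_le ?_ continuous_const).measurableSet
    exact ((continuous_apply l).comp hXc).norm
  have hvol : ∀ r, 0 < r → volume (B r) = ENNReal.ofReal (r ^ s) * volume (B 1) := fun r hr => by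
    have : B r = r • B 1 := by
      ext y
      rw [Set.mem_smul_set_iff_inv_smul_mem₀ hr.ne']
      simp only [hB, Set.mem_ofPred_eq, map_smul, Pi.smul_apply, norm_smul, norm_inv,
        Real.norm_eq_abs, abs_of_pos hr, one_mul]
      exact forall_congr' fun l => by rw [inv_mul_le_iff₀ hr]
    rw [this, Measure.addHaar_smul, Module.finrank_fintype_fun_eq_card, Fintype.card_fin,
      abs_of_nonneg (by positivity)]
  obtain ⟨am, ham, hamle⟩ : ∃ am : ℝ, 0 < am ∧ ∀ l, am ≤ a l := by
    rcases isEmpty_or_nonempty (Fin s) with h | h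
    · exact ⟨1, one_pos, fun l => (h.false l).elim⟩
    · obtain ⟨l, hl⟩ := Finite.exists_min a
      exact ⟨a l, ha l, hl⟩
  have hpos : volume (B 1) ≠ 0 := by
    refine (lt_of_lt_of_le (Metric.measure_ball_pos volume (0 : Fin s → ℝ) (div_pos ham hC))
      (measure_mono (fun y hy => ?_))).ne'
    change ∀ l, _
    intro l
    rw [mem_ball_zero_iff, lt_div_iff₀ hC] at hy
    rw [one_mul]
    linarith [hX y l, hamle l]
  have hfin : volume (B 1) ≠ ⊤ := by
    refine ((measure_mono fun y hy => ?_).trans_lt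
      (measure_closedBall_lt_top (x := (0 : Fin s → ℝ)) (r := C * ∑ l, a l))).ne
    rw [mem_closedBall_zero_iff]
    refine (hX' y).trans (mul_le_mul_of_nonneg_left ?_ hC.le)
    refine (pi_norm_le_iff_of_nonneg (Finset.sum_nonneg fun l _ => (ha l).le)).mpr fun l => ?_
    refine (hy l).trans ?_
    rw [one_mul]
    exact Finset.single_le_sum (f := a) (fun l _ => (ha l).le) (Finset.mem_univ l)
  have hr : (0 : ℝ) < 1 / (2 * Z) := by positivity
  have hdisj : (T : Set (Fin s → ℝ)).PairwiseDisjoint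
      fun t => (fun y => y - t) ⁻¹' B (1 / (2 * Z)) := by
    intro t ht t' ht' htt'
    rw [Function.onFun, Set.disjoint_left]
    intro y hy hy'
    obtain ⟨l, hl⟩ := hsep t ht t' ht' htt'
    have h₁ := hy l
    have h₂ := hy' l
    have e : t - t' = (y - t') - (y - t) := by abel
    rw [e, map_sub, Pi.sub_apply] at hl
    have h₃ := norm_sub_le (X (y - t') l) (X (y - t) l)
    have : a l / Z = 1 / (2 * Z) * a l + 1 / (2 * Z) * a l := by field_simp; ring
    linarith
  have hsub : (⋃ t ∈ T, (fun y => y - t) ⁻¹' B (1 / (2 * Z))) ⊆ B (1 + 1 / (2 * Z)) := by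
    intro y hy l
    obtain ⟨t, ht, hyt⟩ := Set.mem_iUnion₂.mp hy
    have h₁ := hyt l
    have h₂ := hT t ht l
    have e : y = (y - t) + t := by abel
    rw [e, map_add, Pi.add_apply]
    have h₃ := norm_add_le (X (y - t) l) (X t l)
    linarith
  have hle := measure_mono (μ := volume) hsub
  rw [measure_biUnion_finset hdisj fun t _ => (measurable_id.sub_const t) (hmeas _)] at hle
  simp only [sub_eq_add_neg, measure_preimage_add_right] at hle
  rw [Finset.sum_const, hvol _ hr, hvol (1 + 1 / (2 * Z)) (by positivity), nsmul_eq_mul,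
    ← mul_assoc,
    ENNReal.mul_le_mul_iff_left hpos hfin, ← ENNReal.ofReal_natCast,
    ← ENNReal.ofReal_mul (Nat.cast_nonneg _), ENNReal.ofReal_le_ofReal_iff (by positivity)] at hle
  have e : (1 + 1 / (2 * Z)) ^ s = (2 * Z + 1) ^ s * (1 / (2 * Z)) ^ s := by
    rw [← mul_pow]
    congr 1
    field_simp
  rw [e] at hle
  exact le_of_mul_le_mul_right hle (by positivity)

namespace Pencil

variable {s : ℕ} {B₁ B₂ : Matrix (Fin s) (Fin s) ℤ} (D : Pencil s B₁ B₂)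

/-- A short integer vector `g` with at least two nonzero eigencoordinates for which the
eigencoordinates of `α·B g` are simultaneously close to those of the integer vector `n`. -/
structure Resonance (P Z : ℝ) (α : ℝ × ℝ) (a : Fin s → ℝ) (g n : Fin s → ℤ) : Prop where
  pos : ∀ l, 0 < a l
  le : ∀ l, a l ≤ P
  small : ∀ l, ‖D.x (realVec g) l‖ ≤ a l / Z
  approx : ∀ l, D.x (realVec g) l ≠ 0 →
    ‖D.L α l * D.x (realVec g) l - D.y (realVec n) l‖ ≤ ‖D.x (realVec g) l‖ / (P * a l)
  two : ∃ l m, l ≠ m ∧ D.x (realVec g) l ≠ 0 ∧ D.x (realVec g) m ≠ 0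

lemma exists_V_ne_zero (l : Fin s) : ∃ r, D.V r l ≠ 0 := by
  by_contra! h
  have := congrFun (congrFun D.WV l) l
  simp [Matrix.mul_apply, h] at this

theorem exists_resonance (hs : 0 < s) :
    ∃ c C₀ : ℝ, 0 < c ∧ c ≤ 1 / 2 ∧ 1 ≤ C₀ ∧ ∀ P Z : ℝ, ∀ α : ℝ × ℝ,
    1 ≤ Z → Z ≤ P → C₀ * P * Z ^ ((s : ℝ) - 1) ≤ (weylSet B₁ B₂ c P α).ncard →
    ∃ a g n, D.Resonance P Z α a g n := by
  classical
  obtain ⟨C, hC1, hx, hy, hx', -, hV⟩ := D.exists_coord_bound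
  obtain ⟨c₀, hc₀, hgap⟩ := D.exists_gap
  have hC0 : 0 < C := by linarith
  set m := min (1 / 2 : ℝ) (c₀ / 4) with hm
  have hm0 : 0 < m := by positivity
  have hm2 : m ≤ 1 / 2 := min_le_left _ _
  have hm4 : m ≤ c₀ / 4 := min_le_right _ _
  set c := m / C with hc
  have hcC : C * c = m := by rw [hc]; field_simp
  have hc0 : 0 < c := by positivity
  refine ⟨c, s * (2 * C + 1) * 3 ^ s + 1, hc0, ?_, ?_, ?_⟩
  · rw [hc, div_le_iff₀ hC0]; nlinarith
  · have : 0 ≤ s * (2 * C + 1) * 3 ^ s := by positivity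
    linarith
  intro P Z α hZ hZP hN
  have hP : 0 < P := by linarith
  have hZ0 : 0 < Z := by linarith
  set H := (weylSet_finite B₁ B₂ c P α).toFinset with hH
  have hmemH : ∀ h, h ∈ H ↔ h ∈ weylSet B₁ B₂ c P α := fun h => Set.Finite.mem_toFinset _
  rw [Set.ncard_eq_toFinset_card _ (weylSet_finite B₁ B₂ c P α)] at hN
  have h0H : (0 : Fin s → ℤ) ∈ H := by
    rw [hmemH]
    have e : realVec (0 : Fin s → ℤ) = 0 := by ext i; simp [realVec]
    refine ⟨by rw [e, norm_zero]; positivity, 0, ?_⟩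
    rw [e, map_zero, sub_zero, norm_zero]
    positivity
  have hchoose : ∀ h, ∃ n : Fin s → ℤ, h ∈ H →
      ‖pencilMap B₁ B₂ α (realVec h) - realVec n‖ ≤ c / P := by
    intro h
    by_cases hh : h ∈ H
    · obtain ⟨n, hn⟩ := ((hmemH h).mp hh).2
      exact ⟨n, fun _ => hn⟩
    · exact ⟨0, fun h' => absurd h' hh⟩
  choose ν hν using hchoose
  have hxm : ∀ h ∈ H, ∀ l, ‖D.x (realVec h) l‖ ≤ m * P := fun h hh l => by
    refine (hx _ l).trans ?_
    rw [← hcC, mul_assoc]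
    exact mul_le_mul_of_nonneg_left ((hmemH h).mp hh).1 hC0.le
  have hem : ∀ h ∈ H, ∀ l,
      ‖D.L α l * D.x (realVec h) l - D.y (realVec (ν h)) l‖ ≤ m / P := fun h hh l => by
    rw [← y_pencilMap, ← Pi.sub_apply, ← map_sub]
    refine (hy _ l).trans ?_
    rw [← hcC, mul_div_assoc]
    exact mul_le_mul_of_nonneg_left (hν h hh) hC0.le
  -- proportionality of the error terms
  have hprop : ∀ h ∈ H, ∀ h' ∈ H, ∀ l,
      D.x (realVec h') l * (D.L α l * D.x (realVec h) l - D.y (realVec (ν h)) l) =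
      D.x (realVec h) l * (D.L α l * D.x (realVec h') l - D.y (realVec (ν h')) l) := by
    intro h hh h' hh' l
    have key := hgap h (ν h) h' (ν h') ?_ l
    · linear_combination -key
    · intro l
      have e : D.x (realVec h') l * D.y (realVec (ν h)) l
          - D.x (realVec h) l * D.y (realVec (ν h')) l =
          D.x (realVec h) l * (D.L α l * D.x (realVec h') l - D.y (realVec (ν h')) l)
          - D.x (realVec h') l * (D.L α l * D.x (realVec h) l - D.y (realVec (ν h)) l) := by ring
      rw [e]
      calc _ ≤ m * P * (m / P) + m * P * (m / P) := by
            refine (norm_sub_le _ _).trans ?_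
            rw [norm_mul, norm_mul]
            gcongr
            · exact hxm h hh l
            · exact hem h' hh' l
            · exact hxm h' hh' l
            · exact hem h hh l
        _ = 2 * m * m := by field_simp; ring
        _ < c₀ := by nlinarith
  have hmaxex : ∀ l, ∃ h' ∈ H, ∀ h ∈ H, ‖D.x (realVec h) l‖ ≤ ‖D.x (realVec h') l‖ := fun l =>
    Finset.exists_max_image H (fun h => ‖D.x (realVec h) l‖) ⟨0, h0H⟩
  choose hmax hmaxH hmaxle using hmaxex
  set a : Fin s → ℝ := fun l => if ‖D.x (realVec (hmax l)) l‖ = 0 then 1 else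
    ‖D.x (realVec (hmax l)) l‖ with ha
  have ha0 : ∀ l, 0 < a l := fun l => by
    simp only [ha]
    split_ifs with h
    · exact one_pos
    · exact lt_of_le_of_ne (norm_nonneg _) (Ne.symm h)
  have haP : ∀ l, a l ≤ P := fun l => by
    simp only [ha]
    split_ifs with h
    · linarith
    · refine (hxm _ (hmaxH l) l).trans ?_
      nlinarith
  have hxa : ∀ h ∈ H, ∀ l, ‖D.x (realVec h) l‖ ≤ a l := fun h hh l => by
    have := hmaxle l h hh
    simp only [ha]
    split_ifs with h0
    · linarith
    · exact this
  -- differences of elements of `H` satisfy the approximation property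
  have happrox : ∀ h ∈ H, ∀ k ∈ H, ∀ l, D.x (realVec (h - k)) l ≠ 0 →
      ‖D.L α l * D.x (realVec (h - k)) l - D.y (realVec (ν h - ν k)) l‖ ≤
      ‖D.x (realVec (h - k)) l‖ / (P * a l) := by
    intro h hh k hk l hne
    have h₁ := hprop h hh (hmax l) (hmaxH l) l
    have h₂ := hprop k hk (hmax l) (hmaxH l) l
    have hmne : ‖D.x (realVec (hmax l)) l‖ ≠ 0 := by
      intro h0
      apply hne
      have e₁ := hmaxle l h hh
      have e₂ := hmaxle l k hk
      rw [h0, norm_le_zero_iff] at e₁ e₂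
      rw [realVec_sub, map_sub, Pi.sub_apply, e₁, e₂, sub_zero]
    have hal : a l = ‖D.x (realVec (hmax l)) l‖ := by simp only [ha]; rw [if_neg hmne]
    rw [le_div_iff₀ (mul_pos hP (ha0 l)), hal]
    have e : D.x (realVec (hmax l)) l *
        (D.L α l * D.x (realVec (h - k)) l - D.y (realVec (ν h - ν k)) l) =
        D.x (realVec (h - k)) l *
        (D.L α l * D.x (realVec (hmax l)) l - D.y (realVec (ν (hmax l))) l) := by
      simp only [realVec_sub, map_sub, Pi.sub_apply]
      linear_combination h₁ - h₂
    have e' := congrArg norm e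
    rw [norm_mul, norm_mul] at e'
    have h₃ := hem _ (hmaxH l) l
    calc _ = P * (‖D.x (realVec (hmax l)) l‖ *
          ‖D.L α l * D.x (realVec (h - k)) l - D.y (realVec (ν h - ν k)) l‖) := by ring
      _ ≤ P * (‖D.x (realVec (h - k)) l‖ * (m / P)) := by rw [e']; gcongr
      _ = m * ‖D.x (realVec (h - k)) l‖ := by field_simp
      _ ≤ _ := by nlinarith [norm_nonneg (D.x (realVec (h - k)) l)]
  -- a maximal separated subset
  let sep : Finset (Fin s → ℤ) → Prop := fun T =>
    ∀ t ∈ T, ∀ t' ∈ T, t ≠ t' → ∃ l, a l / Z < ‖D.x (realVec (t - t')) l‖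
  obtain ⟨T, hTmem, hTmax⟩ := Finset.exists_max_image (H.powerset.filter sep) Finset.card
    ⟨∅, by simp [sep]⟩
  rw [Finset.mem_filter, Finset.mem_powerset] at hTmem
  obtain ⟨hTH, hTsep⟩ := hTmem
  have hTcard : (T.card : ℝ) ≤ (3 * Z) ^ s := by
    have := packing_bound D.x hC0 hx hx' ha0 hZ0 (T.image realVec) ?_ ?_
    · rw [Finset.card_image_of_injective _ realVec_injective] at this
      exact this.trans (pow_le_pow_left₀ (by positivity) (by linarith) s)
    · intro t ht
      obtain ⟨h, hh, rfl⟩ := Finset.mem_image.mp ht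
      exact hxa h (hTH hh)
    · intro t ht t' ht' hne
      obtain ⟨h, hh, rfl⟩ := Finset.mem_image.mp ht
      obtain ⟨h', hh', rfl⟩ := Finset.mem_image.mp ht'
      rw [← realVec_sub]
      exact hTsep h hh h' hh' fun e => hne (by rw [e])
  have hcover : ∀ h ∈ H, ∃ t ∈ T, ∀ l, ‖D.x (realVec (h - t)) l‖ ≤ a l / Z := by
    intro h hh
    by_contra! hcon
    have hhT : h ∉ T := fun hT => by
      obtain ⟨l, hl⟩ := hcon h hT
      rw [sub_self] at hl
      have e : realVec (0 : Fin s → ℤ) = 0 := by ext i; simp [realVec]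
      rw [e, map_zero, Pi.zero_apply, norm_zero] at hl
      exact absurd hl (not_lt.mpr (div_nonneg (ha0 l).le hZ0.le))
    have := hTmax (insert h T) (by
      rw [Finset.mem_filter, Finset.mem_powerset]
      refine ⟨Finset.insert_subset hh hTH, ?_⟩
      intro t ht t' ht' hne
      rw [Finset.mem_insert] at ht ht'
      rcases ht with rfl | ht <;> rcases ht' with rfl | ht'
      · exact absurd rfl hne
      · exact hcon t' ht'
      · obtain ⟨l, hl⟩ := hcon t ht
        refine ⟨l, ?_⟩
        rwa [realVec_sub, ← norm_neg, ← Pi.neg_apply, ← map_neg, neg_sub, ← realVec_sub]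
      · exact hTsep t ht t' ht' hne)
    rw [Finset.card_insert_of_notMem hhT] at this
    omega
  by_contra hno
  -- all points of a cluster lie on one of the coordinate lines through its centre
  have hline : ∀ t ∈ T, ∀ h ∈ H, (∀ l, ‖D.x (realVec (h - t)) l‖ ≤ a l / Z) →
      ∀ l l', l ≠ l' → D.x (realVec (h - t)) l ≠ 0 → D.x (realVec (h - t)) l' = 0 := by
    intro t ht h hh hsm l l' hll hl
    by_contra hl'
    exact hno ⟨a, h - t, ν h - ν t, ha0, haP, hsm, happrox h hh t (hTH ht), l, l', hll, hl, hl'⟩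
  let cl : (Fin s → ℤ) → Fin s → Finset (Fin s → ℤ) := fun t l =>
    H.filter fun h => (∀ l', l' ≠ l → D.x (realVec (h - t)) l' = 0) ∧
      ‖D.x (realVec (h - t)) l‖ ≤ a l / Z
  have hclcard : ∀ t l, ((cl t l).card : ℝ) ≤ (2 * C + 1) * (P / Z) := by
    intro t l
    obtain ⟨r, hr⟩ := D.exists_V_ne_zero l
    have hval : ∀ h ∈ cl t l, ((h r - t r : ℤ) : ℂ) = D.V r l * D.x (realVec (h - t)) l := by
      intro h hh
      obtain ⟨-, hz, -⟩ := Finset.mem_filter.mp hh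
      have := D.eq_mulVec_x (realVec (h - t)) r
      rw [Finset.sum_eq_single l (fun l' _ hl' => by rw [hz l' hl', mul_zero])
        (fun h => absurd (Finset.mem_univ l) h)] at this
      rw [← this]
      simp [realVec]
    have h₁ := card_le_of_injOn_int (cl t l) (fun h => h r - t r) (y := C * (P / Z))
      (by positivity) ?_ ?_
    · have : 1 ≤ P / Z := by rw [le_div_iff₀ hZ0]; linarith
      nlinarith
    · intro h hh k hk hhk
      have e₁ := hval h hh
      have e₂ := hval k hk
      simp only at hhk
      rw [hhk, e₂] at e₁
      have e₃ := mul_left_cancel₀ hr e₁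
      have e₄ : D.x (realVec (h - t)) = D.x (realVec (k - t)) := by
        ext l'
        by_cases hl' : l' = l
        · rw [hl', e₃]
        · rw [(Finset.mem_filter.mp hh).2.1 l' hl', (Finset.mem_filter.mp hk).2.1 l' hl']
      exact sub_left_injective (realVec_injective (D.x_injective e₄))
    · intro h hh
      have e := congrArg norm (hval h hh)
      rw [Complex.norm_intCast, norm_mul] at e
      rw [e]
      have h₂ := (Finset.mem_filter.mp hh).2.2
      have h₃ : a l / Z ≤ P / Z := by gcongr; exact haP l
      exact mul_le_mul (hV r l) (h₂.trans h₃) (norm_nonneg _) hC0.le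
  have hcov : H ⊆ T.biUnion fun t => Finset.univ.biUnion (cl t) := by
    intro h hh
    obtain ⟨t, ht, hsm⟩ := hcover h hh
    rw [Finset.mem_biUnion]
    refine ⟨t, ht, ?_⟩
    rw [Finset.mem_biUnion]
    by_cases hz : ∃ l, D.x (realVec (h - t)) l ≠ 0
    · obtain ⟨l, hl⟩ := hz
      exact ⟨l, Finset.mem_univ _, Finset.mem_filter.mpr
        ⟨hh, fun l' hl' => hline t ht h hh hsm l l' hl'.symm hl, hsm l⟩⟩
    · push Not at hz
      exact ⟨⟨0, hs⟩, Finset.mem_univ _, Finset.mem_filter.mpr ⟨hh, fun l' _ => hz l', hsm _⟩⟩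
  have hbound : (H.card : ℝ) ≤ (3 * Z) ^ s * (s * ((2 * C + 1) * (P / Z))) := by
    calc (H.card : ℝ) ≤ ((T.biUnion fun t => Finset.univ.biUnion (cl t)).card : ℝ) := by
          exact_mod_cast Finset.card_le_card hcov
      _ ≤ ∑ t ∈ T, ∑ l, ((cl t l).card : ℝ) := by
          have h₁ : (T.biUnion fun t => Finset.univ.biUnion (cl t)).card ≤
              ∑ t ∈ T, ∑ l, (cl t l).card :=
            Finset.card_biUnion_le.trans (Finset.sum_le_sum fun t _ => Finset.card_biUnion_le)
          exact_mod_cast h₁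
      _ ≤ ∑ t ∈ T, ∑ l : Fin s, (2 * C + 1) * (P / Z) :=
          Finset.sum_le_sum fun t _ => Finset.sum_le_sum fun l _ => hclcard t l
      _ = T.card * (s * ((2 * C + 1) * (P / Z))) := by simp
      _ ≤ _ := by gcongr
  have hpw : Z ^ s * (P / Z) = P * Z ^ ((s : ℝ) - 1) := by
    rw [Real.rpow_sub_one hZ0.ne', Real.rpow_natCast]
    ring
  have e : (3 * Z) ^ s * (s * ((2 * C + 1) * (P / Z))) =
      s * (2 * C + 1) * 3 ^ s * (P * Z ^ ((s : ℝ) - 1)) := by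
    rw [← hpw, mul_pow]; ring
  rw [e] at hbound
  have hp : 0 < P * Z ^ ((s : ℝ) - 1) := by positivity
  have : H.card < (s * (2 * C + 1) * 3 ^ s + 1) * P * Z ^ ((s : ℝ) - 1) := by nlinarith
  linarith

end Pencil

lemma pencilMap_one_zero {s : ℕ} (B₁ B₂ : Matrix (Fin s) (Fin s) ℤ) (g : Fin s → ℤ) :
    pencilMap B₁ B₂ (1, 0) (realVec g) = realVec (B₁ *ᵥ g) := by
  ext i
  simp [pencilMap_apply, realVec, mulVec, dotProduct]

lemma pencilMap_zero_one {s : ℕ} (B₁ B₂ : Matrix (Fin s) (Fin s) ℤ) (g : Fin s → ℤ) :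
    pencilMap B₁ B₂ (0, 1) (realVec g) = realVec (B₂ *ᵥ g) := by
  ext i
  simp [pencilMap_apply, realVec, mulVec, dotProduct]

/-- Putting a pair of rationals with a common denominator in lowest terms. -/
lemma exists_lowest_terms (d a₁ a₂ : ℤ) (hd : d ≠ 0) : ∃ (q : ℕ) (b₁ b₂ : ℤ), 1 ≤ q ∧
    (q : ℝ) ≤ |(d : ℝ)| ∧ Int.gcd (Int.gcd b₁ b₂) q = 1 ∧
    (b₁ : ℝ) / q = a₁ / d ∧ (b₂ : ℝ) / q = a₂ / d := by
  set e : ℕ := Int.gcd (Int.gcd a₁ a₂) d with he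
  have he0 : 0 < e := Int.gcd_pos_of_ne_zero_right _ hd
  have he1 : (e : ℤ) ∣ a₁ := (Int.gcd_dvd_left _ _).trans (Int.gcd_dvd_left _ _)
  have he2 : (e : ℤ) ∣ a₂ := (Int.gcd_dvd_left _ _).trans (Int.gcd_dvd_right _ _)
  have hed : (e : ℤ) ∣ d := Int.gcd_dvd_right _ _
  obtain ⟨c₁, hc₁⟩ := he1
  obtain ⟨c₂, hc₂⟩ := he2
  obtain ⟨k, hk⟩ := hed
  have hk0 : k ≠ 0 := by rintro rfl; simp at hk; exact hd hk
  have hcop : Int.gcd (Int.gcd c₁ c₂) k = 1 := by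
    have h : e = e * Int.gcd (Int.gcd c₁ c₂) k := by
      have h1 : (Int.gcd a₁ a₂) = e * Int.gcd c₁ c₂ := by
        rw [hc₁, hc₂, Int.gcd_mul_left, Int.natAbs_natCast]
      have h2 : e = Int.gcd ((e * Int.gcd c₁ c₂ : ℕ) : ℤ) (e * k) := by
        rw [← h1, ← hk]
      push_cast at h2
      rw [Int.gcd_mul_left, Int.natAbs_natCast] at h2
      exact h2
    have h' : e * 1 = e * Int.gcd (Int.gcd c₁ c₂) k := by rw [mul_one]; exact h
    exact (Nat.eq_of_mul_eq_mul_left he0 h').symm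
  have heR : (1 : ℝ) ≤ e := by exact_mod_cast he0
  have hdR : (d : ℝ) = e * k := by rw [hk]; push_cast; ring
  have hkR : (k : ℝ) ≠ 0 := by exact_mod_cast hk0
  have hle : |(k : ℝ)| ≤ |(d : ℝ)| := by
    rw [hdR, abs_mul, abs_of_pos (by linarith : (0 : ℝ) < e)]
    nlinarith [abs_nonneg (k : ℝ)]
  have hsgn : (k.sign : ℝ) * k = |(k : ℝ)| := by exact_mod_cast Int.sign_mul_self_eq_abs k
  have habs : |(k : ℝ)| ≠ 0 := abs_ne_zero.mpr hkR
  refine ⟨k.natAbs, k.sign * c₁, k.sign * c₂, Int.natAbs_pos.mpr hk0, ?_, ?_, ?_, ?_⟩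
  · rw [Nat.cast_natAbs, Int.cast_abs]
    exact hle
  · rw [Int.gcd_mul_left, Int.natAbs_sign_of_ne_zero hk0, one_mul]
    rw [← hcop, Int.gcd_def, Int.gcd_def, Int.natAbs_natCast, Int.natAbs_natCast]
    rfl
  · rw [Nat.cast_natAbs, Int.cast_abs, hc₁, hdR]
    push_cast
    field_simp
    linear_combination (c₁ : ℝ) * hsgn
  · rw [Nat.cast_natAbs, Int.cast_abs, hc₂, hdR]
    push_cast
    field_simp
    linear_combination (c₂ : ℝ) * hsgn

namespace Pencil

variable {s : ℕ} {B₁ B₂ : Matrix (Fin s) (Fin s) ℤ} (D : Pencil s B₁ B₂)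

lemma y_B₁ (g : Fin s → ℤ) (l : Fin s) :
    D.y (realVec (B₁ *ᵥ g)) l = D.ρ l * D.x (realVec g) l := by
  rw [← pencilMap_one_zero B₁ B₂, y_pencilMap]; simp [L]

lemma y_B₂ (g : Fin s → ℤ) (l : Fin s) :
    D.y (realVec (B₂ *ᵥ g)) l = D.σ l * D.x (realVec g) l := by
  rw [← pencilMap_zero_one B₁ B₂, y_pencilMap]; simp [L]

lemma eq_zero_of_double_vandermonde {c : Fin s → Fin s → ℂ}
    (hc : ∀ u v : Fin s, ∑ l, ∑ m, D.θ l ^ (u : ℕ) * D.θ m ^ (v : ℕ) * c l m = 0) (l m : Fin s) :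
    c l m = 0 := by
  have h₁ : ∀ v : Fin s, (fun l => ∑ m, D.θ m ^ (v : ℕ) * c l m) = 0 := fun v =>
    D.eq_zero_of_vandermonde fun u => by
      rw [← hc u v]
      refine Finset.sum_congr rfl fun l _ => ?_
      rw [Finset.mul_sum]
      exact Finset.sum_congr rfl fun m _ => by ring
  exact congrFun (D.eq_zero_of_vandermonde (v := c l) fun v => congrFun (h₁ v) l) m

/-- Any two of the forms `L_l` determine `δ`. -/
lemma exists_indep_bound : ∃ C : ℝ, 1 ≤ C ∧ ∀ i j, i ≠ j → ∀ δ : ℝ × ℝ,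
    ‖δ‖ ≤ C * (‖D.L δ i‖ + ‖D.L δ j‖) := by
  set f : Fin s → Fin s → ℝ := fun i j =>
    (‖D.ρ i‖ + ‖D.ρ j‖ + ‖D.σ i‖ + ‖D.σ j‖) / ‖D.ρ i * D.σ j - D.ρ j * D.σ i‖ with hf
  have hf0 : ∀ i j, 0 ≤ f i j := fun i j => by positivity
  refine ⟨1 + ∑ i, ∑ j, f i j, ?_, fun i j hij δ => ?_⟩
  · have := Finset.sum_nonneg fun i (_ : i ∈ Finset.univ) =>
      Finset.sum_nonneg fun j (_ : j ∈ Finset.univ) => hf0 i j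
    linarith
  · have hle : f i j ≤ ∑ i, ∑ j, f i j :=
      (Finset.single_le_sum (f := fun j => f i j) (fun j _ => hf0 i j) (Finset.mem_univ j)).trans
      (Finset.single_le_sum (f := fun i => ∑ j, f i j)
        (fun i _ => Finset.sum_nonneg fun j _ => hf0 i j) (Finset.mem_univ i))
    have hd := norm_pos_iff.mpr (D.indep i j hij)
    have e₁ : (δ.1 : ℂ) * (D.ρ i * D.σ j - D.ρ j * D.σ i) =
        D.L δ i * D.σ j - D.L δ j * D.σ i := by simp only [L]; ring
    have e₂ : (δ.2 : ℂ) * (D.ρ i * D.σ j - D.ρ j * D.σ i) =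
        D.L δ j * D.ρ i - D.L δ i * D.ρ j := by simp only [L]; ring
    have key : ‖δ‖ ≤ f i j * (‖D.L δ i‖ + ‖D.L δ j‖) := by
      rw [hf]
      simp only
      rw [div_mul_eq_mul_div, le_div_iff₀ hd]
      have a₁ := congrArg norm e₁
      have a₂ := congrArg norm e₂
      rw [norm_mul, Complex.norm_real] at a₁ a₂
      have b₁ := norm_sub_le (D.L δ i * D.σ j) (D.L δ j * D.σ i)
      have b₂ := norm_sub_le (D.L δ j * D.ρ i) (D.L δ i * D.ρ j)
      rw [norm_mul, norm_mul] at b₁ b₂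
      have n₁ := norm_nonneg (D.L δ i)
      have n₂ := norm_nonneg (D.L δ j)
      have n₃ := norm_nonneg (D.ρ i)
      have n₄ := norm_nonneg (D.ρ j)
      have n₅ := norm_nonneg (D.σ i)
      have n₆ := norm_nonneg (D.σ j)
      rcases le_total ‖δ.1‖ ‖δ.2‖ with h | h
      · rw [Prod.norm_def, max_eq_right h, a₂]
        nlinarith [mul_nonneg n₁ n₃, mul_nonneg n₁ n₅, mul_nonneg n₁ n₆, mul_nonneg n₂ n₄,
          mul_nonneg n₂ n₅, mul_nonneg n₂ n₆]
      · rw [Prod.norm_def, max_eq_left h, a₁]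
        nlinarith [mul_nonneg n₁ n₃, mul_nonneg n₁ n₅, mul_nonneg n₁ n₄, mul_nonneg n₂ n₄,
          mul_nonneg n₂ n₃, mul_nonneg n₂ n₆]
    refine key.trans (mul_le_mul_of_nonneg_right (by linarith) (by positivity))

/-- For every possible support of a vector of eigencoordinates, a fixed integer witness. -/
lemma exists_support_witness : ∃ C : ℝ, 1 ≤ C ∧ ∀ g : Fin s → ℤ, ∃ k : Fin s → ℤ,
    (∀ l, D.x (realVec k) l = 0 ↔ D.x (realVec g) l = 0) ∧ ∀ l, ‖D.x (realVec k) l‖ ≤ C := by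
  classical
  let sup : (Fin s → ℤ) → Finset (Fin s) := fun g => univ.filter fun l => D.x (realVec g) l = 0
  let w : Finset (Fin s) → (Fin s → ℤ) := fun S => if h : ∃ g, sup g = S then h.choose else 0
  refine ⟨1 + ∑ S, ∑ l, ‖D.x (realVec (w S)) l‖, ?_, fun g => ⟨w (sup g), fun l => ?_, fun l => ?_⟩⟩
  · have : 0 ≤ ∑ S, ∑ l, ‖D.x (realVec (w S)) l‖ := by positivity
    linarith
  · have hex : ∃ g', sup g' = sup g := ⟨g, rfl⟩
    have hw : sup (w (sup g)) = sup g := by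
      simp only [w]
      rw [dif_pos hex]
      exact hex.choose_spec
    have := Finset.ext_iff.mp hw l
    simpa [sup] using this
  · have h₁ := Finset.single_le_sum (f := fun S => ∑ l, ‖D.x (realVec (w S)) l‖)
      (fun S _ => Finset.sum_nonneg fun l _ => norm_nonneg _) (Finset.mem_univ (sup g))
    have h₂ := Finset.single_le_sum (f := fun l => ‖D.x (realVec (w (sup g))) l‖)
      (fun l _ => norm_nonneg _) (Finset.mem_univ l)
    linarith

theorem exists_resonance_minors : ∃ C : ℝ, 1 ≤ C ∧ ∀ (P Z : ℝ) (α : ℝ × ℝ) a g n, 0 < P → 0 < Z →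
    D.Resonance P Z α a g n → ∃ i j, i ≠ j ∧ D.x (realVec g) i ≠ 0 ∧ D.x (realVec g) j ≠ 0 ∧
    (∀ l, D.x (realVec g) l ≠ 0 → a l ≤ a i) ∧
    (∀ l, l ≠ i → D.x (realVec g) l ≠ 0 → a l ≤ a j) ∧
    ∃ p r z : Fin s → ℤ, (∃ u v, p u * r v - p v * r u ≠ 0) ∧
    (∀ u v, |((p u * r v - p v * r u : ℤ) : ℝ)| ≤ C * (a i * a j) / Z ^ 2) ∧
    (∀ u, |α.1 * p u + α.2 * r u - z u| ≤ C / (P * Z)) ∧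
    (∀ β : ℝ × ℝ, (∀ u, β.1 * p u + β.2 * r u = z u) →
      ∀ l, D.x (realVec g) l ≠ 0 → D.L β l * D.x (realVec g) l = D.y (realVec n) l) := by
  classical
  obtain ⟨C₁, hC₁, hθ⟩ := D.exists_theta_bound
  obtain ⟨C₂, hC₂, hw⟩ := D.exists_support_witness
  set K : ℝ := ∑ l, ∑ m, ‖D.ρ l * D.σ m - D.ρ m * D.σ l‖ with hK
  have hK0 : 0 ≤ K := by positivity
  set C := 1 + s ^ 2 * (C₁ * C₁ * (C₂ * C₂ * K)) + s * (C₁ * C₂) with hC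
  have hA0 : 0 ≤ (s : ℝ) ^ 2 * (C₁ * C₁ * (C₂ * C₂ * K)) := by positivity
  have hB0 : 0 ≤ s * (C₁ * C₂) := by positivity
  refine ⟨C, by linarith, fun P Z α a g n hP hZ hR => ?_⟩
  set S : Finset (Fin s) := univ.filter fun l => D.x (realVec g) l ≠ 0 with hS
  have hmS : ∀ l, l ∈ S ↔ D.x (realVec g) l ≠ 0 := fun l => by simp [hS]
  obtain ⟨l₀, m₀, hlm, hl₀, hm₀⟩ := hR.two
  obtain ⟨i, hiS, hi⟩ := Finset.exists_max_image S a ⟨l₀, (hmS _).mpr hl₀⟩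
  have hne : (S.erase i).Nonempty := by
    by_cases h : l₀ = i
    · exact ⟨m₀, Finset.mem_erase.mpr ⟨fun e => hlm (h.trans e.symm), (hmS _).mpr hm₀⟩⟩
    · exact ⟨l₀, Finset.mem_erase.mpr ⟨h, (hmS _).mpr hl₀⟩⟩
  obtain ⟨j, hjS, hj⟩ := Finset.exists_max_image (S.erase i) a hne
  obtain ⟨hji, hjS⟩ := Finset.mem_erase.mp hjS
  obtain ⟨k, hk0, hkC⟩ := hw g
  set p : Fin s → ℤ := fun u => D.twist u k (B₁ *ᵥ g) with hp
  set r : Fin s → ℤ := fun u => D.twist u k (B₂ *ᵥ g) with hr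
  set z : Fin s → ℤ := fun u => D.twist u k n with hz
  have hpc : ∀ u, (p u : ℂ) = ∑ l, D.θ l ^ (u : ℕ) *
      (D.x (realVec k) l * (D.ρ l * D.x (realVec g) l)) := fun u => by
    simp only [hp, twist_eq, y_B₁]
  have hrc : ∀ u, (r u : ℂ) = ∑ l, D.θ l ^ (u : ℕ) *
      (D.x (realVec k) l * (D.σ l * D.x (realVec g) l)) := fun u => by
    simp only [hr, twist_eq, y_B₂]
  have hzc : ∀ u, (z u : ℂ) = ∑ l, D.θ l ^ (u : ℕ) *
      (D.x (realVec k) l * D.y (realVec n) l) := fun u => by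
    simp only [hz, twist_eq]
  set c : Fin s → Fin s → ℂ := fun l m =>
    D.x (realVec k) l * D.x (realVec k) m * (D.x (realVec g) l * D.x (realVec g) m) *
      (D.ρ l * D.σ m - D.ρ m * D.σ l) with hc
  have hminor : ∀ u v, ((p u * r v - p v * r u : ℤ) : ℂ) =
      ∑ l, ∑ m, D.θ l ^ (u : ℕ) * D.θ m ^ (v : ℕ) * c l m := by
    intro u v
    push_cast
    rw [mul_comm (p v : ℂ), hpc, hrc, hpc, hrc, Finset.sum_mul_sum, Finset.sum_mul_sum,
      ← Finset.sum_sub_distrib]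
    refine Finset.sum_congr rfl fun l _ => ?_
    rw [← Finset.sum_sub_distrib]
    refine Finset.sum_congr rfl fun m _ => ?_
    simp only [hc]
    ring
  have hlin : ∀ (β : ℝ × ℝ) u, ((β.1 * p u + β.2 * r u - z u : ℝ) : ℂ) =
      ∑ l, D.θ l ^ (u : ℕ) * (D.x (realVec k) l *
        (D.L β l * D.x (realVec g) l - D.y (realVec n) l)) := by
    intro β u
    push_cast
    rw [hpc, hrc, hzc, Finset.mul_sum, Finset.mul_sum, ← Finset.sum_add_distrib,
      ← Finset.sum_sub_distrib]
    refine Finset.sum_congr rfl fun l _ => ?_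
    simp only [L]
    ring
  refine ⟨i, j, hji.symm, (hmS i).mp hiS, (hmS j).mp hjS, fun l hl => hi l ((hmS l).mpr hl),
    fun l hli hl => hj l (Finset.mem_erase.mpr ⟨hli, (hmS l).mpr hl⟩), p, r, z, ?_, ?_, ?_, ?_⟩
  · by_contra! hall
    have := D.eq_zero_of_double_vandermonde (c := c)
      (fun u v => by rw [← hminor, hall u v, Int.cast_zero]) i j
    simp only [hc, mul_eq_zero] at this
    rcases this with (((h | h) | (h | h)) | h)
    · exact (hmS i).mp hiS ((hk0 i).mp h)
    · exact (hmS j).mp hjS ((hk0 j).mp h)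
    · exact (hmS i).mp hiS h
    · exact (hmS j).mp hjS h
    · exact D.indep i j hji.symm h
  · intro u v
    rw [← Complex.norm_intCast, hminor]
    have hcb : ∀ l m, ‖c l m‖ ≤ C₂ * C₂ * K * (a i * a j / Z ^ 2) := by
      intro l m
      have hrhs : 0 ≤ C₂ * C₂ * K * (a i * a j / Z ^ 2) := by
        have := hR.pos i
        have := hR.pos j
        positivity
      by_cases hlm : l = m
      · simp only [hc, hlm, sub_self, mul_zero, norm_zero]; exact hrhs
      by_cases hl : D.x (realVec g) l = 0
      · simp only [hc, hl, zero_mul, mul_zero, norm_zero]; exact hrhs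
      by_cases hm : D.x (realVec g) m = 0
      · simp only [hc, hm, zero_mul, mul_zero, norm_zero]; exact hrhs
      have haa : a l * a m ≤ a i * a j := by
        by_cases hmi : m = i
        · have hli : l ≠ i := fun h => hlm (h.trans hmi.symm)
          rw [hmi, mul_comm]
          exact mul_le_mul_of_nonneg_left (hj l (Finset.mem_erase.mpr ⟨hli, (hmS l).mpr hl⟩))
            (hR.pos i).le
        · exact mul_le_mul (hi l ((hmS l).mpr hl))
            (hj m (Finset.mem_erase.mpr ⟨hmi, (hmS m).mpr hm⟩)) (hR.pos m).le (hR.pos i).le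
      have hxx : ‖D.x (realVec g) l‖ * ‖D.x (realVec g) m‖ ≤ a i * a j / Z ^ 2 := by
        calc _ ≤ a l / Z * (a m / Z) := mul_le_mul (hR.small l) (hR.small m) (norm_nonneg _)
              (div_nonneg (hR.pos l).le hZ.le)
          _ = a l * a m / Z ^ 2 := by field_simp
          _ ≤ _ := by gcongr
      have hKK : ‖D.ρ l * D.σ m - D.ρ m * D.σ l‖ ≤ K :=
        (Finset.single_le_sum (f := fun m => ‖D.ρ l * D.σ m - D.ρ m * D.σ l‖)
          (fun m _ => norm_nonneg _) (Finset.mem_univ m)).trans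
        (Finset.single_le_sum (f := fun l => ∑ m, ‖D.ρ l * D.σ m - D.ρ m * D.σ l‖)
          (fun l _ => Finset.sum_nonneg fun m _ => norm_nonneg _) (Finset.mem_univ l))
      simp only [hc, norm_mul]
      calc _ ≤ C₂ * C₂ * (a i * a j / Z ^ 2) * K := by
            have := hkC l
            have := hkC m
            have := hR.pos i
            have := hR.pos j
            gcongr
        _ = _ := by ring
    calc _ ≤ ∑ l : Fin s, ∑ m : Fin s, C₁ * C₁ * (C₂ * C₂ * K * (a i * a j / Z ^ 2)) := by
          refine (norm_sum_le _ _).trans (Finset.sum_le_sum fun l _ =>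
            (norm_sum_le _ _).trans (Finset.sum_le_sum fun m _ => ?_))
          rw [norm_mul, norm_mul]
          have h1 := hθ u l
          have h2 := hθ v m
          have h3 := hcb l m
          have := hR.pos i
          have := hR.pos j
          gcongr
      _ = s ^ 2 * (C₁ * C₁ * (C₂ * C₂ * K)) * (a i * a j / Z ^ 2) := by
          simp only [Finset.sum_const, Finset.card_univ, Fintype.card_fin, nsmul_eq_mul]
          ring
      _ ≤ C * (a i * a j / Z ^ 2) := by
          have := hR.pos i
          have := hR.pos j
          gcongr
          linarith
      _ = _ := by ring
  · intro u
    rw [← Real.norm_eq_abs, ← Complex.norm_real, hlin]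
    calc _ ≤ ∑ l : Fin s, C₁ * (C₂ * (1 / (P * Z))) := by
          refine (norm_sum_le _ _).trans (Finset.sum_le_sum fun l _ => ?_)
          rw [norm_mul, norm_mul]
          have hal := hR.pos l
          by_cases hl : D.x (realVec g) l = 0
          · rw [(hk0 l).mpr hl, norm_zero, zero_mul, mul_zero]
            positivity
          · have h1 := hθ u l
            have h2 := hkC l
            have h3 : ‖D.L α l * D.x (realVec g) l - D.y (realVec n) l‖ ≤ 1 / (P * Z) := by
              refine (hR.approx l hl).trans ?_
              rw [div_le_div_iff₀ (by positivity) (by positivity)]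
              have := (le_div_iff₀ hZ).mp (hR.small l)
              nlinarith
            gcongr
      _ = s * (C₁ * C₂) / (P * Z) := by
          simp only [Finset.sum_const, Finset.card_univ, Fintype.card_fin, nsmul_eq_mul]
          ring
      _ ≤ _ := by
          gcongr
          linarith
  · intro β hβ l hl
    have hv := D.eq_zero_of_vandermonde (v := fun l => D.x (realVec k) l *
        (D.L β l * D.x (realVec g) l - D.y (realVec n) l)) fun u => by
      rw [← hlin, hβ u, sub_self, Complex.ofReal_zero]
    have h := congrFun hv l
    simp only [Pi.zero_apply, mul_eq_zero] at h
    rcases h with h | h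
    · exact absurd ((hk0 l).mp h) hl
    · exact sub_eq_zero.mp h

end Pencil

namespace Pencil

variable {s : ℕ} {B₁ B₂ : Matrix (Fin s) (Fin s) ℤ} (D : Pencil s B₁ B₂)

/-- Exactness: a strong resonance forces `α` to lie close to a rational point of small height. -/
theorem exists_exact_rational : ∃ C : ℝ, 1 ≤ C ∧ ∀ (P Z : ℝ) (α : ℝ × ℝ) a g n, 0 < P → 0 < Z →
    C * P ≤ Z ^ 3 → D.Resonance P Z α a g n → ∃ (q : ℕ) (b₁ b₂ : ℤ), 1 ≤ q ∧
      (q : ℝ) ≤ C * (P / Z) ^ 2 ∧ Int.gcd (Int.gcd b₁ b₂) q = 1 ∧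
      ‖α - ((b₁ : ℝ) / q, (b₂ : ℝ) / q)‖ ≤ C / (q * Z ^ 2) := by
  obtain ⟨C₁, hC₁, hmin⟩ := D.exists_resonance_minors
  obtain ⟨C₂, hC₂, hind⟩ := D.exists_indep_bound
  refine ⟨1 + 3 * C₁ ^ 2 + C₁ + 2 * C₂ * C₁,
    by nlinarith [mul_nonneg (zero_le_one.trans hC₂) (zero_le_one.trans hC₁)],
    fun P Z α a g n hP hZ hPZ hR => ?_⟩
  obtain ⟨i, j, hij, hgi, hgj, hi, hj, p, r, z, ⟨u, v, hD⟩, hD2, hε, hexact⟩ :=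
    hmin P Z α a g n hP hZ hR
  have hai := hR.pos i
  have haj := hR.pos j
  have hCC : 0 ≤ C₂ * C₁ := by positivity
  have haa : a i * a j ≤ P ^ 2 := by
    rw [sq]; exact mul_le_mul (hR.le i) (hR.le j) haj.le hP.le
  have h3 : ∀ w, z w * (p u * r v - p v * r u) =
      p w * (z u * r v - z v * r u) + r w * (p u * z v - p v * z u) := by
    intro w
    set E : ℤ := z w * (p u * r v - p v * r u) -
      (p w * (z u * r v - z v * r u) + r w * (p u * z v - p v * z u)) with hE
    have hEε : (E : ℝ) = -((α.1 * p w + α.2 * r w - z w) * ((p u * r v - p v * r u : ℤ) : ℝ)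
        - (α.1 * p u + α.2 * r u - z u) * ((p w * r v - p v * r w : ℤ) : ℝ)
        + (α.1 * p v + α.2 * r v - z v) * ((p w * r u - p u * r w : ℤ) : ℝ)) := by
      rw [hE]; push_cast; ring
    have hb : ∀ t u' v', |(α.1 * p t + α.2 * r t - z t) * ((p u' * r v' - p v' * r u' : ℤ) : ℝ)| ≤
        C₁ ^ 2 * P / Z ^ 3 := by
      intro t u' v'
      rw [abs_mul]
      calc _ ≤ C₁ / (P * Z) * (C₁ * (P ^ 2) / Z ^ 2) := by
            refine mul_le_mul (hε t) ((hD2 u' v').trans ?_) (abs_nonneg _) (by positivity)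
            gcongr
        _ = _ := by field_simp
    have hlt : |(E : ℝ)| < 1 := by
      have hsum : |(E : ℝ)| ≤ 3 * (C₁ ^ 2 * P / Z ^ 3) := by
        rw [hEε, abs_neg]
        have b1 := hb w u v
        have b2 := hb u w v
        have b3 := hb v w u
        rw [abs_le] at *
        constructor <;> linarith [b1.1, b1.2, b2.1, b2.2, b3.1, b3.2]
      refine hsum.trans_lt ?_
      rw [← mul_div_assoc, div_lt_one (by positivity)]
      nlinarith
    have hE0 : E = 0 := by
      have : |E| < 1 := by exact_mod_cast hlt
      exact Int.abs_lt_one_iff.mp this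
    linarith [hE0, hE]
  set d : ℤ := p u * r v - p v * r u with hd
  have hdR : (d : ℝ) ≠ 0 := by exact_mod_cast hD
  have hd0 : 0 < |(d : ℝ)| := abs_pos.mpr hdR
  set a₁ : ℤ := z u * r v - z v * r u with ha₁
  set a₂ : ℤ := p u * z v - p v * z u with ha₂
  set β : ℝ × ℝ := ((a₁ : ℝ) / d, (a₂ : ℝ) / d) with hβ
  have hLβ := hexact β fun w => by
    have h := h3 w
    have h' : (z w : ℝ) * d = p w * a₁ + r w * a₂ := by exact_mod_cast h
    simp only [hβ]
    field_simp
    linear_combination -h'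
  have hLsmall : ∀ l, D.x (realVec g) l ≠ 0 → ‖D.L (α - β) l‖ ≤ 1 / (P * a l) := by
    intro l hl
    have h := hR.approx l hl
    rw [← hLβ l hl, ← sub_mul, ← L_sub, norm_mul] at h
    have hx := norm_pos_iff.mpr hl
    rw [mul_comm, div_eq_mul_one_div] at h
    exact le_of_mul_le_mul_left h hx
  have hclose : ‖α - β‖ ≤ 2 * C₂ / (P * a j) := by
    have := hind i j hij (α - β)
    have h1 := hLsmall i hgi
    have h2 := hLsmall j hgj
    have h4 : 1 / (P * a i) ≤ 1 / (P * a j) := by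
      have := hi j hgj
      gcongr
    calc _ ≤ C₂ * (1 / (P * a j) + 1 / (P * a j)) := this.trans (by gcongr; exact h1.trans h4)
      _ = _ := by ring
  obtain ⟨q, b₁, b₂, hq, hqd, hcop, e₁, e₂⟩ := exists_lowest_terms d a₁ a₂ hD
  have hq0 : (0 : ℝ) < q := by exact_mod_cast hq
  have hqa : (q : ℝ) ≤ C₁ * (a i * a j) / Z ^ 2 := hqd.trans (hD2 u v)
  refine ⟨q, b₁, b₂, hq, ?_, hcop, ?_⟩
  · calc (q : ℝ) ≤ C₁ * P ^ 2 / Z ^ 2 := hqa.trans (by gcongr)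
      _ = C₁ * (P / Z) ^ 2 := by ring
      _ ≤ _ := by gcongr; nlinarith
  · rw [e₁, e₂]
    refine hclose.trans ?_
    rw [div_le_div_iff₀ (by positivity) (by positivity)]
    have : q * Z ^ 2 ≤ C₁ * (a i * a j) := by rwa [le_div_iff₀ (by positivity)] at hqa
    calc 2 * C₂ * (q * Z ^ 2) ≤ 2 * C₂ * (C₁ * (a i * a j)) := by gcongr
      _ = 2 * C₂ * C₁ * (a i * a j) := by ring
      _ ≤ (1 + 3 * C₁ ^ 2 + C₁ + 2 * C₂ * C₁) * (P * a j) := by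
          gcongr
          · nlinarith
          · exact hR.le i

/-- A resonance at a rational point with denominator `q` bounds `q`. -/
theorem exists_rational_bound : ∃ C : ℝ, 1 ≤ C ∧ ∀ (P Z : ℝ) (q : ℕ) (b₁ b₂ : ℤ) a g n,
    0 < P → 0 < Z → 1 ≤ q → Int.gcd (Int.gcd b₁ b₂) q = 1 → C * q ≤ P * Z →
    D.Resonance P Z ((b₁ : ℝ) / q, (b₂ : ℝ) / q) a g n → (q : ℝ) ≤ C * (P / Z) ^ 2 := by
  obtain ⟨C₁, hC₁, hmin⟩ := D.exists_resonance_minors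
  refine ⟨2 * C₁, by linarith, fun P Z q b₁ b₂ a g n hP hZ hq hcop hqP hR => ?_⟩
  obtain ⟨i, j, hij, hgi, hgj, hi, hj, p, r, z, ⟨u, v, hD⟩, hD2, hε, -⟩ :=
    hmin P Z _ a g n hP hZ hR
  have hai := hR.pos i
  have haj := hR.pos j
  have hq0 : (0 : ℝ) < q := by exact_mod_cast hq
  have haa : a i * a j ≤ P ^ 2 := by
    rw [sq]; exact mul_le_mul (hR.le i) (hR.le j) haj.le hP.le
  have hex : ∀ w, b₁ * p w + b₂ * r w = q * z w := by
    intro w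
    have h := hε w
    have hlt : |((b₁ * p w + b₂ * r w - q * z w : ℤ) : ℝ)| < 1 := by
      have e : ((b₁ * p w + b₂ * r w - q * z w : ℤ) : ℝ) =
          q * ((b₁ : ℝ) / q * p w + (b₂ : ℝ) / q * r w - z w) := by
        push_cast; field_simp
      rw [e, abs_mul, abs_of_pos hq0]
      calc _ ≤ q * (C₁ / (P * Z)) := by gcongr
        _ = q * C₁ / (P * Z) := by ring
        _ < 1 := by rw [div_lt_one (by positivity)]; nlinarith
    have : |b₁ * p w + b₂ * r w - q * z w| < 1 := by exact_mod_cast hlt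
    linarith [Int.abs_lt_one_iff.mp this]
  set d : ℤ := p u * r v - p v * r u with hd
  have h1 : (q : ℤ) ∣ b₁ * d := ⟨z u * r v - z v * r u, by
    rw [hd]; linear_combination r v * hex u - r u * hex v⟩
  have h2 : (q : ℤ) ∣ b₂ * d := ⟨p u * z v - p v * z u, by
    rw [hd]; linear_combination p u * hex v - p v * hex u⟩
  have h3 : (q : ℤ) ∣ (Int.gcd b₁ b₂ : ℤ) * d := by
    rw [Int.gcd_eq_gcd_ab b₁ b₂, add_mul]
    refine dvd_add ?_ ?_
    · rw [mul_right_comm]; exact h1.mul_right _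
    · rw [mul_right_comm]; exact h2.mul_right _
  have hqd : (q : ℤ) ∣ d := by
    refine IsCoprime.dvd_of_dvd_mul_left ?_ h3
    rw [Int.isCoprime_iff_gcd_eq_one, Int.gcd_comm]
    exact hcop
  have hle : (q : ℝ) ≤ |(d : ℝ)| := by
    have := Int.le_of_dvd (abs_pos.mpr hD) ((dvd_abs _ _).mpr hqd)
    exact_mod_cast this
  calc (q : ℝ) ≤ C₁ * P ^ 2 / Z ^ 2 := (hle.trans (hD2 u v)).trans (by gcongr)
    _ = C₁ * (P / Z) ^ 2 := by ring
    _ ≤ _ := by gcongr; linarith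

end Pencil

/-- A set whose differences, once small in the coordinates `Φ`, are automatically very small
there, has small measure. -/
lemma exists_volume_le_of_cells (Φ : (ℝ × ℝ) →ₗ[ℝ] (ℝ × ℝ)) (hΦ : LinearMap.det Φ ≠ 0) :
    ∃ C : ℝ, 1 ≤ C ∧ ∀ (E : Set (ℝ × ℝ)) (r₁ r₂ b₁ b₂ : ℝ), 0 < r₁ → r₁ ≤ 1 → 0 < r₂ → r₂ ≤ 1 →
      0 ≤ b₁ → 0 ≤ b₂ → (∀ α ∈ E, ‖α‖ ≤ 2) →
      (∀ α ∈ E, ∀ α' ∈ E, |(Φ (α - α')).1| ≤ r₁ → |(Φ (α - α')).2| ≤ r₂ →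
        |(Φ (α - α')).1| ≤ b₁ ∧ |(Φ (α - α')).2| ≤ b₂) →
      volume E ≤ ENNReal.ofReal (C * (b₁ * b₂ / (r₁ * r₂))) := by
  set K : ℝ := 1 + 2 * ‖LinearMap.toContinuousLinearMap Φ‖ with hK
  have hK1 : 1 ≤ K := by rw [hK]; linarith [norm_nonneg (LinearMap.toContinuousLinearMap Φ)]
  have hΦb : ∀ α : ℝ × ℝ, ‖α‖ ≤ 2 → ‖Φ α‖ ≤ K := fun α hα => by
    have h := (LinearMap.toContinuousLinearMap Φ).le_opNorm α
    simp only [LinearMap.coe_toContinuousLinearMap'] at h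
    have := norm_nonneg (LinearMap.toContinuousLinearMap Φ)
    nlinarith
  set d : ℝ := |(LinearMap.det Φ)⁻¹| with hd
  have hd0 : 0 ≤ d := abs_nonneg _
  refine ⟨1 + (6 * K) * (6 * K) * (4 * d), by
    have : 0 ≤ (6 * K) * (6 * K) * (4 * d) := by positivity
    linarith, fun E r₁ r₂ b₁ b₂ hr₁ hr₁' hr₂ hr₂' hb₁ hb₂ hE hcell => ?_⟩
  set I : ℝ → Finset ℤ := fun r => Finset.Icc ⌊-K / r⌋ ⌊K / r⌋ with hI
  set cell : ℤ × ℤ → Set (ℝ × ℝ) := fun m =>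
    {α ∈ E | ⌊(Φ α).1 / r₁⌋ = m.1 ∧ ⌊(Φ α).2 / r₂⌋ = m.2} with hcelldef
  have hcard : ∀ r, 0 < r → r ≤ 1 → ((I r).card : ℝ) ≤ 6 * K / r := by
    intro r hr hr1
    have hKr : 1 ≤ K / r := by rw [le_div_iff₀ hr]; linarith
    have h1 : ⌊-K / r⌋ ≤ ⌊K / r⌋ + 1 := by
      have : ⌊-K / r⌋ ≤ ⌊K / r⌋ := Int.floor_le_floor (by gcongr; linarith)
      linarith
    have h2 : ((I r).card : ℤ) = ⌊K / r⌋ + 1 - ⌊-K / r⌋ := by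
      simp only [hI]
      rw [Int.card_Icc, Int.toNat_of_nonneg (by linarith)]
    have h3 : ((I r).card : ℝ) = ⌊K / r⌋ + 1 - ⌊-K / r⌋ := by exact_mod_cast h2
    have h4 := Int.floor_le (K / r)
    have h5 := (Int.sub_one_lt_floor (-K / r)).le
    rw [neg_div] at h5
    rw [h3, neg_div, mul_div_assoc]
    linarith
  have hmem : ∀ r, 0 < r → ∀ y : ℝ, |y| ≤ K → ⌊y / r⌋ ∈ I r := fun r hr y hy => by
    rw [abs_le] at hy
    simp only [hI, Finset.mem_Icc]
    exact ⟨Int.floor_le_floor (by gcongr; exact hy.1), Int.floor_le_floor (by gcongr; exact hy.2)⟩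
  have hsub : E ⊆ ⋃ m ∈ I r₁ ×ˢ I r₂, cell m := fun α hα => by
    have h := hΦb α (hE α hα)
    simp only [Set.mem_iUnion]
    refine ⟨(⌊(Φ α).1 / r₁⌋, ⌊(Φ α).2 / r₂⌋), Finset.mem_product.mpr
      ⟨hmem r₁ hr₁ _ ((norm_fst_le (Φ α)).trans h), hmem r₂ hr₂ _ ((norm_snd_le (Φ α)).trans h)⟩,
      hα, rfl, rfl⟩
  have hfl : ∀ r, 0 < r → ∀ y y' : ℝ, ∀ m : ℤ, ⌊y / r⌋ = m → ⌊y' / r⌋ = m → |y - y'| ≤ r := by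
    intro r hr y y' m h h'
    have := Int.abs_sub_lt_one_of_floor_eq_floor (h.trans h'.symm)
    rw [← sub_div, abs_div, abs_of_pos hr, div_lt_one hr] at this
    exact this.le
  have hvol : ∀ m, volume (cell m) ≤ ENNReal.ofReal (d * (4 * (b₁ * b₂))) := by
    intro m
    rcases (cell m).eq_empty_or_nonempty with h | ⟨α₀, hα₀⟩
    · rw [h, measure_empty]; exact zero_le
    have hsub' : cell m ⊆ Φ ⁻¹' (Set.Icc ((Φ α₀).1 - b₁) ((Φ α₀).1 + b₁) ×ˢ
        Set.Icc ((Φ α₀).2 - b₂) ((Φ α₀).2 + b₂)) := by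
      intro α hα
      have h1 := hfl r₁ hr₁ (Φ α).1 (Φ α₀).1 m.1 hα.2.1 hα₀.2.1
      have h2 := hfl r₂ hr₂ (Φ α).2 (Φ α₀).2 m.2 hα.2.2 hα₀.2.2
      have := hcell α hα.1 α₀ hα₀.1 (by rwa [map_sub]) (by rwa [map_sub])
      rw [map_sub, Prod.fst_sub, Prod.snd_sub, abs_le, abs_le] at this
      refine ⟨⟨?_, ?_⟩, ⟨?_, ?_⟩⟩ <;> linarith [this.1.1, this.1.2, this.2.1, this.2.2]
    refine (measure_mono hsub').trans ?_
    rw [Measure.addHaar_preimage_linearMap _ hΦ, Measure.volume_eq_prod, Measure.prod_prod,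
      Real.volume_Icc, Real.volume_Icc, ← hd, ← ENNReal.ofReal_mul (by linarith),
      ← ENNReal.ofReal_mul hd0]
    apply ENNReal.ofReal_le_ofReal
    apply le_of_eq
    ring
  calc volume E ≤ ∑ m ∈ I r₁ ×ˢ I r₂, volume (cell m) :=
        (measure_mono hsub).trans (measure_biUnion_finset_le _ _)
    _ ≤ ∑ m ∈ I r₁ ×ˢ I r₂, ENNReal.ofReal (d * (4 * (b₁ * b₂))) :=
        Finset.sum_le_sum fun m _ => hvol m
    _ = ENNReal.ofReal (((I r₁).card * (I r₂).card : ℝ) * (d * (4 * (b₁ * b₂)))) := by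
        rw [Finset.sum_const, Finset.card_product, nsmul_eq_mul,
          ← Nat.cast_mul, ENNReal.ofReal_mul (Nat.cast_nonneg _), ENNReal.ofReal_natCast]
    _ ≤ _ := by
        apply ENNReal.ofReal_le_ofReal
        calc _ ≤ (6 * K / r₁) * (6 * K / r₂) * (d * (4 * (b₁ * b₂))) := by
              gcongr
              · exact hcard r₁ hr₁ hr₁'
              · exact hcard r₂ hr₂ hr₂'
          _ = (6 * K) * (6 * K) * (4 * d) * (b₁ * b₂ / (r₁ * r₂)) := by field_simp
          _ ≤ _ := by gcongr; linarith

namespace Pencil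

variable {s : ℕ} {B₁ B₂ : Matrix (Fin s) (Fin s) ℤ} (D : Pencil s B₁ B₂)

/-- The points of a bounded region having a resonance of prescribed type. -/
def resonanceClass (P Z : ℝ) (S : Finset (Fin s)) (i j : Fin s) (A A' : ℝ) : Set (ℝ × ℝ) :=
  {α | ‖α‖ ≤ 2 ∧ ∃ a g n, D.Resonance P Z α a g n ∧ (∀ l, D.x (realVec g) l ≠ 0 ↔ l ∈ S) ∧
    (∀ l ∈ S, a l ≤ a i) ∧ (∀ l ∈ S, l ≠ i → a l ≤ a j) ∧
    A / 2 ≤ a i ∧ a i ≤ A ∧ A' / 2 ≤ a j ∧ a j ≤ A'}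

lemma exists_class_gap : ∃ c C : ℝ, 0 < c ∧ c ≤ 1 ∧ 1 ≤ C ∧ ∀ (P Z A A' : ℝ) S i j α α', 0 < P →
    0 < A → 0 < A' → i ∈ S → j ∈ S → C ≤ Z → α ∈ D.resonanceClass P Z S i j A A' →
    α' ∈ D.resonanceClass P Z S i j A A' → ‖D.L (α - α') i‖ ≤ c * (Z / A) ^ 2 →
    (∀ l ∈ S, l ≠ i → ‖D.L (α - α') l‖ ≤ c * (Z / A') ^ 2) →
    ‖D.L (α - α') i‖ ≤ 4 / (P * A) ∧ ‖D.L (α - α') j‖ ≤ 4 / (P * A') := by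
  obtain ⟨c₀, hc₀, hgap⟩ := D.exists_gap
  refine ⟨min 1 (c₀ / 2), 1 + 8 / c₀, by positivity, min_le_left _ _, by
    have : 0 < 8 / c₀ := by positivity
    linarith, ?_⟩
  rintro P Z A A' S i j α α' hP hA hA' hiS hjS hZ ⟨-, a, g, n, hR, hS, hi, hj, h1, h2, h3, h4⟩
    ⟨-, a', g', n', hR', hS', hi', hj', h1', h2', h3', h4'⟩ hLi hLl
  have h8 : 0 < 8 / c₀ := by positivity
  have hZ0 : 0 < Z := by linarith
  have hid : ∀ l, D.x (realVec g') l * D.y (realVec n) l - D.x (realVec g) l * D.y (realVec n') l =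
      D.x (realVec g) l * D.x (realVec g') l * D.L (α - α') l -
      (D.x (realVec g') l * (D.L α l * D.x (realVec g) l - D.y (realVec n) l) -
        D.x (realVec g) l * (D.L α' l * D.x (realVec g') l - D.y (realVec n') l)) := fun l => by
    rw [L_sub]; ring
  have hsmall : ∀ l, ‖D.x (realVec g') l * D.y (realVec n) l -
      D.x (realVec g) l * D.y (realVec n') l‖ < c₀ := by
    intro l
    by_cases hl : l ∈ S
    · have hxl := (hS l).mpr hl
      have hxl' := (hS' l).mpr hl
      have ha := hR.pos l
      have ha' := hR'.pos l
      have e1 : ‖D.x (realVec g') l * (D.L α l * D.x (realVec g) l - D.y (realVec n) l)‖ ≤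
          1 / Z ^ 2 := by
        rw [norm_mul]
        calc _ ≤ a' l / Z * (a l / Z / (P * a l)) := by
              have := hR'.small l
              have := hR.small l
              have := hR.approx l hxl
              gcongr
              refine this.trans ?_
              gcongr
          _ = a' l / P / Z ^ 2 := by field_simp
          _ ≤ _ := by
              have := (div_le_one hP).mpr (hR'.le l)
              gcongr
      have e2 : ‖D.x (realVec g) l * (D.L α' l * D.x (realVec g') l - D.y (realVec n') l)‖ ≤
          1 / Z ^ 2 := by
        rw [norm_mul]
        calc _ ≤ a l / Z * (a' l / Z / (P * a' l)) := by
              have := hR'.small l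
              have := hR.small l
              have := hR'.approx l hxl'
              gcongr
              refine this.trans ?_
              gcongr
          _ = a l / P / Z ^ 2 := by field_simp
          _ ≤ _ := by
              have := (div_le_one hP).mpr (hR.le l)
              gcongr
      have e3 : ‖D.x (realVec g) l * D.x (realVec g') l * D.L (α - α') l‖ ≤ c₀ / 2 := by
        obtain ⟨T, hT, hT1, hT2, hT3⟩ : ∃ T : ℝ, 0 < T ∧ a l ≤ T ∧ a' l ≤ T ∧
            ‖D.L (α - α') l‖ ≤ c₀ / 2 * (Z / T) ^ 2 := by
          by_cases hli : l = i
          · refine ⟨A, hA, by rw [hli]; exact h2, by rw [hli]; exact h2', ?_⟩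
            rw [hli]
            refine hLi.trans ?_
            gcongr
            exact min_le_right _ _
          · refine ⟨A', hA', (hj l hl hli).trans h4, (hj' l hl hli).trans h4',
              (hLl l hl hli).trans ?_⟩
            gcongr
            exact min_le_right _ _
        rw [norm_mul, norm_mul]
        calc _ ≤ T / Z * (T / Z) * (c₀ / 2 * (Z / T) ^ 2) := by
              have := (hR.small l).trans (div_le_div_of_nonneg_right hT1 hZ0.le)
              have := (hR'.small l).trans (div_le_div_of_nonneg_right hT2 hZ0.le)
              gcongr
          _ = c₀ / 2 := by field_simp
      rw [hid]
      have hZ2 : 1 / Z ^ 2 < c₀ / 4 := by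
        have : 8 / c₀ < Z ^ 2 := by nlinarith
        rw [div_lt_iff₀ hc₀] at this
        rw [div_lt_iff₀ (by positivity)]
        linarith
      have := norm_sub_le (D.x (realVec g) l * D.x (realVec g') l * D.L (α - α') l)
        (D.x (realVec g') l * (D.L α l * D.x (realVec g) l - D.y (realVec n) l) -
        D.x (realVec g) l * (D.L α' l * D.x (realVec g') l - D.y (realVec n') l))
      have := norm_sub_le
        (D.x (realVec g') l * (D.L α l * D.x (realVec g) l - D.y (realVec n) l))
        (D.x (realVec g) l * (D.L α' l * D.x (realVec g') l - D.y (realVec n') l))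
      linarith
    · have hxl : D.x (realVec g) l = 0 := by
        by_contra h; exact hl ((hS l).mp h)
      have hxl' : D.x (realVec g') l = 0 := by
        by_contra h; exact hl ((hS' l).mp h)
      rw [hxl, hxl', zero_mul, zero_mul, sub_zero, norm_zero]
      exact hc₀
  have hz := hgap g n g' n' hsmall
  have hfin : ∀ l ∈ S, ‖D.L (α - α') l‖ ≤ 1 / (P * a l) + 1 / (P * a' l) := by
    intro l hl
    have hxl := norm_pos_iff.mpr ((hS l).mpr hl)
    have hxl' := norm_pos_iff.mpr ((hS' l).mpr hl)
    have h := hid l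
    rw [hz l, sub_self] at h
    have h5 := congrArg norm (sub_eq_zero.mp h.symm)
    rw [norm_mul, norm_mul] at h5
    have h6 := norm_sub_le
        (D.x (realVec g') l * (D.L α l * D.x (realVec g) l - D.y (realVec n) l))
        (D.x (realVec g) l * (D.L α' l * D.x (realVec g') l - D.y (realVec n') l))
    rw [← h5, norm_mul, norm_mul] at h6
    have h7 := hR.approx l ((hS l).mpr hl)
    have h8 := hR'.approx l ((hS' l).mpr hl)
    have ha := hR.pos l
    have ha' := hR'.pos l
    have h9 : ‖D.x (realVec g) l‖ * ‖D.x (realVec g') l‖ * ‖D.L (α - α') l‖ ≤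
        ‖D.x (realVec g) l‖ * ‖D.x (realVec g') l‖ * (1 / (P * a l) + 1 / (P * a' l)) := by
      calc _ ≤ _ := h6
        _ ≤ ‖D.x (realVec g') l‖ * (‖D.x (realVec g) l‖ / (P * a l)) +
            ‖D.x (realVec g) l‖ * (‖D.x (realVec g') l‖ / (P * a' l)) := by gcongr
        _ = _ := by ring
    exact le_of_mul_le_mul_left h9 (by positivity)
  have hdy : ∀ t T : ℝ, 0 < T → T / 2 ≤ t → 1 / (P * t) ≤ 2 / (P * T) := fun t T hT ht => by
    rw [div_le_div_iff₀ (by nlinarith [mul_pos hP hT]) (by positivity)]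
    nlinarith
  constructor
  · have := hfin i hiS
    have e1 := hdy _ A hA h1
    have e2 := hdy _ A hA h1'
    have : 4 / (P * A) = 2 / (P * A) + 2 / (P * A) := by ring
    linarith
  · have := hfin j hjS
    have e1 := hdy _ A' hA' h3
    have e2 := hdy _ A' hA' h3'
    have : 4 / (P * A') = 2 / (P * A') + 2 / (P * A') := by ring
    linarith

end Pencil

namespace Pencil

variable {s : ℕ} {B₁ B₂ : Matrix (Fin s) (Fin s) ℤ} (D : Pencil s B₁ B₂)

/-- Either `L_i` is nondegenerate on `ℝ²`, or it is a multiple of a real form, which can be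
completed to a coordinate system. -/
lemma exists_coords (i j : Fin s) (hij : i ≠ j) :
    (∃ C : ℝ, 1 ≤ C ∧ ∀ δ : ℝ × ℝ, ‖δ‖ ≤ C * ‖D.L δ i‖) ∨
    ∃ (Φ : (ℝ × ℝ) →ₗ[ℝ] (ℝ × ℝ)) (C : ℝ), LinearMap.det Φ ≠ 0 ∧ 1 ≤ C ∧
      (∀ δ, ‖D.L δ i‖ ≤ C * |(Φ δ).1|) ∧ (∀ δ, |(Φ δ).1| ≤ C * ‖D.L δ i‖) ∧
      (∀ δ, |(Φ δ).2| ≤ ‖δ‖) ∧ ∀ δ, ‖δ‖ ≤ C * (|(Φ δ).1| + |(Φ δ).2|) := by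
  set ρ := D.ρ i with hρ
  set σ := D.σ i with hσ
  have hne : ¬ (ρ = 0 ∧ σ = 0) := fun h => D.indep i j hij (by rw [← hρ, ← hσ, h.1, h.2]; ring)
  by_cases ht : ρ.re * σ.im - ρ.im * σ.re = 0
  · right
    have hdet : ∀ (Φ : (ℝ × ℝ) →ₗ[ℝ] (ℝ × ℝ)) (C : ℝ),
        (∀ δ, ‖δ‖ ≤ C * (|(Φ δ).1| + |(Φ δ).2|)) → LinearMap.det Φ ≠ 0 := by
      intro Φ C h h0
      obtain ⟨δ, hδ, hδ0⟩ :=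
        (Submodule.ne_bot_iff _).mp (LinearMap.bot_lt_ker_of_det_eq_zero h0).ne'
      have := h δ
      rw [LinearMap.mem_ker.mp hδ] at this
      simp only [Prod.fst_zero, Prod.snd_zero, abs_zero, add_zero, mul_zero] at this
      exact hδ0 (norm_le_zero_iff.mp this)
    by_cases hρ0 : ρ = 0
    · have hσ0 : 0 < ‖σ‖ := norm_pos_iff.mpr fun h => hne ⟨hρ0, h⟩
      set Φ : (ℝ × ℝ) →ₗ[ℝ] (ℝ × ℝ) :=
        LinearMap.prod (LinearMap.snd ℝ ℝ ℝ) (LinearMap.fst ℝ ℝ ℝ) with hΦ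
      have h1 : ∀ δ, (Φ δ).1 = δ.2 := fun δ => rfl
      have h2 : ∀ δ, (Φ δ).2 = δ.1 := fun δ => rfl
      have hL : ∀ δ, ‖D.L δ i‖ = |δ.2| * ‖σ‖ := fun δ => by
        rw [L, ← hρ, ← hσ, hρ0, mul_zero, zero_add, norm_mul, Complex.norm_real, Real.norm_eq_abs]
      have hinv : 0 < 1 / ‖σ‖ := by positivity
      have hb : ∀ δ : ℝ × ℝ, ‖δ‖ ≤ (1 + ‖σ‖ + 1 / ‖σ‖) * (|(Φ δ).1| + |(Φ δ).2|) := fun δ => by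
        rw [h1, h2, Prod.norm_def, Real.norm_eq_abs, Real.norm_eq_abs]
        have := abs_nonneg δ.1
        have := abs_nonneg δ.2
        calc max |δ.1| |δ.2| ≤ 1 * (|δ.2| + |δ.1|) := by
              rw [max_le_iff]; constructor <;> linarith
          _ ≤ _ := by gcongr; linarith
      refine ⟨Φ, _, hdet Φ _ hb, by linarith, fun δ => ?_, fun δ => ?_, fun δ => ?_, hb⟩
      · rw [hL, h1, mul_comm]
        gcongr
        linarith
      · rw [hL, h1]
        calc |δ.2| = 1 / ‖σ‖ * (|δ.2| * ‖σ‖) := by field_simp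
          _ ≤ _ := by gcongr; linarith
      · rw [h2]; exact norm_fst_le δ
    · have hρ1 : 0 < ‖ρ‖ := norm_pos_iff.mpr hρ0
      set e := ρ.re * σ.re + ρ.im * σ.im with he
      set Φ : (ℝ × ℝ) →ₗ[ℝ] (ℝ × ℝ) :=
        LinearMap.prod (‖ρ‖ ^ 2 • LinearMap.fst ℝ ℝ ℝ + e • LinearMap.snd ℝ ℝ ℝ)
          (LinearMap.snd ℝ ℝ ℝ) with hΦ
      have h1 : ∀ δ, (Φ δ).1 = ‖ρ‖ ^ 2 * δ.1 + e * δ.2 := fun δ => rfl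
      have h2 : ∀ δ, (Φ δ).2 = δ.2 := fun δ => rfl
      have hL : ∀ δ, |(Φ δ).1| = ‖ρ‖ * ‖D.L δ i‖ := fun δ => by
        have : ((Φ δ).1 : ℂ) = starRingEnd ℂ ρ * D.L δ i := by
          rw [h1, ← Complex.normSq_eq_norm_sq, Complex.normSq_apply]
          apply Complex.ext
          · simp [L, ← hρ, ← hσ, he]; ring
          · simp [L, ← hρ, ← hσ]; linear_combination -δ.2 * ht
        rw [← Real.norm_eq_abs, ← Complex.norm_real, this, norm_mul, Complex.norm_conj]
      set C := 1 + ‖ρ‖ + 1 / ‖ρ‖ + (1 + |e|) / ‖ρ‖ ^ 2 with hC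
      have p1 : 0 < 1 / ‖ρ‖ := by positivity
      have p2 : 0 < (1 + |e|) / ‖ρ‖ ^ 2 := by positivity
      have hb : ∀ δ : ℝ × ℝ, ‖δ‖ ≤ C * (|(Φ δ).1| + |(Φ δ).2|) := fun δ => by
        have q1 := abs_nonneg (Φ δ).1
        have q2 := abs_nonneg (Φ δ).2
        have q3 := abs_nonneg e
        rw [Prod.norm_def, max_le_iff]
        constructor
        · have e1 : δ.1 = ((Φ δ).1 - e * (Φ δ).2) / ‖ρ‖ ^ 2 := by
            rw [h1, h2]; field_simp; ring
          rw [e1, norm_div, Real.norm_eq_abs, Real.norm_eq_abs, abs_of_pos (pow_pos hρ1 2)]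
          calc _ ≤ (|(Φ δ).1| + |e| * |(Φ δ).2|) / ‖ρ‖ ^ 2 := by
                gcongr
                rw [← abs_mul]
                exact abs_sub _ _
            _ ≤ (1 + |e|) * (|(Φ δ).1| + |(Φ δ).2|) / ‖ρ‖ ^ 2 := by
                gcongr
                nlinarith
            _ = (1 + |e|) / ‖ρ‖ ^ 2 * (|(Φ δ).1| + |(Φ δ).2|) := by ring
            _ ≤ _ := by gcongr; linarith
        · rw [← h2 δ, Real.norm_eq_abs]
          calc _ ≤ 1 * (|(Φ δ).1| + |(Φ δ).2|) := by linarith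
            _ ≤ _ := by gcongr; linarith
      refine ⟨Φ, C, hdet Φ _ hb, by linarith, fun δ => ?_, fun δ => ?_, fun δ => ?_, hb⟩
      · rw [hL]
        calc _ = 1 / ‖ρ‖ * (‖ρ‖ * ‖D.L δ i‖) := by field_simp
          _ ≤ _ := by gcongr; linarith
      · rw [hL]
        gcongr
        linarith
      · rw [h2]; exact norm_snd_le δ
  · left
    set t := |ρ.re * σ.im - ρ.im * σ.re| with htdef
    have ht0 : 0 < t := abs_pos.mpr ht
    refine ⟨1 + (‖ρ‖ + ‖σ‖) / t, by
      have : 0 ≤ (‖ρ‖ + ‖σ‖) / t := by positivity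
      linarith, fun δ => ?_⟩
    have e₁ : δ.1 * (ρ.re * σ.im - ρ.im * σ.re) = -(starRingEnd ℂ σ * D.L δ i).im := by
      simp [L, ← hρ, ← hσ]; ring
    have e₂ : δ.2 * (ρ.re * σ.im - ρ.im * σ.re) = (starRingEnd ℂ ρ * D.L δ i).im := by
      simp [L, ← hρ, ← hσ]; ring
    have a₁ := congrArg abs e₁
    have a₂ := congrArg abs e₂
    rw [abs_mul, ← htdef] at a₁ a₂
    rw [abs_neg] at a₁
    have b₁ := Complex.abs_im_le_norm (starRingEnd ℂ σ * D.L δ i)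
    have b₂ := Complex.abs_im_le_norm (starRingEnd ℂ ρ * D.L δ i)
    rw [norm_mul, Complex.norm_conj] at b₁ b₂
    have hL := norm_nonneg (D.L δ i)
    have h0 := mul_nonneg (norm_nonneg ρ) hL
    have h1 := mul_nonneg (norm_nonneg σ) hL
    have key : ‖δ‖ ≤ (‖ρ‖ + ‖σ‖) / t * ‖D.L δ i‖ := by
      rw [div_mul_eq_mul_div, le_div_iff₀ ht0, Prod.norm_def, Real.norm_eq_abs, Real.norm_eq_abs]
      rcases le_total |δ.1| |δ.2| with h | h
      · rw [max_eq_right h]; linarith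
      · rw [max_eq_left h]; linarith
    refine key.trans ?_
    gcongr
    linarith

end Pencil

/-- An elementary inequality for the measure of resonance classes. -/
lemma class_measure_arith {P Z A A' K c : ℝ} (hP : 0 < P) (hZ : 0 < Z) (hZP : Z ≤ P) (hA : 0 < A)
    (hA' : 0 < A') (hAP : A ≤ 2 * P) (hA'P : A' ≤ 2 * P) (hK : 1 ≤ K) (hAA : Z ^ 2 ≤ K * (A * A'))
    (hc : 0 < c) (hc1 : c ≤ 1) :
    1 / (P * A) * (1 / (P * A')) /
      (min 1 (c * (Z / A) ^ 2) * min 1 (c * (Z / A') ^ 2)) ≤ 13 * K / c ^ 2 / Z ^ 4 := by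
  have hmin : ∀ T : ℝ, 0 < T → 1 / min 1 (c * (Z / T) ^ 2) ≤ (1 + (T / Z) ^ 2) / c := by
    intro T hT
    rw [div_le_div_iff₀ (by positivity) hc, one_mul]
    rcases min_cases 1 (c * (Z / T) ^ 2) with ⟨h, -⟩ | ⟨h, -⟩
    · rw [h, mul_one]
      linarith [sq_nonneg (T / Z)]
    · rw [h]
      have : (1 + (T / Z) ^ 2) * (c * (Z / T) ^ 2) = c + c * (Z / T) ^ 2 := by
        field_simp; ring
      rw [this]
      have : 0 ≤ c * (Z / T) ^ 2 := by positivity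
      linarith
  have e : 1 / (P * A) * (1 / (P * A')) /
      (min 1 (c * (Z / A) ^ 2) * min 1 (c * (Z / A') ^ 2)) = 1 / (P ^ 2 * (A * A')) *
      ((1 / min 1 (c * (Z / A) ^ 2)) * (1 / min 1 (c * (Z / A') ^ 2))) := by
    field_simp
  rw [e]
  calc _ ≤ 1 / (P ^ 2 * (A * A')) * (((1 + (A / Z) ^ 2) / c) * ((1 + (A' / Z) ^ 2) / c)) := by
        have := hmin A hA
        have := hmin A' hA'
        gcongr
    _ = (1 / (P ^ 2 * (A * A')) + (A ^ 2 + A' ^ 2) / (Z ^ 2 * P ^ 2 * (A * A')) +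
        (A * A') / (P ^ 2 * Z ^ 4)) / c ^ 2 := by field_simp; ring
    _ ≤ (K / Z ^ 4 + 8 * K / Z ^ 4 + 4 / Z ^ 4) / c ^ 2 := by
        have hZP2 : Z ^ 2 ≤ P ^ 2 := by gcongr
        have hAA0 : 0 < A * A' := by positivity
        refine div_le_div_of_nonneg_right (add_le_add (add_le_add ?_ ?_) ?_) (by positivity)
        · rw [div_le_div_iff₀ (by positivity) (by positivity)]
          calc 1 * Z ^ 4 = Z ^ 2 * Z ^ 2 := by ring
            _ ≤ P ^ 2 * (K * (A * A')) := by gcongr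
            _ = _ := by ring
        · rw [div_le_div_iff₀ (by positivity) (by positivity)]
          calc (A ^ 2 + A' ^ 2) * Z ^ 4 ≤ ((2 * P) ^ 2 + (2 * P) ^ 2) * (Z ^ 2 * Z ^ 2) := by
                have : Z ^ 4 = Z ^ 2 * Z ^ 2 := by ring
                rw [this]; gcongr
            _ ≤ ((2 * P) ^ 2 + (2 * P) ^ 2) * (Z ^ 2 * (K * (A * A'))) := by gcongr
            _ = _ := by ring
        · rw [div_le_div_iff₀ (by positivity) (by positivity)]
          calc A * A' * Z ^ 4 ≤ (2 * P) * (2 * P) * Z ^ 4 := by gcongr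
            _ = _ := by ring
    _ ≤ (K / Z ^ 4 + 8 * K / Z ^ 4 + 4 * K / Z ^ 4) / c ^ 2 := by gcongr; linarith
    _ = _ := by field_simp; ring

namespace Pencil

variable {s : ℕ} {B₁ B₂ : Matrix (Fin s) (Fin s) ℤ} (D : Pencil s B₁ B₂)

lemma class_volume_aux (K : ℝ) (hK : 1 ≤ K) (i j : Fin s) (hij : i ≠ j) :
    ∃ C : ℝ, 1 ≤ C ∧ ∀ (P Z A A' : ℝ) (S : Finset (Fin s)), 0 < P → C ≤ Z → Z ≤ P → 0 < A →
      0 < A' → A ≤ 2 * P → A' ≤ 2 * P → Z ^ 2 ≤ K * (A * A') → i ∈ S → j ∈ S →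
      volume (D.resonanceClass P Z S i j A A') ≤ ENNReal.ofReal (C / Z ^ 4) := by
  obtain ⟨c, C₁, hc, hc1, hC₁, hgap⟩ := D.exists_class_gap
  obtain ⟨C₂, hC₂, hx, hy, -, hL, -⟩ := D.exists_coord_bound
  obtain ⟨C₃, hC₃, hind⟩ := D.exists_indep_bound
  rcases D.exists_coords i j hij with ⟨C₄, hC₄, hcoord⟩ | ⟨Φ, C₄, hdet, hC₄, hΦ1, hΦ2, hΦ3, hΦ4⟩
  · obtain ⟨C₅, hC₅, hcell⟩ := exists_volume_le_of_cells LinearMap.id (by simp)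
    set c' := c / (4 * C₂) with hc'
    have hc'0 : 0 < c' := by positivity
    have hc'1 : c' ≤ 1 := by rw [hc', div_le_one (by positivity)]; linarith
    set M := C₅ * (16 * C₄ ^ 2 * (13 * (2 * K) / c' ^ 2)) with hM
    have hM0 : 0 ≤ M := by positivity
    refine ⟨C₁ + M, by linarith, fun P Z A A' S hP hCZ hZP hA hA' hAP hA'P hAA hiS hjS => ?_⟩
    have hZ : 0 < Z := by linarith
    rcases (D.resonanceClass P Z S i j A A').eq_empty_or_nonempty with h | ⟨α₀, hα₀⟩
    · rw [h, measure_empty]; exact zero_le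
    have hA2 : A' ≤ 2 * A := by
      obtain ⟨-, a, g, n, -, -, hi, -, -, h2, h3, -⟩ := hα₀
      have := hi j hjS
      linarith
    set r := min 1 (c' * (Z / A) ^ 2) with hr
    have hr0 : 0 < r := by positivity
    have hb0 : 0 ≤ 4 * C₄ / (P * A) := by positivity
    refine (hcell _ r r (4 * C₄ / (P * A)) (4 * C₄ / (P * A)) hr0 (min_le_left _ _) hr0
      (min_le_left _ _) hb0 hb0 (fun α hα => hα.1) fun α hα α' hα' h1 h2 => ?_).trans ?_
    · simp only [LinearMap.id_coe, id_eq] at h1 h2 ⊢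
      have hδ : ‖α - α'‖ ≤ c' * (Z / A) ^ 2 := by
        rw [Prod.norm_def]
        exact max_le (h1.trans (min_le_right _ _)) (h2.trans (min_le_right _ _))
      have hLl : ∀ l, ‖D.L (α - α') l‖ ≤ c / 4 * (Z / A) ^ 2 := fun l => by
        calc _ ≤ C₂ * (c' * (Z / A) ^ 2) := (hL _ l).trans (by gcongr)
          _ = _ := by rw [hc']; field_simp
      have hg := (hgap P Z A A' S i j α α' hP hA hA' hiS hjS (by linarith) hα hα'
        ((hLl i).trans (by gcongr; linarith)) fun l _ _ => (hLl l).trans (by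
          calc c / 4 * (Z / A) ^ 2 = c * (Z / (2 * A)) ^ 2 := by field_simp; ring
            _ ≤ _ := by gcongr)).1
      have hfin : ‖α - α'‖ ≤ 4 * C₄ / (P * A) := by
        calc _ ≤ C₄ * (4 / (P * A)) := (hcoord _).trans (by gcongr)
          _ = _ := by ring
      exact ⟨(norm_fst_le (α - α')).trans hfin, (norm_snd_le (α - α')).trans hfin⟩
    · apply ENNReal.ofReal_le_ofReal
      have harith := class_measure_arith (P := P) (Z := Z) (A := A) (A' := A) (K := 2 * K) (c := c')
        hP hZ hZP hA hA hAP hAP (by linarith) (by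
          calc Z ^ 2 ≤ K * (A * A') := hAA
            _ ≤ K * (A * (2 * A)) := by gcongr
            _ = _ := by ring) hc'0 hc'1
      calc _ = C₅ * (16 * C₄ ^ 2 * (1 / (P * A) * (1 / (P * A)) / (r * r))) := by
            field_simp; ring
        _ ≤ C₅ * (16 * C₄ ^ 2 * (13 * (2 * K) / c' ^ 2 / Z ^ 4)) := by gcongr
        _ = M / Z ^ 4 := by rw [hM]; ring
        _ ≤ _ := by gcongr; linarith
  · obtain ⟨C₅, hC₅, hcell⟩ := exists_volume_le_of_cells Φ hdet
    set c' := c / (8 * C₂ * C₄) with hc'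
    have hc'0 : 0 < c' := by positivity
    have hc'1 : c' ≤ 1 := by
      rw [hc', div_le_one (by positivity)]
      have := mul_le_mul hC₂ hC₄ zero_le_one (by linarith)
      linarith
    set M := C₅ * (4 * C₄ * (12 * C₃) * (13 * K / c' ^ 2)) with hM
    have hM0 : 0 ≤ M := by positivity
    refine ⟨C₁ + M, by linarith, fun P Z A A' S hP hCZ hZP hA hA' hAP hA'P hAA hiS hjS => ?_⟩
    have hZ : 0 < Z := by linarith
    rcases (D.resonanceClass P Z S i j A A').eq_empty_or_nonempty with h | ⟨α₀, hα₀⟩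
    · rw [h, measure_empty]; exact zero_le
    have hA2 : A' ≤ 2 * A := by
      obtain ⟨-, a, g, n, -, -, hi, -, -, h2, h3, -⟩ := hα₀
      have := hi j hjS
      linarith
    set r₁ := min 1 (c' * (Z / A) ^ 2) with hr₁
    set r₂ := min 1 (c' * (Z / A') ^ 2) with hr₂
    have hr₁0 : 0 < r₁ := by positivity
    have hr₂0 : 0 < r₂ := by positivity
    refine (hcell _ r₁ r₂ (4 * C₄ / (P * A)) (12 * C₃ / (P * A')) hr₁0 (min_le_left _ _) hr₂0
      (min_le_left _ _) (by positivity) (by positivity) (fun α hα => hα.1)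
      fun α hα α' hα' h1 h2 => ?_).trans ?_
    · have hs1 := h1.trans (min_le_right _ _)
      have hs2 := h2.trans (min_le_right _ _)
      have hAA' : (Z / A) ^ 2 ≤ 4 * (Z / A') ^ 2 := by
        calc (Z / A) ^ 2 = 4 * (Z / (2 * A)) ^ 2 := by field_simp; ring
          _ ≤ _ := by gcongr
      have hLi : ‖D.L (α - α') i‖ ≤ c * (Z / A) ^ 2 := by
        calc _ ≤ C₄ * (c' * (Z / A) ^ 2) := (hΦ1 _).trans (by gcongr)
          _ = c * (Z / A) ^ 2 / (8 * C₂) := by rw [hc']; field_simp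
          _ ≤ _ := div_le_self (by positivity) (by linarith)
      have hg := hgap P Z A A' S i j α α' hP hA hA' hiS hjS (by linarith) hα hα' hLi
        fun l _ _ => by
          calc _ ≤ C₂ * (C₄ * (c' * (Z / A) ^ 2 + c' * (Z / A') ^ 2)) :=
                (hL _ l).trans (by gcongr; exact (hΦ4 _).trans (by gcongr))
            _ = c / 8 * ((Z / A) ^ 2 + (Z / A') ^ 2) := by rw [hc']; field_simp
            _ ≤ c / 8 * (4 * (Z / A') ^ 2 + (Z / A') ^ 2) := by gcongr
            _ ≤ _ := by
                have : 0 ≤ c * (Z / A') ^ 2 := by positivity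
                linarith
      refine ⟨?_, ?_⟩
      · calc _ ≤ C₄ * (4 / (P * A)) := (hΦ2 _).trans (by gcongr; exact hg.1)
          _ = _ := by ring
      · have h4 : 4 / (P * A) ≤ 8 / (P * A') := by
          rw [div_le_div_iff₀ (by positivity) (by positivity)]
          nlinarith
        calc _ ≤ C₃ * (8 / (P * A') + 4 / (P * A')) :=
              (hΦ3 _).trans ((hind i j hij _).trans (by
                gcongr
                · exact hg.1.trans h4
                · exact hg.2))
          _ = _ := by ring
    · apply ENNReal.ofReal_le_ofReal
      have harith := class_measure_arith hP hZ hZP hA hA' hAP hA'P hK hAA hc'0 hc'1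
      calc _ = C₅ * (4 * C₄ * (12 * C₃) * (1 / (P * A) * (1 / (P * A')) / (r₁ * r₂))) := by
            field_simp
        _ ≤ C₅ * (4 * C₄ * (12 * C₃) * (13 * K / c' ^ 2 / Z ^ 4)) := by gcongr
        _ = M / Z ^ 4 := by rw [hM]; ring
        _ ≤ _ := by gcongr; linarith

lemma exists_class_volume (K : ℝ) (hK : 1 ≤ K) :
    ∃ C : ℝ, 1 ≤ C ∧ ∀ (P Z A A' : ℝ) (S : Finset (Fin s)) i j, i ≠ j → 0 < P → C ≤ Z → Z ≤ P →
      0 < A → 0 < A' → A ≤ 2 * P → A' ≤ 2 * P → Z ^ 2 ≤ K * (A * A') → i ∈ S → j ∈ S →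
      volume (D.resonanceClass P Z S i j A A') ≤ ENNReal.ofReal (C / Z ^ 4) := by
  classical
  have h : ∀ i j : Fin s, ∃ C : ℝ, 1 ≤ C ∧ (i ≠ j → ∀ (P Z A A' : ℝ) (S : Finset (Fin s)), 0 < P →
      C ≤ Z → Z ≤ P → 0 < A → 0 < A' → A ≤ 2 * P → A' ≤ 2 * P → Z ^ 2 ≤ K * (A * A') → i ∈ S →
      j ∈ S → volume (D.resonanceClass P Z S i j A A') ≤ ENNReal.ofReal (C / Z ^ 4)) := by
    intro i j
    by_cases hij : i = j
    · exact ⟨1, le_rfl, fun h => absurd hij h⟩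
    · obtain ⟨C, hC, h⟩ := D.class_volume_aux K hK i j hij
      exact ⟨C, hC, fun _ => h⟩
  choose C hC1 hC using h
  have hle : ∀ i j, C i j ≤ ∑ i, ∑ j, C i j := fun i j =>
    (Finset.single_le_sum (f := fun j => C i j) (fun j _ => zero_le_one.trans (hC1 i j))
      (Finset.mem_univ j)).trans (Finset.single_le_sum (f := fun i => ∑ j, C i j)
        (fun i _ => Finset.sum_nonneg fun j _ => zero_le_one.trans (hC1 i j)) (Finset.mem_univ i))
  have h0 : 0 ≤ ∑ i, ∑ j, C i j :=
    Finset.sum_nonneg fun i _ => Finset.sum_nonneg fun j _ => zero_le_one.trans (hC1 i j)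
  refine ⟨1 + ∑ i, ∑ j, C i j, by linarith, fun P Z A A' S i j hij hP hZ hZP hA hA' h1 h2 h3 h4 h5
    => ?_⟩
  have := hle i j
  refine (hC i j hij P Z A A' S hP (by linarith) hZP hA hA' h1 h2 h3 h4 h5).trans ?_
  apply ENNReal.ofReal_le_ofReal
  gcongr
  linarith

end Pencil

lemma one_add_log_le_rpow {P : ℝ} (hP : 1 ≤ P) : 1 + Real.log P ≤ 101 * P ^ (1 / 100 : ℝ) := by
  have h1 := Real.log_le_rpow_div (by linarith : (0 : ℝ) ≤ P) (by norm_num : (0 : ℝ) < 1 / 100)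
  have h2 := Real.one_le_rpow hP (by norm_num : (0 : ℝ) ≤ 1 / 100)
  have h3 : P ^ (1 / 100 : ℝ) / (1 / 100) = 100 * P ^ (1 / 100 : ℝ) := by ring
  linarith

namespace Pencil

variable {s : ℕ} {B₁ B₂ : Matrix (Fin s) (Fin s) ℤ} (D : Pencil s B₁ B₂)

theorem exists_resonance_volume : ∃ C : ℝ, 1 ≤ C ∧ ∀ P Z : ℝ, 1 ≤ Z → Z ≤ P →
    volume {α : ℝ × ℝ | ‖α‖ ≤ 2 ∧ ∃ a g n, D.Resonance P Z α a g n} ≤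
      ENNReal.ofReal (C * P ^ (1 / 50 : ℝ) / Z ^ 4) := by
  classical
  obtain ⟨C₁, hC₁, hmin⟩ := D.exists_resonance_minors
  obtain ⟨C₂, hC₂, hvol⟩ := D.exists_class_volume C₁ hC₁
  have hlog2 : 0 < Real.log 2 := Real.log_pos (by norm_num)
  have hlogC : 0 ≤ Real.log C₁ := Real.log_nonneg hC₁
  set K : ℝ := (1 + (Real.log C₁ + 2) / Real.log 2) with hK
  have hK1 : 0 ≤ (Real.log C₁ + 2) / Real.log 2 := by positivity
  have hK0 : 0 ≤ K := by linarith
  set M : ℝ := (2 : ℝ) ^ s * (s * s) * ((K * 101) * (K * 101)) * C₂ with hM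
  have hM0 : 0 ≤ M := by positivity
  have hB0 : 0 ≤ 16 * C₂ ^ 4 := by positivity
  refine ⟨1 + 16 * C₂ ^ 4 + M, by linarith, fun P Z hZ1 hZP => ?_⟩
  have hP1 : 1 ≤ P := hZ1.trans hZP
  have hP0 : 0 < P := by linarith
  have hZ0 : 0 < Z := by linarith
  by_cases hCZ : C₂ ≤ Z
  swap
  · have hsub : {α : ℝ × ℝ | ‖α‖ ≤ 2 ∧ ∃ a g n, D.Resonance P Z α a g n} ⊆
        Set.Icc (-2) 2 ×ˢ Set.Icc (-2) 2 := fun α hα =>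
      ⟨abs_le.mp ((norm_fst_le α).trans hα.1), abs_le.mp ((norm_snd_le α).trans hα.1)⟩
    refine (measure_mono hsub).trans ?_
    rw [Measure.volume_eq_prod, Measure.prod_prod, Real.volume_Icc,
      ← ENNReal.ofReal_mul (by norm_num)]
    apply ENNReal.ofReal_le_ofReal
    rw [le_div_iff₀ (by positivity)]
    have h2 := Real.one_le_rpow hP1 (by norm_num : (0 : ℝ) ≤ 1 / 50)
    calc _ ≤ (2 - -2) * (2 - -2) * C₂ ^ 4 := by gcongr; linarith
      _ = 16 * C₂ ^ 4 * 1 := by ring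
      _ ≤ (1 + 16 * C₂ ^ 4 + M) * P ^ (1 / 50 : ℝ) := by gcongr; linarith
  set N : ℕ := ⌊Real.log (C₁ * P ^ 2) / Real.log 2⌋₊ + 1 with hN
  have hCP : 1 ≤ C₁ * P ^ 2 := by nlinarith [one_le_pow₀ hP1 (n := 2)]
  have hNle : (N : ℝ) ≤ K * (101 * P ^ (1 / 100 : ℝ)) := by
    have h1 : (N : ℝ) ≤ Real.log (C₁ * P ^ 2) / Real.log 2 + 1 := by
      rw [hN]; push_cast
      gcongr
      exact Nat.floor_le (div_nonneg (Real.log_nonneg hCP) hlog2.le)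
    rw [Real.log_mul (by positivity) (by positivity), Real.log_pow] at h1
    refine h1.trans (le_trans ?_ (mul_le_mul_of_nonneg_left (one_add_log_le_rpow hP1) hK0))
    have hlP := Real.log_nonneg hP1
    rw [hK]
    push_cast
    have e : (1 + (Real.log C₁ + 2) / Real.log 2) * (1 + Real.log P) -
        ((Real.log C₁ + 2 * Real.log P) / Real.log 2 + 1) =
        2 / Real.log 2 + Real.log P + Real.log C₁ * Real.log P / Real.log 2 := by
      field_simp; ring
    have : 0 ≤ 2 / Real.log 2 + Real.log P + Real.log C₁ * Real.log P / Real.log 2 := by positivity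
    linarith
  set I : Finset (Finset (Fin s) × (Fin s × Fin s) × (ℕ × ℕ)) :=
    Finset.univ ×ˢ (Finset.univ ×ˢ (Finset.range N ×ˢ Finset.range N)) with hI
  set T : Finset (Fin s) × (Fin s × Fin s) × (ℕ × ℕ) → Set (ℝ × ℝ) := fun t =>
    if t.2.1.1 ≠ t.2.1.2 ∧ t.2.1.1 ∈ t.1 ∧ t.2.1.2 ∈ t.1 ∧
      Z ^ 2 ≤ C₁ * (P / 2 ^ t.2.2.1 * (P / 2 ^ t.2.2.2)) then
      D.resonanceClass P Z t.1 t.2.1.1 t.2.1.2 (P / 2 ^ t.2.2.1) (P / 2 ^ t.2.2.2) else ∅ with hT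
  have hTvol : ∀ t, volume (T t) ≤ ENNReal.ofReal (C₂ / Z ^ 4) := by
    intro t
    simp only [hT]
    split_ifs with h
    · have hle : ∀ m : ℕ, P / 2 ^ m ≤ 2 * P := fun m =>
        (div_le_self hP0.le (one_le_pow₀ (by norm_num))).trans (by linarith)
      exact hvol P Z _ _ _ _ _ h.1 hP0 hCZ hZP (by positivity) (by positivity) (hle _) (hle _)
        h.2.2.2 h.2.1 h.2.2.1
    · rw [measure_empty]; exact zero_le
  have hsub : {α : ℝ × ℝ | ‖α‖ ≤ 2 ∧ ∃ a g n, D.Resonance P Z α a g n} ⊆ ⋃ t ∈ I, T t := by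
    rintro α ⟨hα, a, g, n, hR⟩
    obtain ⟨i, j, hij, hgi, hgj, hi, hj, p, r, z, ⟨u, v, hD⟩, hD2, -⟩ :=
      hmin P Z α a g n hP0 hZ0 hR
    have hai := hR.pos i
    have haj := hR.pos j
    have hZaa : Z ^ 2 ≤ C₁ * (a i * a j) := by
      have h1 : (1 : ℝ) ≤ |((p u * r v - p v * r u : ℤ) : ℝ)| := by
        exact_mod_cast Int.one_le_abs hD
      have := h1.trans (hD2 u v)
      rwa [le_div_iff₀ (by positivity), one_mul] at this
    have hZ2 : 1 ≤ Z ^ 2 := one_le_pow₀ hZ1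
    have hdy : ∀ x, 0 < x → x ≤ P → 1 ≤ C₁ * P * x →
        ∃ m : ℕ, m < N ∧ P / 2 ^ m / 2 ≤ x ∧ x ≤ P / 2 ^ m := by
      intro x hx hxP hx1
      obtain ⟨m, hm1, hm2⟩ := exists_nat_pow_near ((one_le_div hx).mpr hxP)
        (by norm_num : (1 : ℝ) < 2)
      refine ⟨m, ?_, ?_, ?_⟩
      · rw [hN, Nat.lt_succ_iff]
        apply Nat.le_floor
        rw [le_div_iff₀ hlog2, ← Real.log_pow]
        apply Real.log_le_log (by positivity)
        refine hm1.trans ?_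
        rw [div_le_iff₀ hx]
        nlinarith
      · rw [pow_succ, div_lt_iff₀ hx] at hm2
        rw [div_div, div_le_iff₀ (by positivity)]
        linarith
      · rw [le_div_iff₀ hx] at hm1
        rw [le_div_iff₀ (by positivity)]
        linarith
    obtain ⟨m, hm, hm1, hm2⟩ := hdy (a i) hai (hR.le i) (by
      calc 1 ≤ C₁ * (a i * a j) := hZ2.trans hZaa
        _ ≤ C₁ * (a i * P) := by gcongr; exact hR.le j
        _ = _ := by ring)
    obtain ⟨m', hm', hm1', hm2'⟩ := hdy (a j) haj (hR.le j) (by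
      calc 1 ≤ C₁ * (a i * a j) := hZ2.trans hZaa
        _ ≤ C₁ * (P * a j) := by gcongr; exact hR.le i
        _ = _ := by ring)
    set S : Finset (Fin s) := univ.filter fun l => D.x (realVec g) l ≠ 0 with hS
    have hmS : ∀ l, D.x (realVec g) l ≠ 0 ↔ l ∈ S := fun l => by simp [hS]
    simp only [Set.mem_iUnion]
    refine ⟨(S, (i, j), (m, m')), by simp [hI, hm, hm'], ?_⟩
    simp only [hT]
    rw [if_pos ⟨hij, (hmS i).mp hgi, (hmS j).mp hgj, hZaa.trans (by gcongr)⟩]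
    exact ⟨hα, a, g, n, hR, hmS, fun l hl => hi l ((hmS l).mpr hl),
      fun l hl hli => hj l hli ((hmS l).mpr hl), hm1, hm2, hm1', hm2'⟩
  have hcard : (I.card : ℝ) = 2 ^ s * (s * s) * (N * N) := by
    simp only [hI, Finset.card_product, Finset.card_univ, Fintype.card_finset, Fintype.card_prod,
      Fintype.card_fin, Finset.card_range]
    push_cast
    ring
  calc _ ≤ ∑ t ∈ I, volume (T t) := (measure_mono hsub).trans (measure_biUnion_finset_le _ _)
    _ ≤ ∑ t ∈ I, ENNReal.ofReal (C₂ / Z ^ 4) := Finset.sum_le_sum fun t _ => hTvol t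
    _ = ENNReal.ofReal (I.card * (C₂ / Z ^ 4)) := by
        rw [Finset.sum_const, nsmul_eq_mul, ENNReal.ofReal_mul (Nat.cast_nonneg _),
          ENNReal.ofReal_natCast]
    _ ≤ _ := by
        apply ENNReal.ofReal_le_ofReal
        rw [hcard]
        have hPP : P ^ (1 / 50 : ℝ) = P ^ (1 / 100 : ℝ) * P ^ (1 / 100 : ℝ) := by
          rw [← Real.rpow_add hP0]; norm_num
        calc _ ≤ 2 ^ s * (s * s) * ((K * (101 * P ^ (1 / 100 : ℝ))) *
              (K * (101 * P ^ (1 / 100 : ℝ)))) * (C₂ / Z ^ 4) := by gcongr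
          _ = M * P ^ (1 / 50 : ℝ) / Z ^ 4 := by rw [hPP, hM]; ring
          _ ≤ _ := by gcongr; linarith

/-- The distribution of `#weylSet`: the set where it is large has small measure, consists of points
near rationals of small height, and contains few rational points. -/
theorem exists_weylSet_distribution (D : Pencil s B₁ B₂) (hs : 0 < s) :
    ∃ c C₀ C : ℝ, 0 < c ∧ c ≤ 1 / 2 ∧ 1 ≤ C₀ ∧
    1 ≤ C ∧ ∀ P Z : ℝ, 1 ≤ Z → Z ≤ P →
    volume {α : ℝ × ℝ | ‖α‖ ≤ 2 ∧ C₀ * P * Z ^ (s - 1) ≤ (weylSet B₁ B₂ c P α).ncard} ≤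
      ENNReal.ofReal (C * P ^ (1 / 50 : ℝ) / Z ^ 4) ∧
    (∀ α, C * P ≤ Z ^ 3 → C₀ * P * Z ^ (s - 1) ≤ (weylSet B₁ B₂ c P α).ncard →
      ∃ (q : ℕ) (b₁ b₂ : ℤ), 1 ≤ q ∧ (q : ℝ) ≤ C * (P / Z) ^ 2 ∧ Int.gcd (Int.gcd b₁ b₂) q = 1 ∧
      ‖α - ((b₁ : ℝ) / q, (b₂ : ℝ) / q)‖ ≤ C / (q * Z ^ 2)) ∧
    (∀ (q : ℕ) (b₁ b₂ : ℤ), 1 ≤ q → Int.gcd (Int.gcd b₁ b₂) q = 1 → C * q ≤ P * Z →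
      C₀ * P * Z ^ (s - 1) ≤ (weylSet B₁ B₂ c P ((b₁ : ℝ) / q, (b₂ : ℝ) / q)).ncard →
      (q : ℝ) ≤ C * (P / Z) ^ 2) := by
  obtain ⟨c, C₀, hc, hc2, hC₀, hres⟩ := D.exists_resonance hs
  obtain ⟨C₁, hC₁, h₁⟩ := D.exists_resonance_volume
  obtain ⟨C₂, hC₂, h₂⟩ := D.exists_exact_rational
  obtain ⟨C₃, hC₃, h₃⟩ := D.exists_rational_bound
  refine ⟨c, C₀, C₁ + C₂ + C₃, hc, hc2, hC₀, by linarith, fun P Z hZ hZP => ?_⟩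
  have hZ0 : 0 < Z := by linarith
  have hP0 : 0 < P := by linarith
  have hpow : Z ^ ((s : ℝ) - 1) = Z ^ (s - 1) := by
    rw [← Real.rpow_natCast, Nat.cast_sub hs, Nat.cast_one]
  have hres' : ∀ α, C₀ * P * Z ^ (s - 1) ≤ (weylSet B₁ B₂ c P α).ncard →
      ∃ a g n, D.Resonance P Z α a g n := fun α h => hres P Z α hZ hZP (by rwa [hpow])
  refine ⟨?_, fun α hPZ hα => ?_, fun q b₁ b₂ hq hcop hqP hα => ?_⟩
  · have hsub : {α : ℝ × ℝ | ‖α‖ ≤ 2 ∧ C₀ * P * Z ^ (s - 1) ≤ (weylSet B₁ B₂ c P α).ncard} ⊆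
        {α : ℝ × ℝ | ‖α‖ ≤ 2 ∧ ∃ a g n, D.Resonance P Z α a g n} :=
      fun α hα => ⟨hα.1, hres' α hα.2⟩
    refine (measure_mono hsub).trans ((h₁ P Z hZ hZP).trans ?_)
    apply ENNReal.ofReal_le_ofReal
    gcongr
    linarith
  · obtain ⟨a, g, n, hR⟩ := hres' α hα
    obtain ⟨q, b₁, b₂, hq, h4, h5, h6⟩ := h₂ P Z α a g n hP0 hZ0
      (le_trans (by gcongr; linarith) hPZ) hR
    have : (0 : ℝ) < q := by exact_mod_cast hq
    refine ⟨q, b₁, b₂, hq, h4.trans ?_, h5, h6.trans ?_⟩ <;> gcongr <;> linarith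
  · obtain ⟨a, g, n, hR⟩ := hres' _ hα
    refine (h₃ P Z q b₁ b₂ a g n hP0 hZ0 hq hcop (le_trans ?_ hqP) hR).trans ?_ <;> gcongr <;>
      linarith

end Pencil

lemma e2pi_add (x y : ℝ) : e2pi (x + y) = e2pi x * e2pi y := by
  simp only [e2pi, ← Complex.exp_add]
  congr 1; push_cast; ring

lemma e2pi_zero : e2pi 0 = 1 := by simp [e2pi]

lemma e2pi_neg (x : ℝ) : e2pi (-x) = (starRingEnd ℂ) (e2pi x) := by
  simp only [e2pi, ← Complex.exp_conj]
  congr 1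
  simp only [map_mul, Complex.conj_ofReal, Complex.conj_I, map_ofNat, Complex.ofReal_neg]
  ring

lemma e2pi_eq_exp_I (x : ℝ) : e2pi x = Complex.exp ((2 * π * x : ℝ) * Complex.I) := by
  rw [e2pi]; congr 1; push_cast; ring

lemma norm_e2pi (x : ℝ) : ‖e2pi x‖ = 1 := by
  rw [e2pi_eq_exp_I, Complex.norm_exp_ofReal_mul_I]

lemma e2pi_intCast (n : ℤ) : e2pi n = 1 := by
  rw [e2pi, ← Complex.exp_int_mul_two_pi_mul_I n]
  congr 1; push_cast; ring

lemma e2pi_add_intCast (x : ℝ) (n : ℤ) : e2pi (x + n) = e2pi x := by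
  rw [e2pi_add, e2pi_intCast, mul_one]

lemma contDiff_e2pi {n : WithTop ℕ∞} : ContDiff ℝ n e2pi := by
  unfold e2pi
  have : ContDiff ℝ n (fun x : ℝ => (x : ℂ)) := Complex.ofRealCLM.contDiff
  exact (contDiff_const.mul this).cexp

lemma hasDerivAt_e2pi (x : ℝ) : HasDerivAt e2pi (2 * π * Complex.I * e2pi x) x := by
  unfold e2pi
  have h := ((Complex.ofRealCLM.hasDerivAt (x := x)).const_mul (2 * π * Complex.I)).cexp
  simp only [Complex.ofRealCLM_apply, Complex.ofReal_one, mul_one] at h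
  convert h using 1
  ring

/-- Distance of `e(θ)` to `1` in terms of the distance from `θ` to the nearest integer. -/
lemma four_mul_abs_sub_round_le (θ : ℝ) : 4 * |θ - round θ| ≤ ‖e2pi θ - 1‖ := by
  have h : e2pi θ = e2pi (θ - round θ) := by
    rw [← e2pi_add_intCast (θ - round θ) (round θ)]; congr 1; ring
  have hr := abs_sub_round θ
  rw [h, e2pi_eq_exp_I, mul_comm _ Complex.I, Complex.norm_exp_I_mul_ofReal_sub_one]
  set u := θ - round θ
  have h1 : 2 * π * u / 2 = π * u := by ring
  rw [h1, norm_mul, Real.norm_eq_abs, Real.norm_eq_abs, abs_two]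
  have h3 := Real.mul_abs_le_abs_sin (x := π * u) (by
    rw [abs_mul, abs_of_pos Real.pi_pos]; nlinarith [Real.pi_pos])
  rw [abs_mul, abs_of_pos Real.pi_pos] at h3
  have h4 : 2 / π * (π * |u|) = 2 * |u| := by field_simp
  rw [h4] at h3
  linarith

section WeylSums

variable {s : ℕ}

/-- The quadratic form `α₁ F₁ + α₂ F₂` at a real point. -/
noncomputable def phase (M₁ M₂ : Matrix (Fin s) (Fin s) ℤ) (α : ℝ × ℝ) (x : Fin s → ℝ) : ℝ :=
  α.1 * quadEval M₁ x + α.2 * quadEval M₂ x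

lemma quadEval_add {M : Matrix (Fin s) (Fin s) ℤ} (hM : M.IsSymm) (x h : Fin s → ℝ) :
    quadEval M (x + h) = quadEval M x + quadEval M h + ∑ i, x i * ∑ j, (2 * M i j : ℝ) * h j := by
  have key : ∑ i, ∑ j, (M i j : ℝ) * h i * x j = ∑ i, ∑ j, (M i j : ℝ) * x i * h j := by
    rw [Finset.sum_comm]
    refine Finset.sum_congr rfl fun i _ => Finset.sum_congr rfl fun j _ => ?_
    rw [hM.apply i j]; ring
  have e1 : ∑ i, x i * ∑ j, (2 * M i j : ℝ) * h j =
      ∑ i, ∑ j, (M i j : ℝ) * x i * h j + ∑ i, ∑ j, (M i j : ℝ) * h i * x j := by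
    rw [key, ← Finset.sum_add_distrib]
    refine Finset.sum_congr rfl fun i _ => ?_
    rw [Finset.mul_sum, ← Finset.sum_add_distrib]
    exact Finset.sum_congr rfl fun j _ => by ring
  rw [e1]
  simp only [quadEval, ← Finset.sum_add_distrib]
  refine Finset.sum_congr rfl fun i _ => Finset.sum_congr rfl fun j _ => ?_
  simp only [Pi.add_apply]; ring

lemma phase_add {M₁ M₂ : Matrix (Fin s) (Fin s) ℤ} (hM₁ : M₁.IsSymm) (hM₂ : M₂.IsSymm) (α : ℝ × ℝ)
    (x h : Fin s → ℝ) : phase M₁ M₂ α (x + h) = phase M₁ M₂ α x + phase M₁ M₂ α h +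
      ∑ i, x i * pencilMap (2 • M₁) (2 • M₂) α h i := by
  simp only [phase, quadEval_add hM₁, quadEval_add hM₂]
  have : ∀ i, pencilMap (2 • M₁) (2 • M₂) α h i = α.1 * ∑ j, (2 * M₁ i j : ℝ) * h j +
      α.2 * ∑ j, (2 * M₂ i j : ℝ) * h j := fun i => by
    rw [pencilMap_apply, Finset.mul_sum, Finset.mul_sum, ← Finset.sum_add_distrib]
    refine Finset.sum_congr rfl fun j _ => ?_
    simp; ring
  simp only [this]
  have e : ∑ i, x i * (α.1 * ∑ j, (2 * M₁ i j : ℝ) * h j + α.2 * ∑ j, (2 * M₂ i j : ℝ) * h j) =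
      α.1 * ∑ i, x i * ∑ j, (2 * M₁ i j : ℝ) * h j +
        α.2 * ∑ i, x i * ∑ j, (2 * M₂ i j : ℝ) * h j := by
    rw [Finset.mul_sum, Finset.mul_sum, ← Finset.sum_add_distrib]
    exact Finset.sum_congr rfl fun i _ => by ring
  rw [e]; ring

lemma card_int_ball_le {R : ℝ} (hR : 0 ≤ R) :
    ((finite_int_ball (s := s) R).toFinset.card : ℝ) ≤ (2 * R + 1) ^ s := by
  classical
  have hsub : (finite_int_ball (s := s) R).toFinset ⊆
      Fintype.piFinset fun _ : Fin s => Finset.Icc (-⌊R⌋) ⌊R⌋ := fun h hh => by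
    rw [Set.Finite.mem_toFinset] at hh
    refine Fintype.mem_piFinset.mpr fun i => ?_
    have : |(h i : ℝ)| ≤ R := (norm_le_pi_norm (realVec h) i).trans hh
    obtain ⟨h₁, h₂⟩ := abs_le.mp this
    exact Finset.mem_Icc.mpr ⟨neg_le.mp (Int.le_floor.mpr (by push_cast; linarith)),
      Int.le_floor.mpr h₂⟩
  have h1 := Finset.card_le_card hsub
  rw [Fintype.card_piFinset_const, Int.card_Icc] at h1
  have h0 : 0 ≤ ⌊R⌋ := Int.floor_nonneg.mpr hR
  have h2 : ((⌊R⌋ + 1 - -⌊R⌋).toNat : ℝ) ≤ 2 * R + 1 := by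
    have : (((⌊R⌋ + 1 - -⌊R⌋).toNat : ℤ) : ℝ) = ((⌊R⌋ + 1 - -⌊R⌋ : ℤ) : ℝ) := by
      rw [Int.toNat_of_nonneg (by omega)]
    have h3 := Int.floor_le R
    push_cast at this
    rw [this]; linarith
  calc ((finite_int_ball (s := s) R).toFinset.card : ℝ)
      ≤ (((⌊R⌋ + 1 - -⌊R⌋).toNat ^ s : ℕ) : ℝ) := by exact_mod_cast h1
    _ ≤ _ := by push_cast; gcongr

/-- A sum over integer vectors of a function supported in a ball. -/
lemma hasSum_int_ball {E : Type*} [AddCommMonoid E] [TopologicalSpace E] {R : ℝ}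
    {f : (Fin s → ℤ) → E} (hf : ∀ x, R < ‖realVec x‖ → f x = 0) :
    HasSum f (∑ x ∈ (finite_int_ball (s := s) R).toFinset, f x) :=
  hasSum_sum_of_ne_finset_zero fun x hx => hf x (by
    rw [Set.Finite.mem_toFinset] at hx
    exact lt_of_not_ge hx)

lemma norm_tsum_int_ball_le {R M : ℝ} (hR : 0 ≤ R) {f : (Fin s → ℤ) → ℂ}
    (hf : ∀ x, R < ‖realVec x‖ → f x = 0) (hM : ∀ x, ‖f x‖ ≤ M) :
    ‖∑' x, f x‖ ≤ (2 * R + 1) ^ s * M := by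
  rw [(hasSum_int_ball hf).tsum_eq]
  have hM0 : 0 ≤ M := (norm_nonneg _).trans (hM 0)
  calc _ ≤ ∑ x ∈ (finite_int_ball (s := s) R).toFinset, M :=
        (norm_sum_le _ _).trans (Finset.sum_le_sum fun x _ => hM x)
    _ = ((finite_int_ball (s := s) R).toFinset.card : ℝ) * M := by
        rw [Finset.sum_const, nsmul_eq_mul]
    _ ≤ _ := mul_le_mul_of_nonneg_right (card_int_ball_le hR) hM0

/-- The weighted exponential sum over integer points of the dilated support of `w`. -/
noncomputable def expSum (M₁ M₂ : Matrix (Fin s) (Fin s) ℤ) (w : (Fin s → ℝ) → ℝ) (P : ℝ)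
    (α : ℝ × ℝ) : ℂ :=
  ∑' x : Fin s → ℤ, (w (P⁻¹ • realVec x) : ℂ) * e2pi (phase M₁ M₂ α (realVec x))

/-- A function with compact support vanishes outside some ball of radius at least one. -/
lemma HasCompactSupport.exists_ball {E F : Type*} [NormedAddCommGroup E] [Zero F] {f : E → F}
    (hf : HasCompactSupport f) : ∃ ρ : ℝ, 1 ≤ ρ ∧ ∀ x, ρ < ‖x‖ → f x = 0 := by
  obtain ⟨r, hr⟩ := hf.isCompact.isBounded.exists_norm_le
  refine ⟨max r 1, le_max_right _ _, fun x hx => ?_⟩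
  by_contra hne
  have := hr x (subset_tsupport _ hne)
  exact absurd (lt_of_lt_of_le hx (this.trans (le_max_left _ _))) (lt_irrefl _)

lemma norm_inv_smul_gt {P ρ : ℝ} (hP : 0 < P) {x : Fin s → ℝ} (h : ρ * P < ‖x‖) :
    ρ < ‖P⁻¹ • x‖ := by
  rw [norm_smul, norm_inv, Real.norm_eq_abs, abs_of_pos hP, inv_mul_eq_div, lt_div_iff₀ hP]
  exact h

section Differences

variable {E : Type*} [NormedAddCommGroup E] [NormedSpace ℝ E]

/-- The derivative of `f` in the direction `v`. -/
noncomputable def derivAlong (v : E) (f : E → ℂ) : E → ℂ := fun x => fderiv ℝ f x v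

lemma contDiff_derivAlong {f : E → ℂ} (hf : ContDiff ℝ (⊤ : ℕ∞) f) (v : E) :
    ContDiff ℝ (⊤ : ℕ∞) (derivAlong v f) :=
  (hf.fderiv_right (m := (⊤ : ℕ∞)) (by simp)).clm_apply contDiff_const

lemma HasCompactSupport.derivAlong {f : E → ℂ} (hf : HasCompactSupport f) (v : E) :
    HasCompactSupport (derivAlong v f) := hf.fderiv_apply (𝕜 := ℝ) v

lemma hasDerivAt_derivAlong {f : E → ℂ} (hf : ContDiff ℝ (⊤ : ℕ∞) f) (v x : E) (t : ℝ) :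
    HasDerivAt (fun t : ℝ => f (x + t • v)) (derivAlong v f (x + t • v)) t := by
  have h1 : HasFDerivAt f (fderiv ℝ f (x + t • v)) (x + t • v) :=
    (hf.differentiable (by simp) _).hasFDerivAt
  have h2 : HasDerivAt (fun t : ℝ => x + t • v) v t := by
    simpa using ((hasDerivAt_id t).smul_const v).const_add x
  exact h1.comp_hasDerivAt t h2

lemma hasDerivAt_fwdDiff_iter {f f' : E → ℂ} {v h : E}
    (hf : ∀ x (t : ℝ), HasDerivAt (fun t : ℝ => f (x + t • v)) (f' (x + t • v)) t) (n : ℕ) :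
    ∀ x (t : ℝ), HasDerivAt (fun t : ℝ => (fwdDiff h)^[n] f (x + t • v))
      ((fwdDiff h)^[n] f' (x + t • v)) t := by
  induction n with
  | zero => exact hf
  | succ n ih =>
    intro x t
    simp only [Function.iterate_succ_apply', fwdDiff]
    refine HasDerivAt.sub ?_ (ih x t)
    have := ih (x + h) t
    simp only [add_right_comm _ h] at this
    exact this

lemma exists_fwdDiff_bound {f : E → ℂ} (hf : ContDiff ℝ (⊤ : ℕ∞) f) (hc : HasCompactSupport f)
    (v : E) (n : ℕ) : ∃ C : ℝ, 0 ≤ C ∧ ∀ ε : ℝ, 0 ≤ ε → ∀ x,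
      ‖(fwdDiff (ε • v))^[n] f x‖ ≤ C * ε ^ n := by
  induction n generalizing f with
  | zero =>
    obtain ⟨C, hC⟩ := hf.continuous.bounded_above_of_compact_support hc
    exact ⟨C, (norm_nonneg _).trans (hC 0), fun ε _ x => by simpa using hC x⟩
  | succ n ih =>
    obtain ⟨C, hC0, hC⟩ := ih (contDiff_derivAlong hf v) (hc.derivAlong v)
    refine ⟨C, hC0, fun ε hε x => ?_⟩
    rw [Function.iterate_succ_apply', fwdDiff]
    have hd := hasDerivAt_fwdDiff_iter (h := ε • v) (hasDerivAt_derivAlong hf v) n x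
    have := norm_image_sub_le_of_norm_deriv_le_segment' (a := 0) (b := ε)
      (fun t _ => (hd t).hasDerivWithinAt) (fun t _ => hC ε hε _) ε ⟨hε, le_rfl⟩
    simp only [zero_smul, add_zero, sub_zero] at this
    rw [pow_succ, ← mul_assoc]
    exact this

lemma fwdDiff_iter_eq_zero {E : Type*} [NormedAddCommGroup E] {f : E → ℂ} {h : E} {ρ : ℝ}
    (hh : ‖h‖ ≤ 1)
    (hf : ∀ x, ρ < ‖x‖ → f x = 0) (n : ℕ) :
    ∀ x, ρ + n < ‖x‖ → (fwdDiff h)^[n] f x = 0 := by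
  induction n with
  | zero => simpa using hf
  | succ n ih =>
    intro x hx
    push_cast at hx
    rw [Function.iterate_succ_apply', fwdDiff, ih x (by linarith), ih (x + h), sub_zero]
    have := norm_sub_le (x + h) h
    rw [add_sub_cancel_right] at this
    linarith

lemma fwdDiff_iter_prod {E F : Type*} [AddCommGroup E] [AddCommGroup F] (f : F × E → ℂ) (t : F)
    (h : E) (n : ℕ) :
    (fwdDiff h)^[n] (fun x => f (t, x)) = fun x => (fwdDiff ((0 : F), h))^[n] f (t, x) := by
  induction n with
  | zero => rfl
  | succ n ih =>
    ext x
    simp only [Function.iterate_succ_apply', ih, fwdDiff, Prod.mk_add_mk, add_zero]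

end Differences

/-- The sum of `f` over the dilated lattice, twisted by the character `θ`. -/
noncomputable def twistedSum (P : ℝ) (θ : Fin s → ℝ) (f : (Fin s → ℝ) → ℂ) : ℂ :=
  ∑' y : Fin s → ℤ, f (P⁻¹ • realVec y) * e2pi (∑ i, (y i : ℝ) * θ i)

lemma realVec_add (h k : Fin s → ℤ) : realVec (h + k) = realVec h + realVec k := by
  ext i; simp [realVec]

lemma realVec_single (i : Fin s) : realVec (Pi.single i 1) = Pi.single i 1 := by
  ext j; by_cases h : j = i
  · subst h; simp [realVec]
  · simp [realVec, h]

lemma twistedSum_fwdDiff {P ρ : ℝ} (hP : 0 < P) (θ : Fin s → ℝ) {f : (Fin s → ℝ) → ℂ}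
    (hf : ∀ x, ρ < ‖x‖ → f x = 0) (i : Fin s) :
    twistedSum P θ (fwdDiff (P⁻¹ • Pi.single i 1) f) =
      (e2pi (-θ i) - 1) * twistedSum P θ f := by
  have hs : Summable fun y : Fin s → ℤ => f (P⁻¹ • realVec y) * e2pi (∑ i, (y i : ℝ) * θ i) :=
    (hasSum_int_ball (R := ρ * P) fun x hx => by
      rw [hf _ (norm_inv_smul_gt hP hx), zero_mul]).summable
  have hshift : ∀ y : Fin s → ℤ, f (P⁻¹ • realVec y + P⁻¹ • Pi.single i 1) *
      e2pi (∑ i, (y i : ℝ) * θ i) = e2pi (-θ i) *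
      (fun y : Fin s → ℤ => f (P⁻¹ • realVec y) * e2pi (∑ i, (y i : ℝ) * θ i))
        (Equiv.addRight (Pi.single i 1) y) := by
    intro y
    simp only [Equiv.coe_addRight, realVec_add, smul_add, realVec_single]
    have : ∑ j, (((y + Pi.single i 1 : Fin s → ℤ) j : ℤ) : ℝ) * θ j =
        ∑ j, (y j : ℝ) * θ j + θ i := by
      have e : ∀ j, (((y + Pi.single i 1 : Fin s → ℤ) j : ℤ) : ℝ) * θ j =
          (y j : ℝ) * θ j + if j = i then θ j else 0 := fun j => by
        by_cases h : j = i
        · subst h; simp; ring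
        · simp [h]
      simp only [e, Finset.sum_add_distrib, Finset.sum_ite_eq', Finset.mem_univ, if_true]
    rw [this, e2pi_add]
    have h1 : e2pi (-θ i) * e2pi (θ i) = 1 := by rw [← e2pi_add, neg_add_cancel, e2pi_zero]
    calc _ = f (P⁻¹ • realVec y + P⁻¹ • Pi.single i 1) * e2pi (∑ j, (y j : ℝ) * θ j) *
          (e2pi (-θ i) * e2pi (θ i)) := by rw [h1, mul_one]
      _ = _ := by ring
  set g : (Fin s → ℤ) → ℂ := fun y => f (P⁻¹ • realVec y) * e2pi (∑ i, (y i : ℝ) * θ i) with hg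
  set σ : (Fin s → ℤ) ≃ (Fin s → ℤ) := Equiv.addRight (Pi.single i 1)
  have h1 : HasSum (fun y => e2pi (-θ i) * g (σ y) - g y) (e2pi (-θ i) * ∑' y, g y - ∑' y, g y) :=
    ((σ.hasSum_iff.mpr hs.hasSum).mul_left _).sub hs.hasSum
  rw [sub_mul, one_mul]
  refine Eq.trans (tsum_congr fun y => ?_) h1.tsum_eq
  rw [← hshift y, fwdDiff, sub_mul]

lemma twistedSum_fwdDiff_iter {P ρ : ℝ} (hP : 1 ≤ P) (θ : Fin s → ℝ) {f : (Fin s → ℝ) → ℂ}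
    (hf : ∀ x, ρ < ‖x‖ → f x = 0) (i : Fin s) (n : ℕ) :
    twistedSum P θ ((fwdDiff (P⁻¹ • Pi.single i 1))^[n] f) =
      (e2pi (-θ i) - 1) ^ n * twistedSum P θ f := by
  have hh : ‖P⁻¹ • (Pi.single i 1 : Fin s → ℝ)‖ ≤ 1 := by
    rw [norm_smul, Pi.norm_single, norm_one, mul_one, norm_inv, Real.norm_eq_abs,
      abs_of_pos (by linarith)]
    exact inv_le_one_of_one_le₀ hP
  induction n with
  | zero => simp
  | succ n ih =>
    rw [Function.iterate_succ_apply', twistedSum_fwdDiff (by linarith) θ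
      (fwdDiff_iter_eq_zero hh hf n) i, ih]
    ring

lemma norm_twistedSum_le {P ρ M : ℝ} (hP : 1 ≤ P) (hρ : 0 ≤ ρ) (θ : Fin s → ℝ)
    {f : (Fin s → ℝ) → ℂ} (hf : ∀ x, ρ < ‖x‖ → f x = 0) (hM : ∀ x, ‖f x‖ ≤ M) :
    ‖twistedSum P θ f‖ ≤ (2 * ρ + 1) ^ s * P ^ s * M := by
  have hM0 : 0 ≤ M := (norm_nonneg _).trans (hM 0)
  refine (norm_tsum_int_ball_le (R := ρ * P) (M := M) (by positivity) (fun x hx => ?_)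
    fun x => ?_).trans ?_
  · rw [hf _ (norm_inv_smul_gt (by linarith) hx), zero_mul]
  · rw [norm_mul, norm_e2pi, mul_one]; exact hM _
  · rw [← mul_pow]
    gcongr
    nlinarith

lemma one_add_pow_le {a : ℝ} (ha : 0 ≤ a) (n : ℕ) : (1 + a) ^ n ≤ 2 ^ n * (1 + a ^ n) := by
  rcases le_total a 1 with h | h
  · calc (1 + a) ^ n ≤ 2 ^ n := by gcongr; linarith
      _ ≤ _ := le_mul_of_one_le_right (by positivity) (by linarith [pow_nonneg ha n])
  · calc (1 + a) ^ n ≤ (2 * a) ^ n := by gcongr; linarith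
      _ = 2 ^ n * a ^ n := mul_pow _ _ _
      _ ≤ _ := by gcongr; linarith

/-- Rapid decay of twisted lattice sums of the correlations of a smooth weight. -/
lemma exists_twistedSum_decay {w : (Fin s → ℝ) → ℝ} (hw : ContDiff ℝ (⊤ : ℕ∞) w)
    (hc : HasCompactSupport w) (n : ℕ) : ∃ K : ℝ, 0 ≤ K ∧ ∀ P : ℝ, 1 ≤ P → ∀ t θ i,
      ‖twistedSum P θ (fun x => ((w (t + x) * w x : ℝ) : ℂ))‖ *
        (1 + P * |θ i - round (θ i)|) ^ n ≤ K * P ^ s := by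
  obtain ⟨ρ, hρ1, hρ⟩ := hc.exists_ball
  set Φ : (Fin s → ℝ) × (Fin s → ℝ) → ℂ := fun p => ((w (p.1 + p.2) * w p.2 : ℝ) : ℂ) with hΦ
  have hΦs : ContDiff ℝ (⊤ : ℕ∞) Φ := Complex.ofRealCLM.contDiff.comp
    ((hw.comp (contDiff_fst.add contDiff_snd)).mul (hw.comp contDiff_snd))
  have hΦ0 : ∀ t x, ρ < ‖x‖ → Φ (t, x) = 0 := fun t x hx => by simp [hΦ, hρ x hx]
  have hΦc : HasCompactSupport Φ := by
    refine HasCompactSupport.of_support_subset_isCompact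
      (isCompact_closedBall (0 : (Fin s → ℝ) × (Fin s → ℝ)) (2 * ρ)) fun p hp => ?_
    rw [mem_closedBall_zero_iff]
    by_contra hgt
    apply hp
    have h2 : ‖p.2‖ ≤ ρ := by
      by_contra h
      exact hp (hΦ0 p.1 p.2 (not_le.mp h))
    have h1 : 2 * ρ < ‖p.1‖ := by
      rcases lt_max_iff.mp (not_le.mp hgt) with h | h
      · exact h
      · linarith
    have h3 := norm_sub_le (p.1 + p.2) p.2
    rw [add_sub_cancel_right] at h3
    simp [hΦ, hρ (p.1 + p.2) (by linarith)]
  obtain ⟨C₀, hC₀⟩ := hΦs.continuous.bounded_above_of_compact_support hΦc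
  have hC₀0 : 0 ≤ C₀ := (norm_nonneg _).trans (hC₀ 0)
  choose C hC0 hC using fun i : Fin s =>
    exists_fwdDiff_bound hΦs hΦc ((0 : Fin s → ℝ), Pi.single i 1) n
  have hCi : ∀ i, C i ≤ ∑ j, C j := fun i =>
    Finset.single_le_sum (f := C) (fun j _ => hC0 j) (Finset.mem_univ i)
  have hCs : 0 ≤ ∑ j, C j := Finset.sum_nonneg fun j _ => hC0 j
  refine ⟨2 ^ n * ((2 * (ρ + n) + 1) ^ s * (C₀ + ∑ j, C j)), by positivity,
    fun P hP t θ i => ?_⟩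
  have hP0 : 0 < P := by linarith
  set u := |θ i - round (θ i)| with hu
  have hu0 : 0 ≤ u := abs_nonneg _
  set T := twistedSum P θ (fun x => Φ (t, x)) with hT
  have h1 : ‖T‖ ≤ (2 * (ρ + n) + 1) ^ s * P ^ s * C₀ :=
    norm_twistedSum_le hP (by positivity) θ (fun x hx => hΦ0 t x (lt_of_le_of_lt (by simp) hx))
      fun x => hC₀ _
  have hh : ‖P⁻¹ • (Pi.single i 1 : Fin s → ℝ)‖ ≤ 1 := by
    rw [norm_smul, Pi.norm_single, norm_one, mul_one, norm_inv, Real.norm_eq_abs,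
      abs_of_pos (by linarith)]
    exact inv_le_one_of_one_le₀ hP
  have h2 : ‖(e2pi (-θ i) - 1) ^ n * T‖ ≤
      (2 * (ρ + n) + 1) ^ s * P ^ s * ((∑ j, C j) * P⁻¹ ^ n) := by
    rw [hT, ← twistedSum_fwdDiff_iter hP θ (hΦ0 t) i n]
    refine norm_twistedSum_le hP (by positivity) θ (fwdDiff_iter_eq_zero hh (hΦ0 t) n) fun x => ?_
    rw [fwdDiff_iter_prod]
    have := hC i P⁻¹ (by positivity) (t, x)
    rw [Prod.smul_mk, smul_zero] at this
    exact this.trans (mul_le_mul_of_nonneg_right (hCi i) (by positivity))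
  have h3 : u ≤ ‖e2pi (-θ i) - 1‖ := by
    have h4 := four_mul_abs_sub_round_le (θ i)
    have h5 : ‖e2pi (-θ i) - 1‖ = ‖e2pi (θ i) - 1‖ := by
      rw [e2pi_neg, ← Complex.norm_conj, map_sub, Complex.conj_conj, map_one]
    rw [h5]; linarith
  have h4 : (P * u) ^ n * ‖T‖ ≤ (2 * (ρ + n) + 1) ^ s * P ^ s * ∑ j, C j := by
    rw [norm_mul, norm_pow] at h2
    calc (P * u) ^ n * ‖T‖ ≤ (P * ‖e2pi (-θ i) - 1‖) ^ n * ‖T‖ := by gcongr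
      _ = P ^ n * (‖e2pi (-θ i) - 1‖ ^ n * ‖T‖) := by rw [mul_pow]; ring
      _ ≤ P ^ n * ((2 * (ρ + n) + 1) ^ s * P ^ s * ((∑ j, C j) * P⁻¹ ^ n)) := by gcongr
      _ = (2 * (ρ + n) + 1) ^ s * P ^ s * ((∑ j, C j) * (P * P⁻¹) ^ n) := by rw [mul_pow]; ring
      _ = _ := by rw [mul_inv_cancel₀ hP0.ne', one_pow, mul_one]
  calc ‖T‖ * (1 + P * u) ^ n ≤ ‖T‖ * (2 ^ n * (1 + (P * u) ^ n)) := by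
        gcongr; exact one_add_pow_le (by positivity) n
    _ = 2 ^ n * (‖T‖ + (P * u) ^ n * ‖T‖) := by ring
    _ ≤ 2 ^ n * ((2 * (ρ + n) + 1) ^ s * P ^ s * C₀ +
        (2 * (ρ + n) + 1) ^ s * P ^ s * ∑ j, C j) := by gcongr
    _ = _ := by ring

lemma norm_sq_expSum_le {M₁ M₂ : Matrix (Fin s) (Fin s) ℤ} (hM₁ : M₁.IsSymm) (hM₂ : M₂.IsSymm)
    {w : (Fin s → ℝ) → ℝ} {ρ : ℝ} (hρ : ∀ x, ρ < ‖x‖ → w x = 0) {P : ℝ} (hP : 0 < P) (α : ℝ × ℝ) :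
    ‖expSum M₁ M₂ w P α‖ ^ 2 ≤ ∑ h ∈ (finite_int_ball (s := s) (2 * ρ * P)).toFinset,
      ‖twistedSum P (pencilMap (2 • M₁) (2 • M₂) α (realVec h))
        (fun x => ((w (P⁻¹ • realVec h + x) * w x : ℝ) : ℂ))‖ := by
  obtain ⟨f, hf⟩ : ∃ f : (Fin s → ℤ) → ℂ, f = fun x => (w (P⁻¹ • realVec x) : ℂ) *
    e2pi (phase M₁ M₂ α (realVec x)) := ⟨_, rfl⟩
  have hf0 : ∀ x, ρ * P < ‖realVec x‖ → f x = 0 := fun x hx => by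
    simp [hf, hρ _ (norm_inv_smul_gt hP hx)]
  set B := (finite_int_ball (s := s) (ρ * P)).toFinset with hB
  set B₂ := (finite_int_ball (s := s) (2 * ρ * P)).toFinset with hB₂
  set S := expSum M₁ M₂ w P α with hS
  have hSB : HasSum f S := by
    have := (hasSum_int_ball hf0).summable.hasSum
    rwa [hf] at this ⊢
  have hSx : ∀ y ∈ B, S = ∑ h ∈ B₂, f (h + y) := fun y hy => by
    have h1 : HasSum (fun h => f (h + y)) S := (Equiv.addRight y).hasSum_iff.mpr hSB
    have h2 : ∀ h, 2 * ρ * P < ‖realVec h‖ → (fun h => f (h + y)) h = 0 := by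
      intro h hh
      refine hf0 _ ?_
      have hy' : ‖realVec y‖ ≤ ρ * P := by
        rw [hB, Set.Finite.mem_toFinset] at hy
        exact hy
      have := norm_sub_le (realVec (h + y)) (realVec y)
      rw [realVec_add, add_sub_cancel_right] at this
      rw [realVec_add]
      linarith
    exact h1.unique (hasSum_int_ball h2)
  have hconj : (starRingEnd ℂ) S = ∑ y ∈ B, (starRingEnd ℂ) (f y) := by
    rw [← map_sum, hSB.unique (hasSum_int_ball hf0)]
  have hcomm : S * (starRingEnd ℂ) S = ∑ h ∈ B₂, ∑ y ∈ B, f (h + y) * (starRingEnd ℂ) (f y) := by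
    rw [hconj, Finset.mul_sum, Finset.sum_comm]
    refine Finset.sum_congr rfl fun y hy => ?_
    rw [hSx y hy, Finset.sum_mul]
  have hinner : ∀ h, ∑ y ∈ B, f (h + y) * (starRingEnd ℂ) (f y) =
      e2pi (phase M₁ M₂ α (realVec h)) *
        twistedSum P (pencilMap (2 • M₁) (2 • M₂) α (realVec h))
          (fun x => ((w (P⁻¹ • realVec h + x) * w x : ℝ) : ℂ)) := fun h => by
    have h0 : ∀ y, ρ * P < ‖realVec y‖ → (fun y => f (h + y) * (starRingEnd ℂ) (f y)) y = 0 :=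
      fun y hy => by simp [hf0 y hy]
    rw [← (hasSum_int_ball h0).tsum_eq, twistedSum, ← tsum_mul_left]
    refine tsum_congr fun y => ?_
    have hph : phase M₁ M₂ α (realVec h + realVec y) = phase M₁ M₂ α (realVec y) +
        phase M₁ M₂ α (realVec h) +
          ∑ i, (y i : ℝ) * pencilMap (2 • M₁) (2 • M₂) α (realVec h) i := by
      rw [add_comm (realVec h), phase_add hM₁ hM₂]; rfl
    have h1 : e2pi (phase M₁ M₂ α (realVec y)) *
        (starRingEnd ℂ) (e2pi (phase M₁ M₂ α (realVec y))) = 1 := by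
      rw [← e2pi_neg, ← e2pi_add, add_neg_cancel, e2pi_zero]
    simp only [hf, realVec_add, hph, e2pi_add, map_mul, Complex.conj_ofReal, smul_add,
      Complex.ofReal_mul]
    linear_combination ((w (P⁻¹ • realVec h + P⁻¹ • realVec y) : ℂ) *
      e2pi (phase M₁ M₂ α (realVec h)) *
      e2pi (∑ i, (y i : ℝ) * pencilMap (2 • M₁) (2 • M₂) α (realVec h) i) *
      (w (P⁻¹ • realVec y) : ℂ)) * h1
  have hnorm : ‖S‖ ^ 2 = ‖S * (starRingEnd ℂ) S‖ := by
    rw [norm_mul, Complex.norm_conj, sq]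
  rw [hnorm, hcomm]
  refine (norm_sum_le _ _).trans (Finset.sum_le_sum fun h _ => ?_)
  rw [hinner, norm_mul, norm_e2pi, one_mul]

lemma summable_one_add_abs_inv_sq : Summable fun k : ℤ => ((1 + |(k : ℝ)|) ^ 2)⁻¹ := by
  have h : Summable fun n : ℕ => ((1 + |((n : ℤ) : ℝ)|) ^ 2)⁻¹ := by
    have h1 := (summable_nat_add_iff 1).mpr (Real.summable_nat_pow_inv.mpr one_lt_two)
    refine h1.congr fun n => ?_
    rw [Int.cast_natCast, abs_of_nonneg (Nat.cast_nonneg n), add_comm]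
    push_cast; rfl
  refine Summable.of_nat_of_neg h ?_
  simpa using h

lemma exists_sum_prod_le : ∃ Z : ℝ, 0 ≤ Z ∧ ∀ T : Finset ℤ,
    ∑ k ∈ Fintype.piFinset (fun _ : Fin s => T), ∏ i, ((1 + |(k i : ℝ)|) ^ 2)⁻¹ ≤ Z := by
  refine ⟨(∑' k : ℤ, ((1 + |(k : ℝ)|) ^ 2)⁻¹) ^ s, by positivity, fun T => ?_⟩
  have h := Finset.prod_univ_sum (fun _ : Fin s => T)
    (fun (_ : Fin s) (k : ℤ) => ((1 + |(k : ℝ)|) ^ 2)⁻¹)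
  rw [← h, Finset.prod_const, Finset.card_univ, Fintype.card_fin]
  have := summable_one_add_abs_inv_sq.sum_le_tsum T (fun k _ => by positivity)
  exact pow_le_pow_left₀ (Finset.sum_nonneg fun k _ => by positivity) this s

/-- Integer vectors whose positions and twists lie in a common cell. -/
lemma card_cell_le (B₁ B₂ : Matrix (Fin s) (Fin s) ℤ) {c P : ℝ} (hc : 0 < c) (hP : 0 < P)
    (α : ℝ × ℝ) (H : Finset (Fin s → ℤ)) (n : (Fin s → ℤ) → (Fin s → ℤ)) (m k : Fin s → ℤ)
    (hm : ∀ h ∈ H, ∀ i, ⌊(h i : ℝ) / (c * P)⌋ = m i)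
    (hk : ∀ h ∈ H, ∀ i, ⌊P * (pencilMap B₁ B₂ α (realVec h) i - n h i) / c⌋ = k i) :
    H.card ≤ (weylSet B₁ B₂ c P α).ncard := by
  rcases H.eq_empty_or_nonempty with rfl | ⟨h₀, h₀H⟩
  · simp
  rw [Set.ncard_eq_toFinset_card _ (weylSet_finite B₁ B₂ c P α)]
  refine Finset.card_le_card_of_injOn (fun h => h - h₀) (fun h hh => ?_)
    (fun a _ b _ hab => sub_left_injective hab)
  rw [Finset.mem_coe, Set.Finite.mem_toFinset]
  refine ⟨(pi_norm_le_iff_of_nonneg (by positivity)).mpr fun i => ?_, n h - n h₀,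
    (pi_norm_le_iff_of_nonneg (by positivity)).mpr fun i => ?_⟩
  · have := Int.abs_sub_lt_one_of_floor_eq_floor ((hm h hh i).trans (hm h₀ h₀H i).symm)
    rw [← sub_div, abs_div, abs_of_pos (by positivity : 0 < c * P),
      div_lt_one (by positivity)] at this
    rw [realVec_sub, Pi.sub_apply, Real.norm_eq_abs]
    exact this.le
  · have := Int.abs_sub_lt_one_of_floor_eq_floor ((hk h hh i).trans (hk h₀ h₀H i).symm)
    rw [← sub_div, abs_div, abs_of_pos hc, div_lt_one hc, ← mul_sub, abs_mul, abs_of_pos hP] at this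
    rw [le_div_iff₀ hP, mul_comm, Real.norm_eq_abs]
    refine le_of_eq_of_le ?_ this.le
    congr 2
    simp only [realVec_sub, map_sub, Pi.sub_apply, realVec_apply]
    ring

/-- Weyl's inequality. -/
theorem exists_weyl_inequality {M₁ M₂ : Matrix (Fin s) (Fin s) ℤ} (hs : 0 < s)
    (hM₁ : M₁.IsSymm) (hM₂ : M₂.IsSymm)
    {w : (Fin s → ℝ) → ℝ} (hw : ContDiff ℝ (⊤ : ℕ∞) w) (hwc : HasCompactSupport w)
    {c : ℝ} (hc : 0 < c) (hc1 : c ≤ 1) : ∃ C : ℝ, 1 ≤ C ∧ ∀ P : ℝ, 1 ≤ P → ∀ α,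
      ‖expSum M₁ M₂ w P α‖ ^ 2 ≤
        C * P ^ s * (weylSet (2 • M₁) (2 • M₂) c P α).ncard := by
  classical
  obtain ⟨ρ, hρ1, hρ⟩ := hwc.exists_ball
  obtain ⟨K, hK0, hK⟩ := exists_twistedSum_decay hw hwc (2 * s)
  obtain ⟨Z, hZ0, hZ⟩ := exists_sum_prod_le (s := s)
  have : Nonempty (Fin s) := ⟨⟨0, hs⟩⟩
  set A : ℤ := ⌈2 * ρ / c⌉ + 1 with hA
  have hA0 : 0 ≤ A := by
    have : 0 ≤ ⌈2 * ρ / c⌉ := Int.ceil_nonneg (by positivity)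
    omega
  refine ⟨1 + (2 * A + 1) ^ s * Z * (K * (2 / c) ^ (2 * s)), ?_, fun P hP α => ?_⟩
  · have : (0 : ℝ) ≤ A := by exact_mod_cast hA0
    have : 0 ≤ (2 * (A : ℝ) + 1) ^ s * Z * (K * (2 / c) ^ (2 * s)) := by positivity
    linarith
  have hP0 : 0 < P := by linarith
  have hA0' : (0 : ℝ) ≤ A := by exact_mod_cast hA0
  set N := (weylSet (2 • M₁) (2 • M₂) c P α).ncard with hN
  set θ : (Fin s → ℤ) → Fin s → ℝ := fun h => pencilMap (2 • M₁) (2 • M₂) α (realVec h) with hθ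
  set n : (Fin s → ℤ) → Fin s → ℤ := fun h i => round (θ h i) with hn
  set T : (Fin s → ℤ) → ℂ := fun h => twistedSum P (θ h)
        (fun x => ((w (P⁻¹ • realVec h + x) * w x : ℝ) : ℂ)) with hT
  set k : (Fin s → ℤ) → Fin s → ℤ := fun h i => ⌊P * (θ h i - n h i) / c⌋ with hk
  set m : (Fin s → ℤ) → Fin s → ℤ := fun h i => ⌊(h i : ℝ) / (c * P)⌋ with hm
  set ψ : (Fin s → ℤ) → ℝ := fun k => ∏ i, ((1 + |(k i : ℝ)|) ^ 2)⁻¹ with hψ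
  have hψ0 : ∀ k, 0 ≤ ψ k := fun k => Finset.prod_nonneg fun i _ => by positivity
  set K' := K * (2 / c) ^ (2 * s) with hK'
  have hK'0 : 0 ≤ K' := by positivity
  have hTb : ∀ h, ‖T h‖ ≤ K' * P ^ s * ψ (k h) := fun h => by
    obtain ⟨i₀, hi₀⟩ := Finite.exists_max fun i => |θ h i - n h i|
    have h1 := hK P hP (P⁻¹ • realVec h) (θ h) i₀
    set U := 1 + P * |θ h i₀ - n h i₀| with hU
    have hU0 : 0 < U := by positivity
    have hki : ∀ i, (1 + |(k h i : ℝ)|) ≤ 2 / c * U := fun i => by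
      set r := P * (θ h i - n h i) / c
      have a1 : |(⌊r⌋ : ℝ)| ≤ |r| + 1 := by
        have b1 := Int.floor_le r
        have b2 := Int.lt_floor_add_one r
        have b3 := le_abs_self r
        have b4 := neg_abs_le r
        exact abs_le.mpr ⟨by linarith, by linarith⟩
      have a2 : |r| ≤ P * |θ h i₀ - n h i₀| / c := by
        simp only [r, abs_div, abs_mul, abs_of_pos hc, abs_of_pos hP0]
        exact div_le_div_of_nonneg_right (mul_le_mul_of_nonneg_left (hi₀ i) hP0.le) hc.le
      have a3 : 2 ≤ 2 / c := by rw [le_div_iff₀ hc]; linarith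
      have a4 : 0 ≤ P * |θ h i₀ - n h i₀| / c := by positivity
      have a5 : 2 / c * U = 2 / c + 2 * (P * |θ h i₀ - n h i₀| / c) := by rw [hU]; ring
      change 1 + |(⌊r⌋ : ℝ)| ≤ _
      rw [a5]; linarith
    have h2 : ∏ i, (1 + |(k h i : ℝ)|) ^ 2 ≤ (2 / c * U) ^ (2 * s) := by
      calc _ ≤ ∏ _i : Fin s, (2 / c * U) ^ 2 := by
            gcongr with i
            exact hki i
        _ = _ := by rw [Finset.prod_const, Finset.card_univ, Fintype.card_fin, pow_mul]
    have h3 : 0 < ∏ i, (1 + |(k h i : ℝ)|) ^ 2 := Finset.prod_pos fun i _ => by positivity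
    rw [hψ]
    simp only [Finset.prod_inv_distrib]
    rw [← div_eq_mul_inv, le_div_iff₀ h3]
    calc ‖T h‖ * ∏ i, (1 + |(k h i : ℝ)|) ^ 2 ≤ ‖T h‖ * (2 / c * U) ^ (2 * s) := by gcongr
      _ = (2 / c) ^ (2 * s) * (‖T h‖ * U ^ (2 * s)) := by rw [mul_pow]; ring
      _ ≤ (2 / c) ^ (2 * s) * (K * P ^ s) := by gcongr
      _ = _ := by rw [hK']; ring
  set H := (finite_int_ball (s := s) (2 * ρ * P)).toFinset with hH
  set κ : ℤ := ⌈P / c⌉ + 1 with hκ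
  set J := Fintype.piFinset (fun _ : Fin s => Finset.Icc (-A) A) ×ˢ
    Fintype.piFinset (fun _ : Fin s => Finset.Icc (-κ) κ) with hJ
  have hfl : ∀ (r R : ℝ), |r| ≤ R → ⌊r⌋ ∈ Finset.Icc (-(⌈R⌉ + 1)) (⌈R⌉ + 1) := fun r R h => by
    obtain ⟨h1, h2⟩ := abs_le.mp h
    have h3 := Int.le_ceil R
    refine Finset.mem_Icc.mpr ⟨Int.le_floor.mpr ?_, ?_⟩
    · push_cast; linarith
    · have : (⌊r⌋ : ℝ) ≤ (⌈R⌉ : ℝ) + 1 := by linarith [Int.floor_le r]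
      exact_mod_cast this
  have hmaps : ∀ h ∈ H, (m h, k h) ∈ J := fun h hh => by
    rw [hH, Set.Finite.mem_toFinset] at hh
    refine Finset.mem_product.mpr ⟨Fintype.mem_piFinset.mpr fun i => hfl _ _ ?_,
      Fintype.mem_piFinset.mpr fun i => hfl _ _ ?_⟩
    · have h1 : |(h i : ℝ)| ≤ 2 * ρ * P := (norm_le_pi_norm (realVec h) i).trans hh
      rw [abs_div, abs_of_pos (by positivity : 0 < c * P), div_le_div_iff₀ (by positivity) hc]
      nlinarith
    · rw [abs_div, abs_of_pos hc, abs_mul, abs_of_pos hP0]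
      have := abs_sub_round (θ h i)
      have h2 : |θ h i - n h i| ≤ 1 := by simp only [hn]; linarith
      gcongr
      nlinarith
  have hcell : ∀ p ∈ J, ∑ h ∈ H with (m h, k h) = p, ‖T h‖ ≤ N * (K' * P ^ s * ψ p.2) := by
    intro p hp
    have hcard : (H.filter fun h => (m h, k h) = p).card ≤ N :=
      card_cell_le _ _ hc hP0 α _ n p.1 p.2
        (fun h hh i => congrFun (congrArg Prod.fst (Finset.mem_filter.mp hh).2) i)
        (fun h hh i => congrFun (congrArg Prod.snd (Finset.mem_filter.mp hh).2) i)
    have hb : ∀ h ∈ H.filter fun h => (m h, k h) = p, ‖T h‖ ≤ K' * P ^ s * ψ p.2 := fun h hh => by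
      rw [← (Finset.mem_filter.mp hh).2]
      exact hTb h
    refine (Finset.sum_le_card_nsmul _ _ _ hb).trans ?_
    rw [nsmul_eq_mul]
    have := hψ0 p.2
    gcongr
  have hJsum : ∑ p ∈ J, ψ p.2 ≤ (2 * A + 1) ^ s * Z := by
    rw [hJ, Finset.sum_product]
    simp only [Finset.sum_const, nsmul_eq_mul, Fintype.card_piFinset_const, Int.card_Icc]
    have e1 : ((A + 1 - -A).toNat : ℝ) = 2 * A + 1 := by
      have : (((A + 1 - -A).toNat : ℤ) : ℝ) = ((A + 1 - -A : ℤ) : ℝ) := by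
        rw [Int.toNat_of_nonneg (by omega)]
      push_cast at this
      rw [this]; ring
    push_cast
    rw [e1]
    exact mul_le_mul_of_nonneg_left (hZ _) (by positivity)
  calc ‖expSum M₁ M₂ w P α‖ ^ 2 ≤ ∑ h ∈ H, ‖T h‖ := norm_sq_expSum_le hM₁ hM₂ hρ hP0 α
    _ = ∑ p ∈ J, ∑ h ∈ H with (m h, k h) = p, ‖T h‖ :=
        (Finset.sum_fiberwise_of_maps_to hmaps _).symm
    _ ≤ ∑ p ∈ J, N * (K' * P ^ s * ψ p.2) := Finset.sum_le_sum hcell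
    _ = (∑ p ∈ J, ψ p.2) * K' * P ^ s * N := by
        rw [Finset.sum_mul, Finset.sum_mul, Finset.sum_mul]
        exact Finset.sum_congr rfl fun p _ => by ring
    _ ≤ ((2 * A + 1) ^ s * Z) * K' * P ^ s * N := by gcongr
    _ ≤ (1 + (2 * A + 1) ^ s * Z * K') * P ^ s * N := by
        gcongr
        linarith

lemma pencilMap_sub_left (B₁ B₂ : Matrix (Fin s) (Fin s) ℤ) (α β : ℝ × ℝ) (h : Fin s → ℝ) :
    pencilMap B₁ B₂ (α - β) h = pencilMap B₁ B₂ α h - pencilMap B₁ B₂ β h := by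
  ext i
  simp only [pencilMap_apply, Pi.sub_apply, ← Finset.sum_sub_distrib, Prod.fst_sub, Prod.snd_sub]
  exact Finset.sum_congr rfl fun j _ => by ring

lemma exists_norm_pencilMap_le (B₁ B₂ : Matrix (Fin s) (Fin s) ℤ) : ∃ C : ℝ, 1 ≤ C ∧
    ∀ α h, ‖pencilMap B₁ B₂ α h‖ ≤ C * ‖α‖ * ‖h‖ := by
  have h0 : 0 ≤ ∑ i, ∑ j, (|(B₁ i j : ℝ)| + |(B₂ i j : ℝ)|) := by positivity
  refine ⟨1 + ∑ i, ∑ j, (|(B₁ i j : ℝ)| + |(B₂ i j : ℝ)|), by linarith, fun α h => ?_⟩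
  refine (pi_norm_le_iff_of_nonneg (by positivity)).mpr fun i => ?_
  rw [pencilMap_apply]
  have h1 : ∀ j, ‖(α.1 * B₁ i j + α.2 * B₂ i j) * h j‖ ≤
      (|(B₁ i j : ℝ)| + |(B₂ i j : ℝ)|) * (‖α‖ * ‖h‖) := fun j => by
    rw [norm_mul, ← mul_assoc]
    refine mul_le_mul ?_ (norm_le_pi_norm h j) (norm_nonneg _) (by positivity)
    refine (norm_add_le _ _).trans ?_
    rw [norm_mul, norm_mul, Real.norm_eq_abs (B₁ i j : ℝ), Real.norm_eq_abs (B₂ i j : ℝ), add_mul,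
      mul_comm ‖α.1‖, mul_comm ‖α.2‖]
    exact add_le_add (mul_le_mul_of_nonneg_left (norm_fst_le α) (abs_nonneg _))
      (mul_le_mul_of_nonneg_left (norm_snd_le α) (abs_nonneg _))
  calc _ ≤ ∑ j, (|(B₁ i j : ℝ)| + |(B₂ i j : ℝ)|) * (‖α‖ * ‖h‖) :=
        (norm_sum_le _ _).trans (Finset.sum_le_sum fun j _ => h1 j)
    _ = (∑ j, (|(B₁ i j : ℝ)| + |(B₂ i j : ℝ)|)) * (‖α‖ * ‖h‖) := by rw [Finset.sum_mul]
    _ ≤ (1 + ∑ i, ∑ j, (|(B₁ i j : ℝ)| + |(B₂ i j : ℝ)|)) * (‖α‖ * ‖h‖) := by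
        gcongr
        have := Finset.single_le_sum (f := fun i => ∑ j, (|(B₁ i j : ℝ)| + |(B₂ i j : ℝ)|))
          (fun i _ => Finset.sum_nonneg fun j _ => by positivity) (Finset.mem_univ i)
        linarith
    _ = _ := by ring

/-- Comparison of the counting function at different scales and nearby points. -/
lemma exists_ncard_weylSet_le (B₁ B₂ : Matrix (Fin s) (Fin s) ℤ) {c : ℝ} (hc : 0 < c) :
    ∃ κ : ℝ, 0 < κ ∧ κ ≤ 1 ∧ ∀ (P R : ℝ) (α β : ℝ × ℝ), 0 < R → 4 * R ≤ P →
      ‖α - β‖ ≤ κ / R ^ 2 → ((weylSet B₁ B₂ c P α).ncard : ℝ) ≤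
        (5 * (P / R)) ^ s * (weylSet B₁ B₂ c R β).ncard := by
  classical
  obtain ⟨C, hC1, hC⟩ := exists_norm_pencilMap_le B₁ B₂
  refine ⟨1 / (2 * C), by positivity, ?_, fun P R α β hR hPR hαβ => ?_⟩
  · rw [div_le_iff₀ (by positivity)]; linarith
  have hP0 : 0 < P := by linarith
  set H := (weylSet_finite B₁ B₂ c P α).toFinset with hH
  rw [Set.ncard_eq_toFinset_card _ (weylSet_finite B₁ B₂ c P α), ← hH]
  have hmem : ∀ h, h ∈ H ↔ h ∈ weylSet B₁ B₂ c P α := fun h => Set.Finite.mem_toFinset _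
  set m : (Fin s → ℤ) → Fin s → ℤ := fun h i => ⌊(h i : ℝ) / (c * R)⌋ with hm
  set A : ℤ := ⌊P / R⌋ + 1 with hA
  have hPR0 : 0 ≤ ⌊P / R⌋ := Int.floor_nonneg.mpr (by positivity)
  set J := Fintype.piFinset (fun _ : Fin s => Finset.Icc (-A) A) with hJ
  have hmaps : ∀ h ∈ H, m h ∈ J := fun h hh => Fintype.mem_piFinset.mpr fun i => by
    have h1 : |(h i : ℝ)| ≤ c * P := (norm_le_pi_norm (realVec h) i).trans ((hmem h).mp hh).1
    have h2 : |(h i : ℝ) / (c * R)| ≤ P / R := by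
      rw [abs_div, abs_of_pos (by positivity : 0 < c * R), div_le_div_iff₀ (by positivity) hR]
      nlinarith
    obtain ⟨h3, h4⟩ := abs_le.mp h2
    have h5 := Int.lt_floor_add_one (P / R)
    refine Finset.mem_Icc.mpr ⟨Int.le_floor.mpr ?_, ?_⟩
    · push_cast [hA]; linarith
    · exact (Int.floor_le_floor h4).trans (by omega)
  have hfib : ∀ p ∈ J, (H.filter fun h => m h = p).card ≤ (weylSet B₁ B₂ c R β).ncard := by
    intro p _
    rcases (H.filter fun h => m h = p).eq_empty_or_nonempty with he | ⟨h₀, hh₀⟩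
    · rw [he]; simp
    rw [Set.ncard_eq_toFinset_card _ (weylSet_finite B₁ B₂ c R β)]
    refine Finset.card_le_card_of_injOn (fun h => h - h₀) (fun h hh => ?_)
      (fun a _ b _ hab => sub_left_injective hab)
    rw [Finset.mem_coe, Set.Finite.mem_toFinset]
    obtain ⟨hhH, hhm⟩ := Finset.mem_filter.mp hh
    obtain ⟨h0H, h0m⟩ := Finset.mem_filter.mp hh₀
    obtain ⟨-, n, hn⟩ := (hmem h).mp hhH
    obtain ⟨-, n₀, hn₀⟩ := (hmem h₀).mp h0H
    have hsm : ‖realVec (h - h₀)‖ ≤ c * R :=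
      (pi_norm_le_iff_of_nonneg (by positivity)).mpr fun i => by
        have := Int.abs_sub_lt_one_of_floor_eq_floor
          ((congrFun hhm i).trans (congrFun h0m i).symm)
        rw [← sub_div, abs_div, abs_of_pos (by positivity : 0 < c * R),
          div_lt_one (by positivity)] at this
        rw [realVec_sub, Pi.sub_apply, Real.norm_eq_abs]
        exact this.le
    refine ⟨hsm, n - n₀, ?_⟩
    have e : pencilMap B₁ B₂ β (realVec (h - h₀)) - realVec (n - n₀) =
        (pencilMap B₁ B₂ α (realVec h) - realVec n) -
          (pencilMap B₁ B₂ α (realVec h₀) - realVec n₀) -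
          pencilMap B₁ B₂ (α - β) (realVec (h - h₀)) := by
      rw [pencilMap_sub_left]
      simp only [realVec_sub, map_sub]
      abel
    have h1 : ‖pencilMap B₁ B₂ (α - β) (realVec (h - h₀))‖ ≤ c / R / 2 := by
      calc _ ≤ C * ‖α - β‖ * ‖realVec (h - h₀)‖ := hC _ _
        _ ≤ C * (1 / (2 * C) / R ^ 2) * (c * R) := by gcongr
        _ = c / R / 2 := by field_simp
    have h2 : c / P ≤ c / R / 4 := by
      rw [div_div, div_le_div_iff₀ hP0 (by positivity)]
      nlinarith
    rw [e]
    refine (norm_sub_le _ _).trans ((add_le_add (norm_sub_le _ _) h1).trans ?_)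
    linarith
  have hcard := Finset.card_le_mul_card_image_of_maps_to hmaps _ hfib
  have hJc : (J.card : ℝ) ≤ (5 * (P / R)) ^ s := by
    rw [hJ, Fintype.card_piFinset_const, Int.card_Icc]
    push_cast
    have e1 : ((A + 1 - -A).toNat : ℝ) = 2 * A + 1 := by
      have : (((A + 1 - -A).toNat : ℤ) : ℝ) = ((A + 1 - -A : ℤ) : ℝ) := by
        rw [Int.toNat_of_nonneg (by omega)]
      push_cast at this
      rw [this]; ring
    rw [e1]
    have h1 := Int.floor_le (P / R)
    have h2 : 4 ≤ P / R := by rwa [le_div_iff₀ hR]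
    have h3 : (0 : ℝ) ≤ ⌊P / R⌋ := by exact_mod_cast hPR0
    gcongr
    push_cast [hA]
    linarith
  calc (H.card : ℝ) ≤ (((weylSet B₁ B₂ c R β).ncard * J.card : ℕ) : ℝ) := by exact_mod_cast hcard
    _ = J.card * (weylSet B₁ B₂ c R β).ncard := by push_cast; ring
    _ ≤ _ := by gcongr

/-- A mean value bound for functions controlled by the square root of the counting function. -/
lemma exists_lintegral_level_le (hs : 10 ≤ s) (B₁ B₂ : Matrix (Fin s) (Fin s) ℤ) {c C₀ C : ℝ}
    (hC₀ : 1 ≤ C₀) (hC : 1 ≤ C)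
    (hvol : ∀ P Z : ℝ, 1 ≤ Z → Z ≤ P →
      volume {α : ℝ × ℝ | ‖α‖ ≤ 2 ∧ C₀ * P * Z ^ (s - 1) ≤ (weylSet B₁ B₂ c P α).ncard} ≤
        ENNReal.ofReal (C * P ^ (1 / 50 : ℝ) / Z ^ 4)) :
    ∃ K : ℝ, 1 ≤ K ∧ ∀ P Z : ℝ, 1 ≤ Z → Z ≤ P → ∀ g : ℝ × ℝ → ENNReal, Measurable g →
      (∀ α, ‖α‖ ≤ 2 → g α ≤ ENNReal.ofReal √(weylSet B₁ B₂ c P α).ncard) →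
      (∀ α, ‖α‖ ≤ 2 → g α ≤ ENNReal.ofReal √(C₀ * P * Z ^ (s - 1))) →
      ∫⁻ α in {α | ‖α‖ ≤ 2}, g α ≤
        ENNReal.ofReal (K * P ^ (13 / 25 : ℝ) * Z ^ (((s : ℝ) - 1) / 2 - 4)) := by
  set e : ℝ := ((s : ℝ) - 1) / 2 with he
  have hs' : (10 : ℝ) ≤ s := by exact_mod_cast hs
  have he4 : 1 / 2 ≤ e - 4 := by rw [he]; linarith
  have hsqrt : ∀ P Z : ℝ, 0 < P → 0 < Z →
      √(C₀ * P * Z ^ (s - 1)) = √C₀ * P ^ (1 / 2 : ℝ) * Z ^ e := fun P Z hP hZ => by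
    rw [Real.sqrt_mul (by positivity), Real.sqrt_mul (by positivity), Real.sqrt_eq_rpow P]
    congr 1
    rw [Real.sqrt_eq_rpow, ← Real.rpow_natCast, ← Real.rpow_mul hZ.le, he,
      Nat.cast_sub (by omega)]
    congr 1; push_cast; ring
  have hC₀' : 0 ≤ √C₀ := Real.sqrt_nonneg _
  have hball : MeasurableSet {α : ℝ × ℝ | ‖α‖ ≤ 2} :=
    measurableSet_le measurable_norm measurable_const
  have hballvol : volume {α : ℝ × ℝ | ‖α‖ ≤ 2} = ENNReal.ofReal 16 := by
    have : {α : ℝ × ℝ | ‖α‖ ≤ 2} = Metric.closedBall (0 : ℝ) 2 ×ˢ Metric.closedBall (0 : ℝ) 2 := by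
      ext α
      simp [Prod.norm_def]
    rw [this, Measure.volume_eq_prod, Measure.prod_prod, Real.volume_closedBall,
      ← ENNReal.ofReal_mul (by norm_num)]
    norm_num
  set K : ℝ := 1 + 16 * (√C₀ * 2 ^ e) + 64 * C * √C₀ with hK
  have h2e : (0 : ℝ) ≤ 2 ^ e := by positivity
  refine ⟨K, by rw [hK]; nlinarith [mul_nonneg (zero_le_one.trans hC) hC₀', mul_nonneg hC₀' h2e],
    fun P Z hZ hZP g hg h₁ h₂ => ?_⟩
  have hP1 : 1 ≤ P := hZ.trans hZP
  have hP0 : 0 < P := by linarith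
  obtain ⟨n, hn⟩ : ∃ n : ℕ, Z < 2 ^ n := pow_unbounded_of_one_lt Z one_lt_two
  induction n generalizing Z g with
  | zero => exact absurd hn (by simpa using hZ)
  | succ n ih =>
    have hZ0 : 0 < Z := by linarith
    have hK0 : 0 ≤ K := by positivity
    by_cases hZ2 : Z < 2
    · calc ∫⁻ α in {α | ‖α‖ ≤ 2}, g α
          ≤ ∫⁻ α in {α : ℝ × ℝ | ‖α‖ ≤ 2}, ENNReal.ofReal √(C₀ * P * 2 ^ (s - 1)) := by
            refine setLIntegral_mono' hball fun α hα => (h₂ α hα).trans ?_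
            gcongr
        _ = ENNReal.ofReal (√(C₀ * P * 2 ^ (s - 1)) * 16) := by
            rw [setLIntegral_const, hballvol, ← ENNReal.ofReal_mul (Real.sqrt_nonneg _)]
        _ ≤ _ := by
            apply ENNReal.ofReal_le_ofReal
            rw [hsqrt P 2 hP0 two_pos]
            have h3 : P ^ (1 / 2 : ℝ) ≤ P ^ (13 / 25 : ℝ) :=
              Real.rpow_le_rpow_of_exponent_le hP1 (by norm_num)
            have h4 : 1 ≤ Z ^ (e - 4) := Real.one_le_rpow hZ (by linarith)
            calc √C₀ * P ^ (1 / 2 : ℝ) * 2 ^ e * 16 =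
                  16 * (√C₀ * 2 ^ e) * P ^ (1 / 2 : ℝ) := by ring
              _ ≤ K * P ^ (13 / 25 : ℝ) := by
                  refine mul_le_mul ?_ h3 (by positivity) hK0
                  rw [hK]
                  nlinarith [mul_nonneg (zero_le_one.trans hC) hC₀']
              _ ≤ _ := le_mul_of_one_le_right (by positivity) h4
    · push Not at hZ2
      set t := ENNReal.ofReal √(C₀ * P * (Z / 2) ^ (s - 1)) with ht
      have ih' := ih (Z / 2) (by linarith) (by linarith) (fun α => min (g α) t)
        (hg.min measurable_const) (fun α hα => (min_le_left _ _).trans (h₁ α hα))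
        (fun α _ => min_le_right _ _) (by rw [pow_succ] at hn; linarith)
      have hm : MeasurableSet {α | t < g α} := measurableSet_lt measurable_const hg
      have hsplit : ∀ α ∈ {α : ℝ × ℝ | ‖α‖ ≤ 2}, g α ≤ min (g α) t +
          ({α | t < g α}).indicator (fun _ => ENNReal.ofReal √(C₀ * P * Z ^ (s - 1))) α := by
        intro α hα
        by_cases h : t < g α
        · rw [Set.indicator_of_mem (by exact h)]
          exact (h₂ α hα).trans le_add_self
        · rw [Set.indicator_of_notMem (by exact h), add_zero, min_eq_left (not_lt.mp h)]
      have hlev : volume ({α | t < g α} ∩ {α : ℝ × ℝ | ‖α‖ ≤ 2}) ≤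
          ENNReal.ofReal (C * P ^ (1 / 50 : ℝ) / (Z / 2) ^ 4) := by
        refine (measure_mono fun α hα => ?_).trans (hvol P (Z / 2) (by linarith) (by linarith))
        refine ⟨hα.2, ?_⟩
        have h3 : t < ENNReal.ofReal √(weylSet B₁ B₂ c P α).ncard :=
          lt_of_lt_of_le hα.1 (h₁ α hα.2)
        have h4 := (ENNReal.ofReal_lt_ofReal_iff_of_nonneg (Real.sqrt_nonneg _)).mp h3
        exact ((Real.sqrt_lt_sqrt_iff (by positivity)).mp h4).le
      calc ∫⁻ α in {α | ‖α‖ ≤ 2}, g α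
          ≤ ∫⁻ α in {α | ‖α‖ ≤ 2}, (min (g α) t +
          ({α | t < g α}).indicator (fun _ => ENNReal.ofReal √(C₀ * P * Z ^ (s - 1))) α) :=
            setLIntegral_mono' hball hsplit
        _ = (∫⁻ α in {α | ‖α‖ ≤ 2}, min (g α) t) + ENNReal.ofReal √(C₀ * P * Z ^ (s - 1)) *
            volume ({α | t < g α} ∩ {α : ℝ × ℝ | ‖α‖ ≤ 2}) := by
            rw [lintegral_add_left (hg.min measurable_const), lintegral_indicator_const hm,
              Measure.restrict_apply hm]
        _ ≤ ENNReal.ofReal (K * P ^ (13 / 25 : ℝ) * (Z / 2) ^ (e - 4)) +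
            ENNReal.ofReal √(C₀ * P * Z ^ (s - 1)) *
              ENNReal.ofReal (C * P ^ (1 / 50 : ℝ) / (Z / 2) ^ 4) := by gcongr
        _ = ENNReal.ofReal (K * P ^ (13 / 25 : ℝ) * (Z / 2) ^ (e - 4) +
            √(C₀ * P * Z ^ (s - 1)) * (C * P ^ (1 / 50 : ℝ) / (Z / 2) ^ 4)) := by
            rw [← ENNReal.ofReal_mul (Real.sqrt_nonneg _), ← ENNReal.ofReal_add (by positivity)
              (by positivity)]
        _ ≤ _ := by
            apply ENNReal.ofReal_le_ofReal
            rw [hsqrt P Z hP0 hZ0]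
            have h3 : P ^ (13 / 25 : ℝ) = P ^ (1 / 2 : ℝ) * P ^ (1 / 50 : ℝ) := by
              rw [← Real.rpow_add hP0]; norm_num
            have h4 : Z ^ e = Z ^ (e - 4) * Z ^ 4 := by
              rw [← Real.rpow_natCast Z 4, ← Real.rpow_add hZ0]; norm_num
            have h5 : (Z / 2) ^ (e - 4) ≤ 3 / 4 * Z ^ (e - 4) := by
              rw [Real.div_rpow hZ0.le zero_le_two, div_le_iff₀ (by positivity)]
              have h6 : (2 : ℝ) ^ (1 / 2 : ℝ) ≤ 2 ^ (e - 4) :=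
                Real.rpow_le_rpow_of_exponent_le one_le_two he4
              have h7 : (4 / 3 : ℝ) ≤ 2 ^ (1 / 2 : ℝ) := by
                rw [← Real.sqrt_eq_rpow]
                exact Real.le_sqrt_of_sq_le (by norm_num)
              have h8 : 0 ≤ Z ^ (e - 4) := by positivity
              nlinarith
            have h6 : √C₀ * P ^ (1 / 2 : ℝ) * Z ^ e * (C * P ^ (1 / 50 : ℝ) / (Z / 2) ^ 4) =
                16 * C * √C₀ * (P ^ (13 / 25 : ℝ) * Z ^ (e - 4)) := by
              rw [h3, h4]; field_simp; ring
            rw [h6]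
            set Y := P ^ (13 / 25 : ℝ) with hY
            have hY0 : 0 ≤ Y := by positivity
            have hW0 : 0 ≤ Z ^ (e - 4) := by positivity
            calc _ ≤ K * Y * (3 / 4 * Z ^ (e - 4)) + 16 * C * √C₀ * (Y * Z ^ (e - 4)) := by gcongr
              _ = (3 / 4 * K + 16 * C * √C₀) * (Y * Z ^ (e - 4)) := by ring
              _ ≤ K * (Y * Z ^ (e - 4)) := by
                  gcongr
                  rw [hK]
                  nlinarith [mul_nonneg (zero_le_one.trans hC) hC₀', mul_nonneg hC₀' h2e]
              _ = _ := by ring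

end WeylSums

section LatticeSums

variable {s : ℕ}

/-- The sum of `H` over a translate of the integer lattice. -/
noncomputable def latticeSum (H : (Fin s → ℝ) → ℂ) (t : Fin s → ℝ) : ℂ :=
  ∑' k : Fin s → ℤ, H (t + realVec k)

lemma latticeSum_add_realVec (H : (Fin s → ℝ) → ℂ) (t : Fin s → ℝ) (m : Fin s → ℤ) :
    latticeSum H (t + realVec m) = latticeSum H t := by
  unfold latticeSum
  rw [← (Equiv.addLeft m).tsum_eq (fun k => H (t + realVec k))]
  refine tsum_congr fun k => ?_
  rw [Equiv.coe_addLeft, realVec_add, add_assoc]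

lemma exists_realVec_sub_mem (t : Fin s → ℝ) :
    ∃ m : Fin s → ℤ, ∀ i, (t - realVec m) i ∈ Set.Ico (0 : ℝ) 1 := by
  refine ⟨fun i => ⌊t i⌋, fun i => ?_⟩
  simp only [Pi.sub_apply, realVec_apply]
  exact ⟨sub_nonneg.mpr (Int.floor_le _), by linarith [Int.lt_floor_add_one (t i)]⟩

lemma eq_zero_of_tsupport_subset {H : (Fin s → ℝ) → ℂ} {R : ℝ}
    (hH : tsupport H ⊆ Metric.closedBall 0 R) {x : Fin s → ℝ} (hx : R < ‖x‖) : H x = 0 :=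
  image_eq_zero_of_notMem_tsupport fun h => by
    have := hH h
    rw [mem_closedBall_zero_iff] at this
    linarith

lemma norm_latticeSum_le {H : (Fin s → ℝ) → ℂ} {R M : ℝ} (hR : 0 ≤ R)
    (hH : tsupport H ⊆ Metric.closedBall 0 R) (hM : ∀ x, ‖H x‖ ≤ M) (t : Fin s → ℝ) :
    ‖latticeSum H t‖ ≤ (2 * (R + 1) + 1) ^ s * M := by
  obtain ⟨m, hm⟩ := exists_realVec_sub_mem t
  have e : t = (t - realVec m) + realVec m := by abel
  rw [e, latticeSum_add_realVec]
  refine norm_tsum_int_ball_le (by linarith) (fun x hx => eq_zero_of_tsupport_subset hH ?_)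
    fun x => hM _
  have h1 : ‖t - realVec m‖ ≤ 1 := (pi_norm_le_iff_of_nonneg zero_le_one).mpr fun i => by
    rw [Real.norm_eq_abs, abs_of_nonneg (hm i).1]
    exact (hm i).2.le
  have h2 := norm_sub_le (t - realVec m + realVec x) (t - realVec m)
  rw [add_sub_cancel_left] at h2
  linarith

lemma tsupport_derivAlong_subset (v : Fin s → ℝ) (H : (Fin s → ℝ) → ℂ) :
    tsupport (derivAlong v H) ⊆ tsupport H := tsupport_fderiv_apply_subset ℝ v

lemma hasDerivAt_latticeSum {H : (Fin s → ℝ) → ℂ} {R : ℝ} (hsm : ContDiff ℝ (⊤ : ℕ∞) H)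
    (hH : tsupport H ⊆ Metric.closedBall 0 R) (v t : Fin s → ℝ) (u : ℝ) :
    HasDerivAt (fun u : ℝ => latticeSum H (t + u • v))
      (latticeSum (derivAlong v H) (t + u • v)) u := by
  set B : ℝ := R + ‖t‖ + (|u| + 1) * ‖v‖ with hB
  have hfar : ∀ G : (Fin s → ℝ) → ℂ, tsupport G ⊆ Metric.closedBall 0 R → ∀ u' : ℝ,
      |u' - u| < 1 → latticeSum G (t + u' • v) =
        ∑ k ∈ (finite_int_ball (s := s) B).toFinset, G (t + realVec k + u' • v) := by
    intro G hG u' hu'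
    have := (hasSum_int_ball (R := B) (f := fun k => G (t + u' • v + realVec k))
      fun k hk => eq_zero_of_tsupport_subset hG ?_).tsum_eq
    · rw [latticeSum, this]
      exact Finset.sum_congr rfl fun k _ => by rw [add_right_comm]
    · have h1 : ‖u' • v‖ ≤ (|u| + 1) * ‖v‖ := by
        rw [norm_smul, Real.norm_eq_abs]
        have : |u'| ≤ |u| + 1 := by
          have := abs_sub_abs_le_abs_sub u' u
          linarith
        gcongr
      have h2 := norm_sub_le (t + u' • v + realVec k) (t + u' • v)
      rw [add_sub_cancel_left] at h2
      have h3 := norm_add_le t (u' • v)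
      linarith
  have hsum : HasDerivAt (fun u' : ℝ => ∑ k ∈ (finite_int_ball (s := s) B).toFinset,
      H (t + realVec k + u' • v))
      (∑ k ∈ (finite_int_ball (s := s) B).toFinset, derivAlong v H (t + realVec k + u • v)) u :=
    HasDerivAt.fun_sum fun k _ => hasDerivAt_derivAlong hsm v _ u
  rw [hfar _ ((tsupport_derivAlong_subset v H).trans hH) u (by simp)]
  refine hsum.congr_of_eventuallyEq ?_
  filter_upwards [Metric.ball_mem_nhds u one_pos] with u' hu'
  exact hfar H hH u' (by rwa [Metric.mem_ball, Real.dist_eq] at hu')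

lemma norm_latticeSum_derivAlong_le {H : (Fin s → ℝ) → ℂ} {R M : ℝ}
    (hsm : ContDiff ℝ (⊤ : ℕ∞) H) (hH : tsupport H ⊆ Metric.closedBall 0 R) (i : Fin s)
    (hM : ∀ t, ‖latticeSum (derivAlong (Pi.single i 1) (derivAlong (Pi.single i 1) H)) t‖ ≤ M)
    (t : Fin s → ℝ) : ‖latticeSum (derivAlong (Pi.single i 1) H) t‖ ≤ M := by
  set v : Fin s → ℝ := Pi.single i 1 with hv
  have hd := hasDerivAt_latticeSum hsm hH v t
  have hd2 := hasDerivAt_latticeSum (contDiff_derivAlong hsm v)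
    ((tsupport_derivAlong_subset v H).trans hH) v t
  have hper : latticeSum H (t + (1 : ℝ) • v) = latticeSum H (t + (0 : ℝ) • v) := by
    rw [zero_smul, add_zero, one_smul, hv, ← realVec_single, latticeSum_add_realVec]
  have hM0 : 0 ≤ M := (norm_nonneg _).trans (hM 0)
  have hb : ∀ u ∈ Set.Icc (0 : ℝ) 1, ‖latticeSum (derivAlong v H) (t + u • v) -
      latticeSum (derivAlong v H) t‖ ≤ M := fun u hu => by
    have := norm_image_sub_le_of_norm_deriv_le_segment' (a := 0) (b := 1)
      (fun u _ => (hd2 u).hasDerivWithinAt) (fun u _ => hM _) u hu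
    simp only [zero_smul, add_zero, sub_zero] at this
    exact this.trans (mul_le_of_le_one_right hM0 hu.2)
  have hF : ∀ u ∈ Set.Icc (0 : ℝ) 1, HasDerivWithinAt (fun u : ℝ => latticeSum H (t + u • v) -
      u • latticeSum (derivAlong v H) t) (latticeSum (derivAlong v H) (t + u • v) -
      (1 : ℝ) • latticeSum (derivAlong v H) t) (Set.Icc 0 1) u := fun u _ =>
    ((hd u).sub ((hasDerivAt_id u).smul_const _)).hasDerivWithinAt
  have := norm_image_sub_le_of_norm_deriv_le_segment_01' hF (C := M) fun u hu => by
    rw [one_smul]; exact hb u ⟨hu.1, hu.2.le⟩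
  rwa [hper, zero_smul ℝ (latticeSum (derivAlong v H) t), one_smul, sub_zero,
    sub_sub_cancel_left, norm_neg] at this

lemma norm_latticeSum_derivAlong_le_iter (i : Fin s) (L : ℕ) {R M : ℝ} :
    ∀ {H : (Fin s → ℝ) → ℂ}, ContDiff ℝ (⊤ : ℕ∞) H → tsupport H ⊆ Metric.closedBall 0 R →
    (∀ t, ‖latticeSum ((derivAlong (Pi.single i 1))^[L + 1] H) t‖ ≤ M) →
    ∀ t, ‖latticeSum (derivAlong (Pi.single i 1) H) t‖ ≤ M := by
  induction L with
  | zero => intro H _ _ h; exact h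
  | succ L ih =>
    intro H hsm hH h
    refine norm_latticeSum_derivAlong_le hsm hH i (ih (contDiff_derivAlong hsm _)
      ((tsupport_derivAlong_subset _ _).trans hH) ?_)
    simpa only [Function.iterate_succ_apply] using h

lemma norm_latticeSum_sub_le {H : (Fin s → ℝ) → ℂ} {R M : ℝ} (hsm : ContDiff ℝ (⊤ : ℕ∞) H)
    (hH : tsupport H ⊆ Metric.closedBall 0 R)
    (hM : ∀ i t, ‖latticeSum (derivAlong (Pi.single i 1) H) t‖ ≤ M) (t : Fin s → ℝ)
    {v : Fin s → ℝ} (hv : ∀ i, v i ∈ Set.Ico (0 : ℝ) 1) :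
    ‖latticeSum H (t + v) - latticeSum H t‖ ≤ s * M := by
  have key : ∀ S : Finset (Fin s),
      ‖latticeSum H (t + ∑ i ∈ S, v i • Pi.single i 1) - latticeSum H t‖ ≤ S.card * M := by
    intro S
    induction S using Finset.induction_on with
    | empty => simp
    | insert i S hi ih =>
      have hM0 : 0 ≤ M := (norm_nonneg _).trans (hM i 0)
      have h1 := norm_image_sub_le_of_norm_deriv_le_segment' (a := 0) (b := v i)
        (fun u _ => (hasDerivAt_latticeSum hsm hH (Pi.single i 1)
          (t + ∑ i ∈ S, v i • Pi.single i 1) u).hasDerivWithinAt) (fun u _ => hM i _) (v i)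
          ⟨(hv i).1, le_rfl⟩
      simp only [zero_smul, add_zero, sub_zero] at h1
      rw [Finset.sum_insert hi, add_comm (v i • _), ← add_assoc, Finset.card_insert_of_notMem hi]
      push_cast
      have h2 := norm_sub_le_norm_sub_add_norm_sub
        (latticeSum H (t + ∑ i ∈ S, v i • Pi.single i 1 + v i • Pi.single i 1))
        (latticeSum H (t + ∑ i ∈ S, v i • Pi.single i 1)) (latticeSum H t)
      have h3 : M * v i ≤ M := mul_le_of_le_one_right hM0 (hv i).2.le
      linarith
  have hsum : ∑ i, v i • (Pi.single i 1 : Fin s → ℝ) = v := by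
    ext j
    simp [Finset.sum_apply, Pi.single_apply]
  have := key Finset.univ
  rwa [hsum, Finset.card_univ, Fintype.card_fin] at this

lemma norm_latticeSum_sub_integral_le {H : (Fin s → ℝ) → ℂ} {R M : ℝ}
    (hsm : ContDiff ℝ (⊤ : ℕ∞) H) (hH : tsupport H ⊆ Metric.closedBall 0 R)
    (hM : ∀ t v : Fin s → ℝ, (∀ i, v i ∈ Set.Ico (0 : ℝ) 1) →
      ‖latticeSum H (t + v) - latticeSum H t‖ ≤ M) (t : Fin s → ℝ) :
    ‖latticeSum H t - ∫ x, H x‖ ≤ M := by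
  set U : Set (Fin s → ℝ) := Set.univ.pi fun _ => Set.Ico 0 1 with hU
  have hUm : MeasurableSet U := MeasurableSet.univ_pi fun _ => measurableSet_Ico
  have hUv : volume U = 1 := by
    rw [hU, Real.volume_pi_Ico]; simp
  have hc : HasCompactSupport H :=
    HasCompactSupport.of_support_subset_isCompact (isCompact_closedBall 0 R)
      ((subset_tsupport _).trans hH)
  have hInt : Integrable H := hsm.continuous.integrable_of_hasCompactSupport hc
  set B : ℝ := R + ‖t‖ + 1 with hB
  set K := (finite_int_ball (s := s) B).toFinset with hK
  have hUnorm : ∀ v ∈ U, ‖v‖ ≤ 1 := fun v hv =>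
    (pi_norm_le_iff_of_nonneg zero_le_one).mpr fun i => by
      have := hv i (Set.mem_univ i)
      rw [Real.norm_eq_abs, abs_of_nonneg this.1]
      exact this.2.le
  have hfar : ∀ v ∈ U, ∀ k, B < ‖realVec k‖ → H (t + v + realVec k) = 0 := by
    intro v hv k hk
    refine eq_zero_of_tsupport_subset hH ?_
    have h2 := norm_sub_le (t + v + realVec k) (t + v)
    rw [add_sub_cancel_left] at h2
    have h3 := norm_add_le t v
    have := hUnorm v hv
    linarith
  have hLam : ∀ v ∈ U, latticeSum H (t + v) = ∑ k ∈ K, H (t + v + realVec k) := fun v hv =>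
    (hasSum_int_ball (hfar v hv)).tsum_eq
  set box : (Fin s → ℤ) → Set (Fin s → ℝ) := fun k => (fun x => x - (t + realVec k)) ⁻¹' U
    with hbox
  have hboxm : ∀ k, MeasurableSet (box k) := fun k => hUm.preimage (measurable_sub_const _)
  have hdisj : Pairwise (Function.onFun Disjoint box) := by
    intro k l hkl
    refine Set.disjoint_left.mpr fun x hx hy => hkl ?_
    ext i
    have h1 := hx i (Set.mem_univ i)
    have h2 := hy i (Set.mem_univ i)
    simp only [Pi.sub_apply, Pi.add_apply, realVec_apply, Set.mem_Ico] at h1 h2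
    have h3 : ((k i : ℤ) : ℝ) < l i + 1 := by linarith
    have h4 : ((l i : ℤ) : ℝ) < k i + 1 := by linarith
    have h3' : k i < l i + 1 := by exact_mod_cast h3
    have h4' : l i < k i + 1 := by exact_mod_cast h4
    omega
  have hcov : ∀ x, x ∉ ⋃ k ∈ K, box k → H x = 0 := by
    intro x hx
    obtain ⟨m, hm⟩ := exists_realVec_sub_mem (x - t)
    have hmU : x - t - realVec m ∈ U := fun i _ => hm i
    have hmb : x ∈ box m := by
      rw [hbox, Set.mem_preimage, ← sub_sub]; exact hmU
    have hmK : B < ‖realVec m‖ := by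
      by_contra hcon
      exact hx (Set.mem_biUnion (by rw [Finset.mem_coe, hK, Set.Finite.mem_toFinset]
                                    exact not_lt.mp hcon) hmb)
    have := hfar _ hmU m hmK
    rwa [show t + (x - t - realVec m) + realVec m = x by abel] at this
  have hI : ∫ x, H x = ∫ v in U, latticeSum H (t + v) := by
    rw [← setIntegral_eq_integral_of_forall_compl_eq_zero hcov,
      integral_biUnion_finset _ (fun k _ => hboxm k) (fun k _ l _ h => hdisj h)
        (fun k _ => hInt.integrableOn), setIntegral_congr_fun hUm hLam, integral_finsetSum]
    · refine Finset.sum_congr rfl fun k _ => ?_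
      have := (measurePreserving_sub_right (volume : Measure (Fin s → ℝ))
        (t + realVec k)).setIntegral_preimage_emb (MeasurableEquiv.subRight _).measurableEmbedding
        (fun v => H (t + v + realVec k)) U
      rw [← this]
      refine setIntegral_congr_fun (hboxm k) fun x _ => ?_
      change H x = H (t + (x - (t + realVec k)) + realVec k)
      congr 1; abel
    · intro k _
      have : (fun v => H (t + v + realVec k)) = fun v => H (v + (t + realVec k)) := by
        ext v; congr 1; abel
      rw [this]
      exact (hInt.comp_add_right _).integrableOn
  have hint2 : IntegrableOn (fun v => latticeSum H (t + v)) U := by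
    refine IntegrableOn.congr_fun (f := fun v => ∑ k ∈ K, H (t + v + realVec k)) ?_
      (fun v hv => (hLam v hv).symm) hUm
    refine integrable_finsetSum _ fun k _ => ?_
    have : (fun v => H (t + v + realVec k)) = fun v => H (v + (t + realVec k)) := by
      ext v; congr 1; abel
    rw [this]
    exact (hInt.comp_add_right _).integrableOn
  have hconst : ∫ v in U, latticeSum H t = latticeSum H t := by
    rw [setIntegral_const, measureReal_def, hUv]; simp
  rw [hI, norm_sub_rev, ← hconst, ← integral_sub hint2 (by
    rw [integrable_const_iff]; right
    exact ⟨by rw [Measure.restrict_apply_univ, hUv]; exact ENNReal.one_lt_top⟩)]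
  have := norm_setIntegral_le_of_norm_le_const (μ := volume) (s := U) (C := M)
    (f := fun v => latticeSum H (t + v) - latticeSum H t) (by rw [hUv]; exact ENNReal.one_lt_top)
    fun v hv => hM t v fun i => hv i (Set.mem_univ i)
  rwa [measureReal_def, hUv, ENNReal.toReal_one, mul_one] at this

/-- Lattice sums of a smooth compactly supported function approximate its integral, with an error
controlled by the derivatives of order `L + 1`. -/
lemma norm_latticeSum_sub_integral_le_of_deriv {H : (Fin s → ℝ) → ℂ} {R M : ℝ} (hR : 0 ≤ R)
    (hsm : ContDiff ℝ (⊤ : ℕ∞) H) (hH : tsupport H ⊆ Metric.closedBall 0 R) (L : ℕ)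
    (hM : ∀ i x, ‖(derivAlong (Pi.single i 1))^[L + 1] H x‖ ≤ M) (t : Fin s → ℝ) :
    ‖latticeSum H t - ∫ x, H x‖ ≤ s * ((2 * (R + 1) + 1) ^ s * M) := by
  refine norm_latticeSum_sub_integral_le hsm hH (fun t v hv => norm_latticeSum_sub_le hsm hH
    (fun i => norm_latticeSum_derivAlong_le_iter i L hsm hH fun t =>
      norm_latticeSum_le hR ?_ (hM i) t) t hv) t
  have : ∀ n, tsupport ((derivAlong (Pi.single i 1))^[n] H) ⊆ Metric.closedBall 0 R := by
    intro n
    induction n with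
    | zero => exact hH
    | succ n ih =>
      rw [Function.iterate_succ_apply']
      exact (tsupport_derivAlong_subset _ _).trans ih
  exact this _

end LatticeSums

section Derivatives

variable {E : Type*} [NormedAddCommGroup E] [NormedSpace ℝ E]

lemma contDiff_derivAlong_iter {f : E → ℂ} (hf : ContDiff ℝ (⊤ : ℕ∞) f) (v : E) (n : ℕ) :
    ContDiff ℝ (⊤ : ℕ∞) ((derivAlong v)^[n] f) := by
  induction n with
  | zero => exact hf
  | succ n ih => rw [Function.iterate_succ_apply']; exact contDiff_derivAlong ih v

lemma derivAlong_iter_add {f g : E → ℂ} (hf : ContDiff ℝ (⊤ : ℕ∞) f)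
    (hg : ContDiff ℝ (⊤ : ℕ∞) g) (v : E) (n : ℕ) :
    (derivAlong v)^[n] (fun x => f x + g x) =
      fun x => (derivAlong v)^[n] f x + (derivAlong v)^[n] g x := by
  induction n with
  | zero => rfl
  | succ n ih =>
    rw [Function.iterate_succ_apply', ih]
    ext x
    simp only [Function.iterate_succ_apply', derivAlong]
    rw [fderiv_fun_add ((contDiff_derivAlong_iter hf v n).differentiable (by simp) x)
      ((contDiff_derivAlong_iter hg v n).differentiable (by simp) x)]
    rfl

lemma derivAlong_iter_const_mul (f : E → ℂ) (c : ℝ) (v : E) (n : ℕ) :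
    (derivAlong v)^[n] (fun x => (c : ℂ) * f x) = fun x => (c : ℂ) * (derivAlong v)^[n] f x := by
  induction n with
  | zero => rfl
  | succ n ih =>
    rw [Function.iterate_succ_apply', ih]
    ext x
    have e : (fun x => (c : ℂ) * (derivAlong v)^[n] f x) = c • (derivAlong v)^[n] f := by
      ext; simp
    rw [Function.iterate_succ_apply', e]
    simp only [derivAlong]
    rw [fderiv_const_smul_field]
    simp

lemma derivAlong_iter_comp_smul (f : E → ℂ) (c : ℝ) (v : E) (n : ℕ) :
    (derivAlong v)^[n] (fun x => f (c • x)) =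
      fun x => (c : ℂ) ^ n * (derivAlong v)^[n] f (c • x) := by
  induction n generalizing f with
  | zero => simp
  | succ n ih =>
    have e : derivAlong v (fun x => f (c • x)) = fun x => (c : ℂ) * derivAlong v f (c • x) := by
      ext x
      simp only [derivAlong, fderiv_comp_smul]
      simp
    rw [Function.iterate_succ_apply, e, ih fun y => (c : ℂ) * derivAlong v f y]
    ext x
    rw [Function.iterate_succ_apply, derivAlong_iter_const_mul, pow_succ, mul_assoc]

end Derivatives

section OscillatoryIntegral

variable {s : ℕ}

/-- The integrand of the singular integral. -/
noncomputable def oscFun (M₁ M₂ : Matrix (Fin s) (Fin s) ℤ) (φ : (Fin s → ℝ) → ℂ) (β : ℝ × ℝ) :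
    (Fin s → ℝ) → ℂ := fun x => φ x * e2pi (phase M₁ M₂ β x)

lemma contDiff_quadEval (M : Matrix (Fin s) (Fin s) ℤ) {n : WithTop ℕ∞} :
    ContDiff ℝ n (fun x : Fin s → ℝ => quadEval M x) := by
  unfold quadEval
  fun_prop

lemma contDiff_phase (M₁ M₂ : Matrix (Fin s) (Fin s) ℤ) (β : ℝ × ℝ) {n : WithTop ℕ∞} :
    ContDiff ℝ n (phase M₁ M₂ β) :=
  (contDiff_const.mul (contDiff_quadEval M₁)).add (contDiff_const.mul (contDiff_quadEval M₂))

lemma contDiff_oscFun (M₁ M₂ : Matrix (Fin s) (Fin s) ℤ) {φ : (Fin s → ℝ) → ℂ}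
    (hφ : ContDiff ℝ (⊤ : ℕ∞) φ) (β : ℝ × ℝ) : ContDiff ℝ (⊤ : ℕ∞) (oscFun M₁ M₂ φ β) :=
  hφ.mul (contDiff_e2pi.comp (contDiff_phase M₁ M₂ β))

lemma derivAlong_oscFun (M₁ M₂ : Matrix (Fin s) (Fin s) ℤ) {φ : (Fin s → ℝ) → ℂ}
    (hφ : ContDiff ℝ (⊤ : ℕ∞) φ) (β : ℝ × ℝ) (v : Fin s → ℝ) :
    derivAlong v (oscFun M₁ M₂ φ β) = fun x => oscFun M₁ M₂ (derivAlong v φ) β x +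
      ((β.1 : ℂ) * oscFun M₁ M₂ (fun x => (2 * π * Complex.I) *
        (fderiv ℝ (fun x : Fin s → ℝ => quadEval M₁ x) x v : ℂ) * φ x) β x +
      (β.2 : ℂ) * oscFun M₁ M₂ (fun x => (2 * π * Complex.I) *
        (fderiv ℝ (fun x : Fin s → ℝ => quadEval M₂ x) x v : ℂ) * φ x) β x) := by
  ext x
  have h1 : HasFDerivAt φ (fderiv ℝ φ x) x := (hφ.differentiable (by simp) x).hasFDerivAt
  have hQ : ∀ M : Matrix (Fin s) (Fin s) ℤ, HasFDerivAt (fun x : Fin s → ℝ => quadEval M x)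
      (fderiv ℝ (fun x : Fin s → ℝ => quadEval M x) x) x := fun M =>
    ((contDiff_quadEval M (n := 1)).differentiable (by simp) x).hasFDerivAt
  have h2 : HasFDerivAt (phase M₁ M₂ β) _ x :=
    ((hQ M₁).const_mul β.1).add ((hQ M₂).const_mul β.2)
  have h3 := (hasDerivAt_e2pi (phase M₁ M₂ β x)).hasFDerivAt.comp x h2
  have h4 := (h1.mul h3).fderiv
  have h5 : fderiv ℝ (oscFun M₁ M₂ φ β) x = _ := h4
  simp only [derivAlong, h5, oscFun]
  simp
  ring

lemma exists_oscFun_deriv_bound (M₁ M₂ : Matrix (Fin s) (Fin s) ℤ) (v : Fin s → ℝ) (n : ℕ) :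
    ∀ {φ : (Fin s → ℝ) → ℂ}, ContDiff ℝ (⊤ : ℕ∞) φ → HasCompactSupport φ →
    ∃ C : ℝ, 0 ≤ C ∧ ∀ β x, ‖(derivAlong v)^[n] (oscFun M₁ M₂ φ β) x‖ ≤ C * (1 + ‖β‖) ^ n := by
  induction n with
  | zero =>
    intro φ hφ hc
    obtain ⟨C, hC⟩ := hφ.continuous.bounded_above_of_compact_support hc
    refine ⟨C, (norm_nonneg _).trans (hC 0), fun β x => ?_⟩
    simp only [Function.iterate_zero, id, oscFun, norm_mul, norm_e2pi, mul_one, pow_zero]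
    exact hC x
  | succ n ih =>
    intro φ hφ hc
    have hQd : ∀ M : Matrix (Fin s) (Fin s) ℤ, ContDiff ℝ (⊤ : ℕ∞) (fun x => (2 * π * Complex.I) *
        (fderiv ℝ (fun x : Fin s → ℝ => quadEval M x) x v : ℂ) * φ x) := fun M => by
      have h : ContDiff ℝ (⊤ : ℕ∞) (fun x => fderiv ℝ (fun x : Fin s → ℝ => quadEval M x) x v) :=
        ((contDiff_quadEval M).fderiv_right (m := (⊤ : ℕ∞)) (n := (⊤ : ℕ∞)) (by simp)).clm_apply
          contDiff_const
      exact (contDiff_const.mul (Complex.ofRealCLM.contDiff.comp h)).mul hφ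
    obtain ⟨C₀, hC₀, h₀⟩ := ih (contDiff_derivAlong hφ v) (hc.derivAlong v)
    obtain ⟨C₁, hC₁, h₁⟩ := ih (hQd M₁) hc.mul_left
    obtain ⟨C₂, hC₂, h₂⟩ := ih (hQd M₂) hc.mul_left
    refine ⟨C₀ + C₁ + C₂, by positivity, fun β x => ?_⟩
    rw [Function.iterate_succ_apply, derivAlong_oscFun M₁ M₂ hφ]
    have s0 := contDiff_oscFun M₁ M₂ (contDiff_derivAlong hφ v) β
    have s1 := contDiff_oscFun M₁ M₂ (hQd M₁) β
    have s2 := contDiff_oscFun M₁ M₂ (hQd M₂) β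
    rw [derivAlong_iter_add s0 ((contDiff_const.mul s1).add (contDiff_const.mul s2)),
      derivAlong_iter_add (contDiff_const.mul s1) (contDiff_const.mul s2),
      derivAlong_iter_const_mul, derivAlong_iter_const_mul]
    have hβ1 : |β.1| ≤ 1 + ‖β‖ := (norm_fst_le β).trans (by linarith)
    have hβ2 : |β.2| ≤ 1 + ‖β‖ := (norm_snd_le β).trans (by linarith)
    have hY : 1 ≤ 1 + ‖β‖ := by linarith [norm_nonneg β]
    set Y := 1 + ‖β‖
    have b0 : C₀ * Y ^ n ≤ Y * (C₀ * Y ^ n) := le_mul_of_one_le_left (by positivity) hY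
    refine (norm_add_le _ _).trans ((add_le_add (h₀ β x) (norm_add_le _ _)).trans ?_)
    rw [norm_mul, norm_mul, Complex.norm_real, Complex.norm_real]
    have b1 := mul_le_mul hβ1 (h₁ β x) (norm_nonneg _) (by positivity)
    have b2 := mul_le_mul hβ2 (h₂ β x) (norm_nonneg _) (by positivity)
    simp only [Real.norm_eq_abs]
    rw [pow_succ]
    linarith

/-- The oscillatory integral attached to the pencil. -/
noncomputable def singInt (M₁ M₂ : Matrix (Fin s) (Fin s) ℤ) (w : (Fin s → ℝ) → ℝ)
    (β : ℝ × ℝ) : ℂ :=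
  ∫ x : Fin s → ℝ, (w x : ℂ) * e2pi (phase M₁ M₂ β x)

lemma exists_latticeSum_oscFun_approx (M₁ M₂ : Matrix (Fin s) (Fin s) ℤ) {w : (Fin s → ℝ) → ℝ}
    (hw : ContDiff ℝ (⊤ : ℕ∞) w) (hwc : HasCompactSupport w) (L : ℕ) :
    ∃ C : ℝ, 0 ≤ C ∧ ∀ (β : ℝ × ℝ) (δ : ℝ), 0 < δ → δ ≤ 1 → ∀ t : Fin s → ℝ,
      ‖latticeSum (fun y => oscFun M₁ M₂ (fun x => (w x : ℂ)) β (δ • y)) t -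
        ((δ ^ s)⁻¹ : ℝ) * singInt M₁ M₂ w β‖ ≤ C * (δ ^ s)⁻¹ * (δ * (1 + ‖β‖)) ^ (L + 1) := by
  have hφ : ContDiff ℝ (⊤ : ℕ∞) (fun x => (w x : ℂ)) := Complex.ofRealCLM.contDiff.comp hw
  have hφc : HasCompactSupport (fun x => (w x : ℂ)) := hwc.comp_left Complex.ofReal_zero
  choose C hC hCb using fun i : Fin s =>
    exists_oscFun_deriv_bound M₁ M₂ (Pi.single i 1) (L + 1) hφ hφc
  obtain ⟨r, hr⟩ := hφc.isCompact.isBounded.exists_norm_le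
  set ρ := max r 1
  have hρ : 1 ≤ ρ := le_max_right _ _
  set C' := ∑ i, C i with hC'
  have hCi : ∀ i, C i ≤ C' := fun i => Finset.single_le_sum (fun i _ => hC i) (Finset.mem_univ i)
  have hC'0 : 0 ≤ C' := Finset.sum_nonneg fun i _ => hC i
  refine ⟨s * ((2 * ρ + 3) ^ s * C'), by positivity, fun β δ hδ hδ1 t => ?_⟩
  set f := oscFun M₁ M₂ (fun x => (w x : ℂ)) β with hf
  have hfs : ContDiff ℝ (⊤ : ℕ∞) f := contDiff_oscFun M₁ M₂ hφ β
  have hsm : ContDiff ℝ (⊤ : ℕ∞) (fun y : Fin s → ℝ => f (δ • y)) :=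
    hfs.comp (contDiff_const_smul δ)
  have hsupp : tsupport (fun y : Fin s → ℝ => f (δ • y)) ⊆ Metric.closedBall 0 (ρ / δ) := by
    refine closure_minimal (fun y hy => ?_) Metric.isClosed_closedBall
    have h1 : δ • y ∈ tsupport (fun x => (w x : ℂ)) := by
      refine subset_tsupport _ fun h => hy ?_
      simp only [hf, oscFun, h, zero_mul]
    have h2 := (hr _ h1).trans (le_max_left r 1)
    rw [norm_smul, Real.norm_eq_abs, abs_of_pos hδ] at h2
    rw [mem_closedBall_zero_iff, le_div_iff₀ hδ]
    linarith
  have hbd : ∀ i x, ‖(derivAlong (Pi.single i 1))^[L + 1] (fun y : Fin s → ℝ => f (δ • y)) x‖ ≤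
      C' * (δ * (1 + ‖β‖)) ^ (L + 1) := fun i x => by
    rw [derivAlong_iter_comp_smul, norm_mul, norm_pow, Complex.norm_real, Real.norm_eq_abs,
      abs_of_pos hδ, mul_pow]
    calc δ ^ (L + 1) * ‖(derivAlong (Pi.single i 1))^[L + 1] f (δ • x)‖
        ≤ δ ^ (L + 1) * (C' * (1 + ‖β‖) ^ (L + 1)) := by
          refine mul_le_mul_of_nonneg_left ((hCb i β _).trans ?_) (by positivity)
          exact mul_le_mul_of_nonneg_right (hCi i) (by positivity)
      _ = _ := by ring
  have key := norm_latticeSum_sub_integral_le_of_deriv (by positivity) hsm hsupp L hbd t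
  have hI : ∫ y : Fin s → ℝ, f (δ • y) = ((δ ^ s)⁻¹ : ℝ) * singInt M₁ M₂ w β := by
    rw [Measure.integral_comp_smul, Module.finrank_fintype_fun_eq_card, Fintype.card_fin,
      abs_of_pos (by positivity), Complex.real_smul]
    rfl
  rw [hI] at key
  refine key.trans ?_
  have h3 : (2 * (ρ / δ + 1) + 1) ^ s ≤ (2 * ρ + 3) ^ s * (δ ^ s)⁻¹ := by
    rw [← inv_pow, ← mul_pow]
    refine pow_le_pow_left₀ (by positivity) ?_ _
    rw [← div_eq_mul_inv, le_div_iff₀ hδ]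
    have : ρ / δ * δ = ρ := div_mul_cancel₀ _ hδ.ne'
    nlinarith
  calc (s : ℝ) * ((2 * (ρ / δ + 1) + 1) ^ s * (C' * (δ * (1 + ‖β‖)) ^ (L + 1)))
      ≤ s * (((2 * ρ + 3) ^ s * (δ ^ s)⁻¹) * (C' * (δ * (1 + ‖β‖)) ^ (L + 1))) := by gcongr
    _ = _ := by ring

/-- The complete exponential sum modulo `q`. -/
noncomputable def gaussSum2 (M₁ M₂ : Matrix (Fin s) (Fin s) ℤ) (q : ℕ) (a : ℕ × ℕ) : ℂ :=
  ∑ b ∈ Fintype.piFinset (fun _ : Fin s => Finset.range q),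
    eqc q ((a.1 : ℤ) * quadEval M₁ (fun i => (b i : ℤ)) +
      (a.2 : ℤ) * quadEval M₂ (fun i => (b i : ℤ)))

lemma Dq_zero_eq (M₁ M₂ : Matrix (Fin s) (Fin s) ℤ) (q : ℕ) :
    Dq s M₁ M₂ q 0 = ∑ a ∈ residues q, gaussSum2 M₁ M₂ q a := by
  simp [Dq, gaussSum2]

/-- Splitting a finitely supported sum over integer vectors into residue classes. -/
lemma tsum_eq_sum_residue_classes {q : ℕ} (hq : 1 ≤ q) {f : (Fin s → ℤ) → ℂ} {R : ℝ}
    (hf : ∀ x, R < ‖realVec x‖ → f x = 0) :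
    ∑' x, f x = ∑ b ∈ Fintype.piFinset (fun _ : Fin s => Finset.range q),
      ∑' k : Fin s → ℤ, f (fun i => k i * q + b i) := by
  have : NeZero q := ⟨by omega⟩
  have hs : Summable f := (hasSum_int_ball hf).summable
  set e : (Fin s → Fin q) × (Fin s → ℤ) ≃ (Fin s → ℤ) :=
    ((Equiv.piCongrRight fun _ : Fin s => Int.divModEquiv q).trans
      ((Equiv.arrowProdEquivProdArrow (Fin s) (fun _ => ℤ) (fun _ => Fin q)).trans
        (Equiv.prodComm _ _))).symm with he
  have hap : ∀ p, e p = fun i => p.2 i * (q : ℤ) + (p.1 i : ℤ) := fun p => rfl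
  have hprod := ((e.summable_iff).mpr hs).tsum_prod
  simp only [Function.comp_def] at hprod
  rw [← e.tsum_eq, hprod, tsum_fintype]
  simp only [hap]
  refine Finset.sum_bij (fun b _ i => (b i : ℕ)) ?_ ?_ ?_ ?_
  · intro b _
    exact Fintype.mem_piFinset.mpr fun i => Finset.mem_range.mpr (b i).2
  · intro b _ c _ h
    ext i
    exact congrFun h i
  · intro b hb
    exact ⟨fun i => ⟨b i, Finset.mem_range.mp (Fintype.mem_piFinset.mp hb i)⟩,
      Finset.mem_univ _, rfl⟩
  · intro b _; rfl

lemma quadEval_intCast {R : Type*} [CommRing R] (M : Matrix (Fin s) (Fin s) ℤ) (x : Fin s → ℤ) :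
    quadEval M (fun i => (x i : R)) = ((quadEval M x : ℤ) : R) := by
  simp [quadEval]

lemma exists_quadEval_mod (M : Matrix (Fin s) (Fin s) ℤ) (q : ℕ) (k b : Fin s → ℤ) :
    ∃ n : ℤ, quadEval M (fun i => k i * q + b i) = quadEval M b + q * n := by
  refine ⟨∑ i, ∑ j, M i j * (k i * (k j * q + b j) + b i * k j), ?_⟩
  simp only [quadEval, Finset.mul_sum, ← Finset.sum_add_distrib]
  refine Finset.sum_congr rfl fun i _ => Finset.sum_congr rfl fun j _ => ?_
  simp only [Int.cast_id]
  ring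

lemma e2pi_phase_rational (M₁ M₂ : Matrix (Fin s) (Fin s) ℤ) {q : ℕ} (hq : 1 ≤ q) (a : ℕ × ℕ)
    (k : Fin s → ℤ) (b : Fin s → ℕ) :
    e2pi (phase M₁ M₂ ((a.1 : ℝ) / q, (a.2 : ℝ) / q) (realVec fun i => k i * q + b i)) =
      eqc q ((a.1 : ℤ) * quadEval M₁ (fun i => (b i : ℤ)) +
        (a.2 : ℤ) * quadEval M₂ (fun i => (b i : ℤ))) := by
  obtain ⟨n₁, h₁⟩ := exists_quadEval_mod M₁ q k (fun i => (b i : ℤ))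
  obtain ⟨n₂, h₂⟩ := exists_quadEval_mod M₂ q k (fun i => (b i : ℤ))
  have hq0 : (q : ℝ) ≠ 0 := by positivity
  have c : ∀ M : Matrix (Fin s) (Fin s) ℤ, quadEval M (realVec fun i => k i * q + b i) =
      ((quadEval M (fun i => k i * (q : ℤ) + (b i : ℤ)) : ℤ) : ℝ) := fun M =>
    quadEval_intCast M (fun i => k i * (q : ℤ) + (b i : ℤ))
  unfold phase eqc
  symm
  rw [c, c, h₁, h₂, ← e2pi_add_intCast _ ((a.1 : ℤ) * n₁ + (a.2 : ℤ) * n₂)]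
  congr 1
  push_cast
  field_simp
  ring

lemma phase_smul (M₁ M₂ : Matrix (Fin s) (Fin s) ℤ) (c : ℝ) (β : ℝ × ℝ) (x : Fin s → ℝ) :
    phase M₁ M₂ β (c • x) = c ^ 2 * phase M₁ M₂ β x := by
  have : ∀ M : Matrix (Fin s) (Fin s) ℤ, quadEval M (c • x) = c ^ 2 * quadEval M x := fun M => by
    simp only [quadEval, Finset.mul_sum]
    refine Finset.sum_congr rfl fun i _ => Finset.sum_congr rfl fun j _ => ?_
    simp only [Pi.smul_apply, smul_eq_mul]; ring
  simp only [phase, this]; ring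

lemma phase_smul_left (M₁ M₂ : Matrix (Fin s) (Fin s) ℤ) (c : ℝ) (β : ℝ × ℝ) (x : Fin s → ℝ) :
    phase M₁ M₂ (c • β) x = c * phase M₁ M₂ β x := by
  simp only [phase, Prod.smul_fst, Prod.smul_snd, smul_eq_mul]; ring

lemma phase_add_left (M₁ M₂ : Matrix (Fin s) (Fin s) ℤ) (α β : ℝ × ℝ) (x : Fin s → ℝ) :
    phase M₁ M₂ (α + β) x = phase M₁ M₂ α x + phase M₁ M₂ β x := by
  simp only [phase, Prod.fst_add, Prod.snd_add]; ring

/-- The approximation of the exponential sum near a rational point. -/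
lemma exists_expSum_approx (M₁ M₂ : Matrix (Fin s) (Fin s) ℤ) {w : (Fin s → ℝ) → ℝ}
    (hw : ContDiff ℝ (⊤ : ℕ∞) w) (hwc : HasCompactSupport w) (L : ℕ) :
    ∃ C : ℝ, 0 ≤ C ∧ ∀ (P : ℝ) (q : ℕ) (a : ℕ × ℕ) (ξ : ℝ × ℝ), 1 ≤ q → (q : ℝ) ≤ P →
      ‖expSum M₁ M₂ w P (((a.1 : ℝ) / q, (a.2 : ℝ) / q) + ξ) -
        ((P ^ s * ((q : ℝ) ^ s)⁻¹ : ℝ) : ℂ) * gaussSum2 M₁ M₂ q a *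
          singInt M₁ M₂ w (P ^ 2 • ξ)‖ ≤
        C * P ^ s * (q / P * (1 + P ^ 2 * ‖ξ‖)) ^ (L + 1) := by
  obtain ⟨C, hC, hCb⟩ := exists_latticeSum_oscFun_approx M₁ M₂ hw hwc L
  obtain ⟨ρ, hρ, hρw⟩ := hwc.exists_ball
  refine ⟨C, hC, fun P q a ξ hq hqP => ?_⟩
  have hq0 : (0 : ℝ) < q := by exact_mod_cast hq
  have hP : 0 < P := hq0.trans_le hqP
  set δ : ℝ := q / P with hδ
  have hδ0 : 0 < δ := by positivity
  have hδ1 : δ ≤ 1 := (div_le_one hP).mpr hqP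
  have hexp : expSum M₁ M₂ w P (((a.1 : ℝ) / q, (a.2 : ℝ) / q) + ξ) =
      ∑ b ∈ Fintype.piFinset (fun _ : Fin s => Finset.range q),
        eqc q ((a.1 : ℤ) * quadEval M₁ (fun i => (b i : ℤ)) +
          (a.2 : ℤ) * quadEval M₂ (fun i => (b i : ℤ))) *
        latticeSum (fun y => oscFun M₁ M₂ (fun x => (w x : ℂ)) (P ^ 2 • ξ) (δ • y))
          ((q : ℝ)⁻¹ • fun i => (b i : ℝ)) := by
    rw [expSum, tsum_eq_sum_residue_classes hq (R := ρ * P) fun x hx => by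
      rw [hρw _ (norm_inv_smul_gt hP hx)]; simp]
    refine Finset.sum_congr rfl fun b _ => ?_
    rw [latticeSum, ← tsum_mul_left]
    refine tsum_congr fun k => ?_
    have e1 : P⁻¹ • realVec (fun i => k i * (q : ℤ) + (b i : ℤ)) =
        δ • ((q : ℝ)⁻¹ • (fun i => (b i : ℝ)) + realVec k) := by
      ext i
      simp only [Pi.smul_apply, Pi.add_apply, realVec_apply, smul_eq_mul, hδ]
      push_cast
      field_simp
      ring
    rw [oscFun, ← e1, phase_smul, phase_smul_left, phase_add_left, e2pi_add,
      e2pi_phase_rational M₁ M₂ hq, ← mul_assoc (P⁻¹ ^ 2), inv_pow,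
      inv_mul_cancel₀ (by positivity), one_mul]
    ring
  have hmain : ((P ^ s * ((q : ℝ) ^ s)⁻¹ : ℝ) : ℂ) * gaussSum2 M₁ M₂ q a *
      singInt M₁ M₂ w (P ^ 2 • ξ) = ∑ b ∈ Fintype.piFinset (fun _ : Fin s => Finset.range q),
        eqc q ((a.1 : ℤ) * quadEval M₁ (fun i => (b i : ℤ)) +
          (a.2 : ℤ) * quadEval M₂ (fun i => (b i : ℤ))) *
        (((δ ^ s)⁻¹ : ℝ) * singInt M₁ M₂ w (P ^ 2 • ξ)) := by
    rw [← Finset.sum_mul, gaussSum2]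
    have : P ^ s * ((q : ℝ) ^ s)⁻¹ = (δ ^ s)⁻¹ := by
      rw [hδ, div_pow, inv_div, div_eq_mul_inv]
    rw [this]; ring
  rw [hexp, hmain, ← Finset.sum_sub_distrib]
  have hnξ : ‖P ^ 2 • ξ‖ = P ^ 2 * ‖ξ‖ := by
    rw [norm_smul, Real.norm_eq_abs, abs_of_pos (by positivity)]
  have hcard : ((Fintype.piFinset (fun _ : Fin s => Finset.range q)).card : ℝ) = (q : ℝ) ^ s := by
    rw [Fintype.card_piFinset_const, Finset.card_range]; push_cast; rfl
  calc _ ≤ ∑ b ∈ Fintype.piFinset (fun _ : Fin s => Finset.range q),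
        C * (δ ^ s)⁻¹ * (δ * (1 + P ^ 2 * ‖ξ‖)) ^ (L + 1) := by
        refine (norm_sum_le _ _).trans (Finset.sum_le_sum fun b _ => ?_)
        rw [← mul_sub, norm_mul, eqc, norm_e2pi, one_mul, ← hnξ]
        exact hCb _ δ hδ0 hδ1 _
    _ = _ := by
        rw [Finset.sum_const, nsmul_eq_mul, hcard, hδ, div_pow]
        field_simp

lemma le_of_forall_le_add_div {x y E P₀ : ℝ} (h : ∀ P, P₀ ≤ P → x ≤ y + E / P) : x ≤ y := by
  have ht : Filter.Tendsto (fun P : ℝ => y + E / P) Filter.atTop (nhds (y + 0)) :=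
    tendsto_const_nhds.add (tendsto_const_nhds.div_atTop Filter.tendsto_id)
  rw [add_zero] at ht
  exact ge_of_tendsto ht ((Filter.eventually_ge_atTop P₀).mono h)

end OscillatoryIntegral

section GaussSum

variable {s : ℕ} {M₁ M₂ : Matrix (Fin s) (Fin s) ℤ}

lemma exists_bump_integral_ne_zero (s : ℕ) : ∃ w : (Fin s → ℝ) → ℝ, ContDiff ℝ (⊤ : ℕ∞) w ∧
    HasCompactSupport w ∧ 0 < ∫ x, w x := by
  let f : ContDiffBump (0 : Fin s → ℝ) := ⟨1, 2, one_pos, one_lt_two⟩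
  exact ⟨f, f.contDiff, f.hasCompactSupport, f.integral_pos⟩

lemma singInt_zero (M₁ M₂ : Matrix (Fin s) (Fin s) ℤ) (w : (Fin s → ℝ) → ℝ) :
    singInt M₁ M₂ w 0 = ((∫ x, w x : ℝ) : ℂ) := by
  have h : ∀ x, phase M₁ M₂ (0 : ℝ × ℝ) x = 0 := fun x => by simp [phase]
  simp only [singInt, h, e2pi_zero, mul_one]
  exact integral_ofReal

lemma exists_gaussSum_le (hs : 0 < s) (hM₁ : M₁.IsSymm) (hM₂ : M₂.IsSymm) {c : ℝ} (hc : 0 < c)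
    (hc1 : c ≤ 1) : ∃ K κ : ℝ, 1 ≤ K ∧ 0 < κ ∧ κ ≤ 1 ∧ ∀ (q : ℕ) (a : ℕ × ℕ) (R : ℝ) (β : ℝ × ℝ),
      1 ≤ q → 0 < R → ‖((a.1 : ℝ) / q, (a.2 : ℝ) / q) - β‖ ≤ κ / R ^ 2 →
      ((q : ℝ) ^ s)⁻¹ * ‖gaussSum2 M₁ M₂ q a‖ ≤
        K * √((weylSet (2 • M₁) (2 • M₂) c R β).ncard / R ^ s) := by
  obtain ⟨w, hw, hwc, hpos⟩ := exists_bump_integral_ne_zero s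
  obtain ⟨C, hC, happ⟩ := exists_expSum_approx M₁ M₂ hw hwc 0
  obtain ⟨C', hC', hweyl⟩ := exists_weyl_inequality hs hM₁ hM₂ hw hwc hc hc1
  obtain ⟨κ, hκ, hκ1, hmono⟩ := exists_ncard_weylSet_le (2 • M₁) (2 • M₂) hc
  set I := ∫ x, w x with hI
  refine ⟨1 + √(C' * 5 ^ s) / I, κ, by simp; positivity, hκ, hκ1, fun q a R β hq hR hβ => ?_⟩
  set N : ℝ := ((weylSet (2 • M₁) (2 • M₂) c R β).ncard : ℝ) with hN
  set T := ((q : ℝ) ^ s)⁻¹ * ‖gaussSum2 M₁ M₂ q a‖ with hT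
  have hmain : T * I ≤ √(C' * 5 ^ s) * √(N / R ^ s) := by
    refine le_of_forall_le_add_div (E := C * q) (P₀ := max (4 * R) (max 1 q)) fun P hP => ?_
    have hP4 : 4 * R ≤ P := (le_max_left _ _).trans hP
    have hP1 : 1 ≤ P := (le_max_left _ _).trans ((le_max_right _ _).trans hP)
    have hPq : (q : ℝ) ≤ P := (le_max_right _ _).trans ((le_max_right _ _).trans hP)
    have hP0 : 0 < P := by linarith
    have h1 := happ P q a 0 hq hPq
    rw [add_zero, smul_zero, singInt_zero, norm_zero, mul_zero, add_zero, mul_one, zero_add,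
      pow_one, norm_sub_rev] at h1
    have h2 := hweyl P hP1 ((a.1 : ℝ) / q, (a.2 : ℝ) / q)
    have h3 := hmono P R _ β hR hP4 hβ
    set S := expSum M₁ M₂ w P ((a.1 : ℝ) / q, (a.2 : ℝ) / q) with hS
    have h4 : ‖S‖ ≤ P ^ s * (√(C' * 5 ^ s) * √(N / R ^ s)) := by
      refine abs_le_of_sq_le_sq' ?_ (by positivity) |>.2
      rw [mul_pow, mul_pow, Real.sq_sqrt (by positivity), Real.sq_sqrt (by positivity)]
      refine h2.trans ((mul_le_mul_of_nonneg_left h3 (by positivity)).trans (le_of_eq ?_))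
      rw [mul_pow, div_pow]
      ring
    have h5 := norm_le_norm_sub_add ((((P ^ s * ((q : ℝ) ^ s)⁻¹ : ℝ)) : ℂ) *
      gaussSum2 M₁ M₂ q a * (I : ℂ)) S
    have h6 : ‖(((P ^ s * ((q : ℝ) ^ s)⁻¹ : ℝ)) : ℂ) * gaussSum2 M₁ M₂ q a * (I : ℂ)‖ =
        P ^ s * (T * I) := by
      rw [norm_mul, norm_mul, Complex.norm_real, Complex.norm_real, Real.norm_of_nonneg hpos.le,
        Real.norm_of_nonneg (by positivity), hT]
      ring
    rw [h6] at h5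
    have hPs : 0 < P ^ s := by positivity
    refine le_of_mul_le_mul_left ?_ hPs
    calc P ^ s * (T * I) ≤ C * P ^ s * (q / P) + P ^ s * (√(C' * 5 ^ s) * √(N / R ^ s)) := by
          linarith
      _ = _ := by ring
  have h0 : 0 ≤ √(N / R ^ s) := Real.sqrt_nonneg _
  calc T = T * I / I := by field_simp
    _ ≤ √(C' * 5 ^ s) * √(N / R ^ s) / I := div_le_div_of_nonneg_right hmain hpos.le
    _ = √(C' * 5 ^ s) / I * √(N / R ^ s) := by ring
    _ ≤ _ := mul_le_mul_of_nonneg_right (by linarith) h0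

end GaussSum

section SingularIntegral

variable {s : ℕ}

/-- Counting integer points in a region bounded by `T` in all eigencoordinates but one. -/
lemma Pencil.card_le_of_coord_bound {B₁ B₂ : Matrix (Fin s) (Fin s) ℤ} (D : Pencil s B₁ B₂)
    {C T A : ℝ} (hC : 1 ≤ C) (hT : 1 ≤ T) (hA : 1 ≤ A)
    (hx : ∀ h, ‖h‖ ≤ C * ‖D.x h‖) (S : Finset (Fin s → ℤ)) (l₀ : Fin s)
    (hS : ∀ h ∈ S, ∀ l, l ≠ l₀ → ‖D.x (realVec h) l‖ ≤ T)
    (hS₀ : ∀ h ∈ S, ‖D.x (realVec h) l₀‖ ≤ A * T) :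
    (S.card : ℝ) ≤ (4 * A) ^ 2 * (5 * C * T) ^ s := by
  classical
  have hT0 : 0 < T := by linarith
  set f : (Fin s → ℤ) → ℤ × ℤ := fun h =>
    (⌊(D.x (realVec h) l₀).re / T⌋, ⌊(D.x (realVec h) l₀).im / T⌋) with hf
  set J : Finset ℤ := Finset.Icc (-(⌊A⌋ + 1)) ⌊A⌋ with hJ
  have hfl : ∀ t : ℝ, |t| ≤ A * T → ⌊t / T⌋ ∈ J := fun t ht => by
    have h1 : |t / T| ≤ A := by
      rw [abs_div, abs_of_pos hT0, div_le_iff₀ hT0]; exact ht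
    obtain ⟨h2, h3⟩ := abs_le.mp h1
    rw [hJ, Finset.mem_Icc]
    refine ⟨?_, Int.floor_le_floor h3⟩
    rw [Int.le_floor]
    push_cast
    linarith [Int.lt_floor_add_one A]
  have hmaps : ∀ h ∈ S, f h ∈ J ×ˢ J := fun h hh => by
    rw [Finset.mem_product]
    exact ⟨hfl _ ((Complex.abs_re_le_norm _).trans (hS₀ h hh)),
      hfl _ ((Complex.abs_im_le_norm _).trans (hS₀ h hh))⟩
  have hdiff : ∀ a b : ℝ, ⌊a / T⌋ = ⌊b / T⌋ → |a - b| ≤ T := fun a b hab => by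
    have := Int.abs_sub_lt_one_of_floor_eq_floor hab
    rw [← sub_div, abs_div, abs_of_pos hT0, div_lt_one hT0] at this
    exact this.le
  have hfib : ∀ z ∈ J ×ˢ J, (S.filter fun h => f h = z).card ≤ ⌊(5 * C * T) ^ s⌋₊ := by
    intro z _
    refine Nat.le_floor ?_
    rcases (S.filter fun h => f h = z).eq_empty_or_nonempty with he | ⟨h₀, hh₀⟩
    · rw [he, Finset.card_empty, Nat.cast_zero]; positivity
    rw [Finset.mem_filter] at hh₀
    have hsub : (S.filter fun h => f h = z).image (fun h => h - h₀) ⊆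
        (finite_int_ball (s := s) (2 * C * T)).toFinset := by
      intro k hk
      obtain ⟨h, hh, rfl⟩ := Finset.mem_image.mp hk
      rw [Finset.mem_filter] at hh
      rw [Set.Finite.mem_toFinset]
      change ‖realVec (h - h₀)‖ ≤ 2 * C * T
      rw [realVec_sub]
      refine (hx _).trans ?_
      have : ‖D.x (realVec h - realVec h₀)‖ ≤ 2 * T := by
        refine (pi_norm_le_iff_of_nonneg (by positivity)).mpr fun l => ?_
        rw [map_sub, Pi.sub_apply]
        by_cases hl : l = l₀
        · subst hl
          have e := hh.2.trans hh₀.2.symm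
          simp only [hf, Prod.mk.injEq] at e
          have h1 := hdiff _ _ e.1
          have h2 := hdiff _ _ e.2
          have h3 := Complex.norm_le_abs_re_add_abs_im (D.x (realVec h) l - D.x (realVec h₀) l)
          rw [Complex.sub_re, Complex.sub_im] at h3
          linarith
        · have := norm_sub_le (D.x (realVec h) l) (D.x (realVec h₀) l)
          linarith [hS h hh.1 l hl, hS h₀ hh₀.1 l hl]
      nlinarith
    have h1 := Finset.card_le_card hsub
    rw [Finset.card_image_of_injective _ (sub_left_injective)] at h1
    have h2 := card_int_ball_le (s := s) (R := 2 * C * T) (by positivity)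
    refine (Nat.cast_le.mpr h1).trans (h2.trans ?_)
    refine pow_le_pow_left₀ (by positivity) ?_ s
    nlinarith
  have h1 := Finset.card_le_mul_card_image_of_maps_to hmaps _ hfib
  have hJc : (J.card : ℝ) ≤ 4 * A := by
    have h0 : 0 ≤ ⌊A⌋ := Int.floor_nonneg.mpr (by linarith)
    rw [hJ, Int.card_Icc]
    have e : (((⌊A⌋ + 1 - -(⌊A⌋ + 1)).toNat : ℕ) : ℝ) = ((⌊A⌋ + 1 - -(⌊A⌋ + 1) : ℤ) : ℝ) := by
      exact_mod_cast Int.toNat_of_nonneg (by omega)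
    rw [e]
    push_cast
    linarith [Int.floor_le A]
  rw [Finset.card_product] at h1
  calc (S.card : ℝ) ≤ ((⌊(5 * C * T) ^ s⌋₊ * (J.card * J.card) : ℕ) : ℝ) := Nat.cast_le.mpr h1
    _ = (J.card : ℝ) ^ 2 * (⌊(5 * C * T) ^ s⌋₊ : ℝ) := by push_cast; ring
    _ ≤ _ := mul_le_mul (pow_le_pow_left₀ (by positivity) hJc 2)
      (Nat.floor_le (by positivity)) (by positivity) (by positivity)

lemma Pencil.L_smul {B₁ B₂ : Matrix (Fin s) (Fin s) ℤ} (D : Pencil s B₁ B₂) (t : ℝ) (β : ℝ × ℝ)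
    (l : Fin s) : D.L (t • β) l = t * D.L β l := by
  simp only [Pencil.L, Prod.smul_fst, Prod.smul_snd, smul_eq_mul]
  push_cast
  ring

/-- The Weyl count very close to the origin. -/
lemma Pencil.exists_ncard_weylSet_near_zero_le {B₁ B₂ : Matrix (Fin s) (Fin s) ℤ}
    (D : Pencil s B₁ B₂) (hs : 0 < s) {c : ℝ} (hc1 : c ≤ 1) :
    ∃ K : ℝ, 1 ≤ K ∧ ∀ β : ℝ × ℝ, 1 ≤ ‖β‖ → ∃ P₀ : ℝ, 1 ≤ P₀ ∧ ∀ P, P₀ ≤ P →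
      ((weylSet B₁ B₂ c P ((P ^ 2)⁻¹ • β)).ncard : ℝ) ≤ K * ‖β‖ ^ 2 * (P / ‖β‖) ^ s := by
  classical
  obtain ⟨C, hC, -, hy, hx, -, -⟩ := D.exists_coord_bound
  obtain ⟨C₁, hC₁, hx₁, -, -, -, -⟩ := D.exists_coord_bound
  obtain ⟨C₂, hC₂, hind⟩ := D.exists_indep_bound
  obtain ⟨C₃, hC₃, hpm⟩ := exists_norm_pencilMap_le B₁ B₂
  set E := 2 * C₂ * C * C₁ with hE
  have hE1 : 1 ≤ E := by
    have h1 : 1 ≤ C₂ * C := one_le_mul_of_one_le_of_one_le hC₂ hC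
    have h2 : 1 ≤ C₂ * C * C₁ := one_le_mul_of_one_le_of_one_le h1 hC₁
    rw [hE]; nlinarith
  refine ⟨(1 + 4) ^ 2 * (5 * C * E) ^ s, ?_, fun β hβ => ⟨4 * C₃ * ‖β‖ + 4, ?_, fun P hP => ?_⟩⟩
  · refine one_le_mul_of_one_le_of_one_le (by norm_num) (one_le_pow₀ ?_)
    nlinarith
  · nlinarith
  have hb0 : 0 < ‖β‖ := by linarith
  have hP4 : 4 ≤ P := by nlinarith
  have hP0 : 0 < P := by linarith
  have hPb : ‖β‖ ≤ P := by nlinarith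
  have : Nonempty (Fin s) := ⟨⟨0, hs⟩⟩
  obtain ⟨l₀, hl₀⟩ := Finite.exists_min fun l => ‖D.L β l‖
  set T := E * (P / ‖β‖) with hT
  have hPB1 : 1 ≤ P / ‖β‖ := (one_le_div hb0).mpr hPb
  have hT1 : 1 ≤ T := one_le_mul_of_one_le_of_one_le hE1 hPB1
  have hfin := weylSet_finite B₁ B₂ c P ((P ^ 2)⁻¹ • β)
  have hnorm : ‖(P ^ 2)⁻¹ • β‖ = ‖β‖ / P ^ 2 := by
    rw [norm_smul, norm_inv, Real.norm_of_nonneg (by positivity)]; ring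
  have key : ∀ h ∈ hfin.toFinset, ‖realVec h‖ ≤ c * P ∧
      ∀ l, ‖D.L β l‖ * ‖D.x (realVec h) l‖ ≤ C * P := by
    intro h hh
    rw [Set.Finite.mem_toFinset] at hh
    obtain ⟨hh1, n, hn⟩ := hh
    refine ⟨hh1, fun l => ?_⟩
    have h1 : ‖pencilMap B₁ B₂ ((P ^ 2)⁻¹ • β) (realVec h)‖ ≤ 1 / 4 := by
      refine (hpm _ _).trans ?_
      rw [hnorm]
      calc C₃ * (‖β‖ / P ^ 2) * ‖realVec h‖ ≤ C₃ * (‖β‖ / P ^ 2) * P :=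
            mul_le_mul_of_nonneg_left (hh1.trans (by nlinarith)) (by positivity)
        _ = C₃ * ‖β‖ / P := by field_simp
        _ ≤ _ := by rw [div_le_iff₀ hP0]; linarith
    have h2 : c / P ≤ 1 / 4 := by rw [div_le_iff₀ hP0]; linarith
    have hn0 : n = 0 := by
      ext i
      have h3 : ‖realVec n‖ ≤ 1 / 2 := by
        have := norm_le_norm_sub_add (realVec n) (pencilMap B₁ B₂ ((P ^ 2)⁻¹ • β) (realVec h))
        rw [norm_sub_rev] at this
        linarith
      have h4 : |(n i : ℝ)| ≤ 1 / 2 := (norm_le_pi_norm (realVec n) i).trans h3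
      have h5 : |(n i : ℝ)| < 1 := by linarith
      have h6 : |n i| < 1 := by exact_mod_cast h5
      simpa using Int.abs_lt_one_iff.mp h6
    have hr0 : realVec (0 : Fin s → ℤ) = 0 := by ext i; simp [realVec_apply]
    rw [hn0, hr0, sub_zero] at hn
    have h7 := hy (pencilMap B₁ B₂ ((P ^ 2)⁻¹ • β) (realVec h)) l
    rw [D.y_pencilMap, D.L_smul, norm_mul, norm_mul, Complex.norm_real,
      Real.norm_of_nonneg (by positivity)] at h7
    have h8 : (P ^ 2)⁻¹ * ‖D.L β l‖ * ‖D.x (realVec h) l‖ ≤ C * (1 / P) :=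
      h7.trans (mul_le_mul_of_nonneg_left
        (hn.trans (div_le_div_of_nonneg_right hc1 hP0.le)) (by linarith))
    calc ‖D.L β l‖ * ‖D.x (realVec h) l‖
        = P ^ 2 * ((P ^ 2)⁻¹ * ‖D.L β l‖ * ‖D.x (realVec h) l‖) := by field_simp
      _ ≤ P ^ 2 * (C * (1 / P)) := mul_le_mul_of_nonneg_left h8 (by positivity)
      _ = C * P := by field_simp
  have hcard := D.card_le_of_coord_bound hC hT1 hβ hx hfin.toFinset l₀ (fun h hh l hl => ?_)
    (fun h hh => ?_)
  · rw [← Set.ncard_eq_toFinset_card _ hfin] at hcard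
    refine hcard.trans (le_of_mul_le_mul_left ?_ (one_pos))
    have e1 : (5 * C * T) ^ s = (5 * C * E) ^ s * (P / ‖β‖) ^ s := by
      rw [← mul_pow]; congr 1; rw [hT]; ring
    rw [e1]
    have : 0 ≤ ‖β‖ ^ 2 * ((5 * C * E) ^ s * (P / ‖β‖) ^ s) := by positivity
    nlinarith
  · have h1 := hind l l₀ hl β
    have h2 : ‖β‖ ≤ 2 * C₂ * ‖D.L β l‖ := by
      have := hl₀ l
      nlinarith
    have h3 := (key h hh).2 l
    rw [hT, ← mul_div_assoc, le_div_iff₀ hb0]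
    calc ‖D.x (realVec h) l‖ * ‖β‖ ≤ ‖D.x (realVec h) l‖ * (2 * C₂ * ‖D.L β l‖) :=
          mul_le_mul_of_nonneg_left h2 (norm_nonneg _)
      _ = 2 * C₂ * (‖D.L β l‖ * ‖D.x (realVec h) l‖) := by ring
      _ ≤ 2 * C₂ * (C * P) := mul_le_mul_of_nonneg_left h3 (by linarith)
      _ ≤ E * P := by
        rw [hE]
        have : 0 ≤ 2 * C₂ * C * P := by positivity
        nlinarith
  · calc ‖D.x (realVec h) l₀‖ ≤ C₁ * ‖realVec h‖ := hx₁ _ _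
      _ ≤ C₁ * P := mul_le_mul_of_nonneg_left ((key h hh).1.trans (by nlinarith)) (by linarith)
      _ ≤ E * P := by
        refine mul_le_mul_of_nonneg_right ?_ hP0.le
        have h1 : 1 ≤ C₂ * C := one_le_mul_of_one_le_of_one_le hC₂ hC
        rw [hE]; nlinarith
      _ = ‖β‖ * T := by rw [hT]; field_simp

lemma norm_singInt_le_integral (M₁ M₂ : Matrix (Fin s) (Fin s) ℤ) (w : (Fin s → ℝ) → ℝ)
    (β : ℝ × ℝ) :
    ‖singInt M₁ M₂ w β‖ ≤ ∫ x, ‖w x‖ := by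
  refine (norm_integral_le_integral_norm _).trans (le_of_eq ?_)
  simp [norm_e2pi]

lemma gaussSum2_one (M₁ M₂ : Matrix (Fin s) (Fin s) ℤ) : gaussSum2 M₁ M₂ 1 (0, 0) = 1 := by
  simp [gaussSum2, eqc, e2pi_zero]

lemma Pencil.exists_singInt_le {M₁ M₂ : Matrix (Fin s) (Fin s) ℤ}
    (D : Pencil s (2 • M₁) (2 • M₂)) (hs : 10 ≤ s)
    (hM₁ : M₁.IsSymm) (hM₂ : M₂.IsSymm) {w : (Fin s → ℝ) → ℝ}
    (hw : ContDiff ℝ (⊤ : ℕ∞) w) (hwc : HasCompactSupport w) :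
    ∃ K : ℝ, 1 ≤ K ∧ ∀ β, ‖singInt M₁ M₂ w β‖ ≤ K * ((1 + ‖β‖) ^ 4)⁻¹ := by
  obtain ⟨C, hC, happ⟩ := exists_expSum_approx M₁ M₂ hw hwc 0
  obtain ⟨C', hC', hweyl⟩ := exists_weyl_inequality (by omega) hM₁ hM₂ hw hwc one_pos le_rfl
  obtain ⟨K, hK, hN⟩ := D.exists_ncard_weylSet_near_zero_le (by omega) le_rfl
  have hbig : ∀ β : ℝ × ℝ, 1 ≤ ‖β‖ → ‖singInt M₁ M₂ w β‖ ≤ √(C' * K) * (‖β‖ ^ 4)⁻¹ := by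
    intro β hβ
    have hb0 : 0 < ‖β‖ := by linarith
    obtain ⟨P₀, hP₀, hNP⟩ := hN β hβ
    refine le_of_forall_le_add_div (E := C * (1 + ‖β‖)) (P₀ := P₀) fun P hP => ?_
    have hP1 : 1 ≤ P := hP₀.trans hP
    have hP0 : 0 < P := by linarith
    have h1 := happ P 1 (0, 0) ((P ^ 2)⁻¹ • β) le_rfl (by simpa using hP1)
    rw [smul_smul, mul_inv_cancel₀ (by positivity), one_smul, gaussSum2_one, norm_smul, norm_inv,
      Real.norm_of_nonneg (by positivity : (0 : ℝ) ≤ P ^ 2), mul_inv_cancel_left₀ (by positivity),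
      zero_add, pow_one, norm_sub_rev] at h1
    simp only [Nat.cast_zero, zero_div, Nat.cast_one, one_pow, inv_one, mul_one] at h1
    rw [show ((0 : ℝ), (0 : ℝ)) = 0 from rfl, zero_add] at h1
    have h2 := hweyl P hP1 ((P ^ 2)⁻¹ • β)
    have h3 := hNP P hP
    set S := expSum M₁ M₂ w P ((P ^ 2)⁻¹ • β) with hS
    have h4 : ‖S‖ ≤ P ^ s * (√(C' * K) * (‖β‖ ^ 4)⁻¹) := by
      refine abs_le_of_sq_le_sq' ?_ (by positivity) |>.2
      rw [mul_pow, mul_pow, Real.sq_sqrt (by positivity)]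
      refine h2.trans ((mul_le_mul_of_nonneg_left h3 (by positivity)).trans ?_)
      obtain ⟨t, rfl⟩ := Nat.exists_eq_add_of_le hs
      have h5 : ((‖β‖) ^ (10 + t))⁻¹ ≤ (‖β‖ ^ 10)⁻¹ :=
        inv_anti₀ (by positivity) (pow_le_pow_right₀ hβ (by omega))
      rw [div_pow]
      calc C' * P ^ (10 + t) * (K * ‖β‖ ^ 2 * (P ^ (10 + t) / ‖β‖ ^ (10 + t)))
          = C' * K * (P ^ (10 + t)) ^ 2 * ‖β‖ ^ 2 * ((‖β‖) ^ (10 + t))⁻¹ := by ring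
        _ ≤ C' * K * (P ^ (10 + t)) ^ 2 * ‖β‖ ^ 2 * (‖β‖ ^ 10)⁻¹ :=
          mul_le_mul_of_nonneg_left h5 (by positivity)
        _ = _ := by field_simp
    have h5 := norm_le_norm_sub_add (((P ^ s : ℝ) : ℂ) * singInt M₁ M₂ w β) S
    rw [norm_mul, Complex.norm_real, Real.norm_of_nonneg (by positivity)] at h5
    refine le_of_mul_le_mul_left ?_ (by positivity : 0 < P ^ s)
    calc P ^ s * ‖singInt M₁ M₂ w β‖
        ≤ C * P ^ s * (1 / P * (1 + ‖β‖)) + P ^ s * (√(C' * K) * (‖β‖ ^ 4)⁻¹) := by linarith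
      _ = _ := by ring
  have hI0 : 0 ≤ ∫ x, ‖w x‖ := integral_nonneg fun x => norm_nonneg _
  refine ⟨1 + 16 * ((∫ x, ‖w x‖) + √(C' * K)), ?_, fun β => ?_⟩
  · have : 0 ≤ √(C' * K) := Real.sqrt_nonneg _
    linarith
  have hsq : 0 ≤ √(C' * K) := Real.sqrt_nonneg _
  have hb0 := norm_nonneg β
  rw [← div_eq_mul_inv, le_div_iff₀ (by positivity)]
  rcases le_total ‖β‖ 1 with hβ | hβ
  · have h1 := norm_singInt_le_integral M₁ M₂ w β
    have h2 : (1 + ‖β‖) ^ 4 ≤ 2 ^ 4 := pow_le_pow_left₀ (by linarith) (by linarith) 4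
    calc _ ≤ (∫ x, ‖w x‖) * 2 ^ 4 := mul_le_mul h1 h2 (by positivity) hI0
      _ ≤ _ := by linarith
  · have h1 := hbig β hβ
    have h2 : (1 + ‖β‖) ^ 4 ≤ (2 * ‖β‖) ^ 4 := pow_le_pow_left₀ (by linarith) (by linarith) 4
    calc _ ≤ √(C' * K) * (‖β‖ ^ 4)⁻¹ * (2 * ‖β‖) ^ 4 :=
          mul_le_mul h1 h2 (by positivity) (by positivity)
      _ = 16 * √(C' * K) := by rw [mul_pow]; field_simp; norm_num
      _ ≤ _ := by linarith

end SingularIntegral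

section RationalPoints

lemma mem_residues {q : ℕ} {a : ℕ × ℕ} :
    a ∈ residues q ↔ a.1 < q ∧ a.2 < q ∧ Nat.gcd (Nat.gcd a.1 a.2) q = 1 := by
  simp [residues, and_assoc]

lemma dvd_of_residue_proportional {q q' : ℕ} {a a' : ℕ × ℕ} (ha : a' ∈ residues q')
    (h₁ : a.1 * q' = a'.1 * q) (h₂ : a.2 * q' = a'.2 * q) : q' ∣ q := by
  have h : q' ∣ Nat.gcd (Nat.gcd (a'.1 * q) (a'.2 * q)) (q' * q) :=
    Nat.dvd_gcd (Nat.dvd_gcd ⟨a.1, by rw [← h₁, mul_comm]⟩ ⟨a.2, by rw [← h₂, mul_comm]⟩)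
      (dvd_mul_right _ _)
  rwa [Nat.gcd_mul_right, Nat.gcd_mul_right, (mem_residues.mp ha).2.2, one_mul] at h

/-- Distinct reduced rational points are well separated. -/
lemma one_div_le_norm_sub_of_ne {q q' : ℕ} {a a' : ℕ × ℕ} (hq : 1 ≤ q) (hq' : 1 ≤ q')
    (ha : a ∈ residues q) (ha' : a' ∈ residues q') (hne : (q, a) ≠ (q', a')) :
    1 / ((q : ℝ) * q') ≤
      ‖(((a.1 : ℝ) / q, (a.2 : ℝ) / q) : ℝ × ℝ) - ((a'.1 : ℝ) / q', (a'.2 : ℝ) / q')‖ := by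
  have hq0 : (0 : ℝ) < q := by exact_mod_cast hq
  have hq0' : (0 : ℝ) < q' := by exact_mod_cast hq'
  have key : ∀ m n : ℕ, m * q' ≠ n * q → 1 / ((q : ℝ) * q') ≤ |(m : ℝ) / q - n / q'| := by
    intro m n hmn
    have h1 : (m : ℝ) / q - n / q' = ((m * q' - n * q : ℤ) : ℝ) / (q * q') := by
      push_cast; field_simp
    rw [h1, abs_div, abs_of_pos (by positivity : (0 : ℝ) < q * q')]
    refine div_le_div_of_nonneg_right ?_ (by positivity)
    have h2 : (m * q' - n * q : ℤ) ≠ 0 := fun h => hmn (by exact_mod_cast sub_eq_zero.mp h)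
    exact_mod_cast Int.one_le_abs h2
  rw [Prod.norm_def]
  by_cases h₁ : a.1 * q' = a'.1 * q
  · by_cases h₂ : a.2 * q' = a'.2 * q
    · refine absurd ?_ hne
      have e : q = q' := Nat.dvd_antisymm (dvd_of_residue_proportional ha h₁.symm h₂.symm)
        (dvd_of_residue_proportional ha' h₁ h₂)
      subst e
      have e₁ := Nat.eq_of_mul_eq_mul_right (by omega) h₁
      have e₂ := Nat.eq_of_mul_eq_mul_right (by omega) h₂
      exact Prod.ext rfl (Prod.ext e₁ e₂)
    · exact (key _ _ h₂).trans (le_max_right _ _)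
  · exact (key _ _ h₁).trans (le_max_left _ _)

lemma volume_closedBall_prod (x : ℝ × ℝ) {r : ℝ} (hr : 0 ≤ r) :
    volume (Metric.closedBall x r) = ENNReal.ofReal ((2 * r) ^ 2) := by
  rw [← closedBall_prod_same, Measure.volume_eq_prod, Measure.prod_prod, Real.volume_closedBall,
    Real.volume_closedBall, ← ENNReal.ofReal_mul (by positivity), sq]

lemma sum_indicator_le_of_pairwiseDisjoint {ι X : Type*} (I : Finset ι) (S : ι → Set X)
    (v : ι → ENNReal) (hd : ∀ i ∈ I, ∀ j ∈ I, i ≠ j → Disjoint (S i) (S j)) {x : X} {B : ENNReal}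
    (hB : ∀ i ∈ I, x ∈ S i → v i ≤ B) :
    ∑ i ∈ I, (S i).indicator (fun _ => v i) x ≤ B := by
  by_cases h : ∃ i ∈ I, x ∈ S i
  · obtain ⟨i, hi, hx⟩ := h
    rw [Finset.sum_eq_single_of_mem i hi fun j hj hji =>
      Set.indicator_of_notMem (fun hxj => Set.disjoint_left.mp (hd j hj i hi hji) hxj hx) _,
      Set.indicator_of_mem hx]
    exact hB i hi hx
  · push Not at h
    rw [Finset.sum_eq_zero fun i hi => Set.indicator_of_notMem (h i hi) _]
    exact zero_le

end RationalPoints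

section SingularSeries

variable {s : ℕ}

/-- The normalised absolute value of a complete exponential sum. -/
noncomputable def seriesTerm (M₁ M₂ : Matrix (Fin s) (Fin s) ℤ) (q : ℕ) (a : ℕ × ℕ) : ℝ :=
  ((q : ℝ) ^ s)⁻¹ * ‖gaussSum2 M₁ M₂ q a‖

lemma seriesTerm_nonneg (M₁ M₂ : Matrix (Fin s) (Fin s) ℤ) (q : ℕ) (a : ℕ × ℕ) :
    0 ≤ seriesTerm M₁ M₂ q a := by
  unfold seriesTerm; positivity

lemma Pencil.exists_block_bound {M₁ M₂ : Matrix (Fin s) (Fin s) ℤ}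
    (D : Pencil s (2 • M₁) (2 • M₂)) (hs : 10 ≤ s) (hM₁ : M₁.IsSymm) (hM₂ : M₂.IsSymm) :
    ∃ K R₀ : ℝ, 1 ≤ K ∧ 1 ≤ R₀ ∧ ∀ R, R₀ ≤ R → ∀ I : Finset (ℕ × (ℕ × ℕ)),
      (∀ i ∈ I, R / 2 < (i.1 : ℝ) ∧ (i.1 : ℝ) ≤ R ∧ i.2 ∈ residues i.1) →
      ∑ i ∈ I, seriesTerm M₁ M₂ i.1 i.2 ≤ K * R ^ (-(23 / 100) : ℝ) := by
  obtain ⟨c, C₀, C, hc, hc2, hC₀, hC, hdist⟩ := D.exists_weylSet_distribution (by omega)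
  obtain ⟨G, κ, hG, hκ, hκ1, hgauss⟩ := exists_gaussSum_le (s := s) (by omega) hM₁ hM₂ hc
    (by linarith)
  obtain ⟨K, hK, hlevel⟩ := exists_lintegral_level_le hs (2 • M₁) (2 • M₂) hC₀ hC
    (fun P Z h1 h2 => (hdist P Z h1 h2).1)
  set e : ℝ := ((s : ℝ) - 1) / 2 - 4 with he
  refine ⟨1 + 4 * G * K / κ ^ 2 * (2 * C) ^ (e / 2), 2 * C, ?_, by linarith, fun R hR I hI => ?_⟩
  · have : 0 ≤ 4 * G * K / κ ^ 2 * (2 * C) ^ (e / 2) := by positivity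
    linarith
  have hR0 : 0 < R := by linarith
  have hR1 : 1 ≤ R := by linarith
  set Z := √(2 * C * R) with hZ
  have hZ2 : Z ^ 2 = 2 * C * R := Real.sq_sqrt (by positivity)
  have hZ0 : 0 < Z := Real.sqrt_pos.mpr (by positivity)
  have hZC : C ≤ Z := by
    refine Real.le_sqrt_of_sq_le ?_
    nlinarith
  have hZ1 : 1 ≤ Z := hC.trans hZC
  have hZR : Z ≤ R := by
    refine Real.sqrt_le_iff.mpr ⟨hR0.le, ?_⟩
    nlinarith
  set r := κ / (4 * R ^ 2) with hr
  have hr0 : 0 < r := by positivity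
  have hr4 : r ≤ 1 / (4 * R ^ 2) := div_le_div_of_nonneg_right hκ1 (by positivity)
  have hrκ : r ≤ κ / R ^ 2 := by
    rw [hr]
    exact div_le_div_of_nonneg_left hκ.le (by positivity) (by nlinarith [sq_nonneg R])
  set pt : ℕ × (ℕ × ℕ) → ℝ × ℝ := fun i => ((i.2.1 : ℝ) / i.1, (i.2.2 : ℝ) / i.1) with hpt
  set v : ℕ × (ℕ × ℕ) → ℝ := fun i => seriesTerm M₁ M₂ i.1 i.2 * √(R ^ s) / G with hv
  have hRs : 0 < √(R ^ s) := Real.sqrt_pos.mpr (by positivity)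
  have hv0 : ∀ i, 0 ≤ v i := fun i =>
    div_nonneg (mul_nonneg (seriesTerm_nonneg _ _ _ _) hRs.le) (by linarith)
  have hq1 : ∀ i ∈ I, 1 ≤ i.1 := fun i hi => by
    have h1 := (hI i hi).1
    have h2 : (0 : ℝ) < i.1 := by linarith
    exact_mod_cast h2
  have hvN : ∀ i ∈ I, ∀ α, ‖pt i - α‖ ≤ r →
      v i ≤ √((weylSet (2 • M₁) (2 • M₂) c R α).ncard) := by
    intro i hi α hα
    have h1 := hgauss i.1 i.2 R α (hq1 i hi) hR0 (hα.trans hrκ)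
    rw [Real.sqrt_div' _ (by positivity)] at h1
    rw [hv]
    simp only [seriesTerm]
    rw [div_le_iff₀ (by linarith)]
    calc _ ≤ G * (√((weylSet (2 • M₁) (2 • M₂) c R α).ncard) / √(R ^ s)) * √(R ^ s) :=
          mul_le_mul_of_nonneg_right h1 hRs.le
      _ = _ := by field_simp
  have hvZ : ∀ i ∈ I, v i ≤ √(C₀ * R * Z ^ (s - 1)) := by
    intro i hi
    obtain ⟨h1, h2, h3⟩ := hI i hi
    refine (hvN i hi (pt i) (by rw [sub_self, norm_zero]; exact hr0.le)).trans ?_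
    refine Real.sqrt_le_sqrt ?_
    by_contra! hcon
    have h4 := (hdist R Z hZ1 hZR).2.2 i.1 i.2.1 i.2.2 (hq1 i hi) (by
      have := (mem_residues.mp h3).2.2
      rw [Int.gcd_natCast_natCast, Int.gcd_natCast_natCast]
      exact this) (by nlinarith) (by
      simpa only [Int.cast_natCast] using hcon.le)
    rw [div_pow, hZ2] at h4
    have h5 : C * (R ^ 2 / (2 * C * R)) = R / 2 := by field_simp
    linarith
  set g : ℝ × ℝ → ENNReal := fun α => ∑ i ∈ I,
    (Metric.closedBall (pt i) r).indicator (fun _ => ENNReal.ofReal (v i)) α with hg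
  have hdisj : ∀ i ∈ I, ∀ j ∈ I, i ≠ j →
      Disjoint (Metric.closedBall (pt i) r) (Metric.closedBall (pt j) r) := by
    intro i hi j hj hij
    refine Metric.closedBall_disjoint_closedBall ?_
    have h1 := one_div_le_norm_sub_of_ne (hq1 i hi) (hq1 j hj) (hI i hi).2.2 (hI j hj).2.2 hij
    have h2 : 1 / R ^ 2 ≤ 1 / ((i.1 : ℝ) * j.1) := by
      have hi0 : (0 : ℝ) < i.1 := by exact_mod_cast hq1 i hi
      have hj0 : (0 : ℝ) < j.1 := by exact_mod_cast hq1 j hj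
      refine one_div_le_one_div_of_le (by positivity) ?_
      rw [sq]
      exact mul_le_mul (hI i hi).2.1 (hI j hj).2.1 hj0.le hR0.le
    rw [dist_eq_norm]
    refine lt_of_lt_of_le ?_ (h2.trans h1)
    have h3 : 1 / (4 * R ^ 2) = 1 / R ^ 2 / 4 := by field_simp
    have h4 : 0 < 1 / R ^ 2 := by positivity
    linarith
  have hgm : Measurable g := Finset.measurable_fun_sum _ fun i _ =>
    measurable_const.indicator Metric.isClosed_closedBall.measurableSet
  have hmem : ∀ i α, α ∈ Metric.closedBall (pt i) r → ‖pt i - α‖ ≤ r := fun i α h => by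
    rwa [← dist_eq_norm, dist_comm]
  have hInt := hlevel R Z hZ1 hZR g hgm
    (fun α _ => sum_indicator_le_of_pairwiseDisjoint I _ _ hdisj fun i hi hx =>
      ENNReal.ofReal_le_ofReal (hvN i hi α (hmem i α hx)))
    (fun α _ => sum_indicator_le_of_pairwiseDisjoint I _ _ hdisj fun i hi hx =>
      ENNReal.ofReal_le_ofReal (hvZ i hi))
  have hball : ∀ i ∈ I, Metric.closedBall (pt i) r ⊆ {α : ℝ × ℝ | ‖α‖ ≤ 2} := by
    intro i hi α hα
    have h1 := hmem i α hα
    have h0 : (0 : ℝ) < i.1 := by exact_mod_cast hq1 i hi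
    obtain ⟨ha, hb, -⟩ := mem_residues.mp (hI i hi).2.2
    have h2 : ‖pt i‖ ≤ 1 := by
      rw [hpt, Prod.norm_def]
      refine max_le ?_ ?_
      · simp only [norm_div, RCLike.norm_natCast]
        rw [div_le_one h0]; exact_mod_cast ha.le
      · simp only [norm_div, RCLike.norm_natCast]
        rw [div_le_one h0]; exact_mod_cast hb.le
    have h3 : r ≤ 1 := hr4.trans (by
      rw [div_le_one (by positivity)]; nlinarith)
    have h4 := norm_sub_norm_le α (pt i)
    rw [norm_sub_rev] at h4
    change ‖α‖ ≤ 2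
    linarith
  have heq : ∫⁻ α in {α | ‖α‖ ≤ 2}, g α =
      ENNReal.ofReal ((2 * r) ^ 2 * √(R ^ s) / G * ∑ i ∈ I, seriesTerm M₁ M₂ i.1 i.2) := by
    rw [hg, lintegral_finsetSum _ fun i _ =>
      measurable_const.indicator Metric.isClosed_closedBall.measurableSet]
    rw [Finset.mul_sum, ENNReal.ofReal_sum_of_nonneg fun i _ => by
      have := seriesTerm_nonneg M₁ M₂ i.1 i.2
      positivity]
    refine Finset.sum_congr rfl fun i hi => ?_
    rw [lintegral_indicator_const Metric.isClosed_closedBall.measurableSet,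
      Measure.restrict_apply Metric.isClosed_closedBall.measurableSet,
      Set.inter_eq_left.mpr (hball i hi), volume_closedBall_prod _ hr0.le,
      ← ENNReal.ofReal_mul (hv0 i)]
    congr 1
    rw [hv]
    ring
  rw [heq, ENNReal.ofReal_le_ofReal_iff (by positivity)] at hInt
  have hsq : √(R ^ s) = R ^ ((s : ℝ) / 2) := by
    rw [Real.sqrt_eq_rpow, ← Real.rpow_natCast, ← Real.rpow_mul hR0.le]
    congr 1; ring
  have hZe : Z ^ e = (2 * C) ^ (e / 2) * R ^ (e / 2) := by
    rw [hZ, Real.sqrt_eq_rpow, ← Real.rpow_mul (by positivity),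
      Real.mul_rpow (by positivity) hR0.le]
    congr 2 <;> ring
  have hpos : 0 < (2 * r) ^ 2 * √(R ^ s) / G := by positivity
  have hR4 : R ^ 4 = R ^ (4 : ℝ) := by rw [← Real.rpow_natCast]; norm_num
  have hexp : R ^ (4 : ℝ) * R ^ (13 / 25 : ℝ) * R ^ (e / 2) / R ^ ((s : ℝ) / 2) ≤
      R ^ (-(23 / 100) : ℝ) := by
    rw [← Real.rpow_add hR0, ← Real.rpow_add hR0, ← Real.rpow_sub hR0]
    refine Real.rpow_le_rpow_of_exponent_le hR1 ?_
    have : (10 : ℝ) ≤ s := by exact_mod_cast hs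
    rw [he]
    linarith
  calc ∑ i ∈ I, seriesTerm M₁ M₂ i.1 i.2
      = ((2 * r) ^ 2 * √(R ^ s) / G)⁻¹ *
        ((2 * r) ^ 2 * √(R ^ s) / G * ∑ i ∈ I, seriesTerm M₁ M₂ i.1 i.2) := by
        rw [inv_mul_cancel_left₀ hpos.ne']
    _ ≤ ((2 * r) ^ 2 * √(R ^ s) / G)⁻¹ * (K * R ^ (13 / 25 : ℝ) * Z ^ e) :=
        mul_le_mul_of_nonneg_left hInt (by positivity)
    _ = 4 * G * K / κ ^ 2 * (2 * C) ^ (e / 2) *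
        (R ^ (4 : ℝ) * R ^ (13 / 25 : ℝ) * R ^ (e / 2) / R ^ ((s : ℝ) / 2)) := by
        rw [← hR4, hZe, hsq, hr]
        field_simp
        norm_num
    _ ≤ 4 * G * K / κ ^ 2 * (2 * C) ^ (e / 2) * R ^ (-(23 / 100) : ℝ) :=
        mul_le_mul_of_nonneg_left hexp (by positivity)
    _ ≤ _ := mul_le_mul_of_nonneg_right (by linarith) (by positivity)

end SingularSeries

/-- A nonnegative series converges if its dyadic blocks eventually decay geometrically. -/
lemma summable_of_dyadic_blocks {f : ℕ → ℝ} (hf : ∀ n, 0 ≤ f n) {K ρ : ℝ}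
    (hρ₀ : 0 ≤ ρ) (hρ : ρ < 1) {k₀ : ℕ}
    (h : ∀ k, k₀ ≤ k → ∑ q ∈ Finset.Ioc (2 ^ k) (2 ^ (k + 1)), f q ≤ K * ρ ^ k) : Summable f := by
  set b : ℕ → ℝ := fun k => ∑ q ∈ Finset.Ioc (2 ^ k) (2 ^ (k + 1)), f q with hb
  have hb0 : ∀ k, 0 ≤ b k := fun k => Finset.sum_nonneg fun q _ => hf q
  have hbs : Summable b := by
    refine Summable.of_norm_bounded_eventually_nat
      ((summable_geometric_of_lt_one hρ₀ hρ).mul_left K) ?_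
    filter_upwards [Filter.eventually_ge_atTop k₀] with k hk
    rw [Real.norm_of_nonneg (hb0 k)]
    exact h k hk
  have hS : ∀ n, ∑ q ∈ Finset.Ioc 0 (2 ^ n), f q = f 1 + ∑ k ∈ Finset.range n, b k := by
    intro n
    induction n with
    | zero => simp [show Finset.Ioc 0 1 = {1} from rfl]
    | succ n ih =>
      rw [Finset.sum_range_succ, ← add_assoc, ← ih, hb,
        Finset.sum_Ioc_consecutive _ (Nat.zero_le _) (Nat.pow_le_pow_right two_pos (Nat.le_succ n))]
  refine summable_of_sum_range_le (c := f 0 + (f 1 + ∑' k, b k)) hf fun n => ?_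
  have hsub : Finset.range n ⊆ insert 0 (Finset.Ioc 0 (2 ^ n)) := by
    intro q hq
    rw [Finset.mem_range] at hq
    have := Nat.lt_two_pow_self (n := n)
    rw [Finset.mem_insert, Finset.mem_Ioc]
    omega
  refine (Finset.sum_le_sum_of_subset_of_nonneg hsub fun q _ _ => hf q).trans ?_
  rw [Finset.sum_insert (by simp), hS]
  have := hbs.sum_le_tsum (Finset.range n) fun k _ => hb0 k
  linarith

section SingularSeries

variable {s : ℕ}

/-- The absolute value of a summand of the singular series, before cancellation over `a`. -/
noncomputable def seriesAbs (M₁ M₂ : Matrix (Fin s) (Fin s) ℤ) (q : ℕ) : ℝ :=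
  ∑ a ∈ residues q, seriesTerm M₁ M₂ q a

lemma seriesAbs_nonneg (M₁ M₂ : Matrix (Fin s) (Fin s) ℤ) (q : ℕ) : 0 ≤ seriesAbs M₁ M₂ q :=
  Finset.sum_nonneg fun a _ => seriesTerm_nonneg M₁ M₂ q a

lemma norm_Dq_le (M₁ M₂ : Matrix (Fin s) (Fin s) ℤ) (q : ℕ) :
    (q : ℝ) ^ (-(s : ℤ)) * ‖Dq s M₁ M₂ q 0‖ ≤ seriesAbs M₁ M₂ q := by
  rw [Dq_zero_eq, _root_.zpow_neg, zpow_natCast, seriesAbs]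
  simp only [seriesTerm]
  rw [← Finset.mul_sum]
  exact mul_le_mul_of_nonneg_left (norm_sum_le _ _) (by positivity)

lemma Pencil.summable_seriesAbs {M₁ M₂ : Matrix (Fin s) (Fin s) ℤ}
    (D : Pencil s (2 • M₁) (2 • M₂)) (hs : 10 ≤ s) (hM₁ : M₁.IsSymm) (hM₂ : M₂.IsSymm) :
    Summable fun q : ℕ => (q : ℝ) ^ (1 / 5 : ℝ) * seriesAbs M₁ M₂ q := by
  obtain ⟨K, R₀, hK, hR₀, hblock⟩ := D.exists_block_bound hs hM₁ hM₂
  obtain ⟨k₀, hk₀⟩ := pow_unbounded_of_one_lt R₀ (one_lt_two : (1 : ℝ) < 2)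
  refine summable_of_dyadic_blocks (K := 2 ^ (1 / 5 : ℝ) * K) (ρ := 2 ^ (-(3 / 100) : ℝ)) (k₀ := k₀)
    (fun q => mul_nonneg (by positivity) (seriesAbs_nonneg _ _ _)) (by positivity)
    (Real.rpow_lt_one_of_one_lt_of_neg one_lt_two (by norm_num)) fun k hk => ?_
  have h1 := hblock (2 ^ (k + 1)) (hk₀.le.trans (pow_le_pow_right₀ one_le_two (by omega)))
    (((Finset.Ioc (2 ^ k) (2 ^ (k + 1))).sigma fun q => residues q).map
      ⟨fun x => (x.1, x.2), fun x y h => by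
        cases x; cases y; simp only [Prod.mk.injEq] at h; obtain ⟨rfl, rfl⟩ := h; rfl⟩) (by
      intro i hi
      rw [Finset.mem_map] at hi
      obtain ⟨x, hx, rfl⟩ := hi
      rw [Finset.mem_sigma, Finset.mem_Ioc] at hx
      refine ⟨?_, ?_, hx.2⟩
      · rw [pow_succ, mul_div_cancel_right₀ _ two_ne_zero]
        exact_mod_cast hx.1.1
      · exact_mod_cast hx.1.2)
  rw [Finset.sum_map, Finset.sum_sigma] at h1
  have h2 : ∀ q ∈ (Finset.Ioc (2 ^ k) (2 ^ (k + 1)) : Finset ℕ),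
      (q : ℝ) ^ (1 / 5 : ℝ) * seriesAbs M₁ M₂ q ≤
      ((2 : ℝ) ^ (k + 1)) ^ (1 / 5 : ℝ) * seriesAbs M₁ M₂ q := fun q hq => by
    refine mul_le_mul_of_nonneg_right ?_ (seriesAbs_nonneg _ _ _)
    refine Real.rpow_le_rpow (by positivity) ?_ (by norm_num)
    exact_mod_cast (Finset.mem_Ioc.mp hq).2
  refine (Finset.sum_le_sum h2).trans ?_
  rw [← Finset.mul_sum]
  refine (mul_le_mul_of_nonneg_left h1 (by positivity)).trans ?_
  have e1 : ((2 : ℝ) ^ (k + 1)) ^ (1 / 5 : ℝ) = 2 ^ (1 / 5 : ℝ) * 2 ^ ((k : ℝ) * (1 / 5)) := by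
    rw [← Real.rpow_natCast, ← Real.rpow_mul two_pos.le, ← Real.rpow_add two_pos]
    congr 1; push_cast; ring
  have e2 : ((2 : ℝ) ^ (k + 1)) ^ (-(23 / 100) : ℝ) ≤ 2 ^ ((k : ℝ) * (-(23 / 100))) := by
    rw [← Real.rpow_natCast, ← Real.rpow_mul two_pos.le]
    refine Real.rpow_le_rpow_of_exponent_le one_le_two ?_
    push_cast
    linarith
  have e3 : ((2 : ℝ) ^ (-(3 / 100) : ℝ)) ^ k =
      2 ^ ((k : ℝ) * (1 / 5)) * 2 ^ ((k : ℝ) * (-(23 / 100))) := by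
    rw [← Real.rpow_natCast, ← Real.rpow_mul two_pos.le, ← Real.rpow_add two_pos]
    congr 1; ring
  rw [e1, e3]
  calc _ ≤ 2 ^ (1 / 5 : ℝ) * 2 ^ ((k : ℝ) * (1 / 5)) * (K * 2 ^ ((k : ℝ) * (-(23 / 100)))) := by
        refine mul_le_mul_of_nonneg_left (mul_le_mul_of_nonneg_left e2 (by linarith))
          (by positivity)
    _ = _ := by ring

lemma seriesAbs_zero (M₁ M₂ : Matrix (Fin s) (Fin s) ℤ) : seriesAbs M₁ M₂ 0 = 0 := by
  simp [seriesAbs, residues]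

lemma seriesAbs_le_rpow_mul (M₁ M₂ : Matrix (Fin s) (Fin s) ℤ) (q : ℕ) :
    seriesAbs M₁ M₂ q ≤ (q : ℝ) ^ (1 / 5 : ℝ) * seriesAbs M₁ M₂ q := by
  rcases Nat.eq_zero_or_pos q with rfl | hq
  · simp [seriesAbs_zero]
  · exact le_mul_of_one_le_left (seriesAbs_nonneg _ _ _)
      (Real.one_le_rpow (by exact_mod_cast hq) (by norm_num))

end SingularSeries

section SingularIntegral

variable {s : ℕ}

lemma integrable_one_add_norm_pow_inv :
    Integrable (fun β : ℝ × ℝ => ((1 + ‖β‖) ^ 3)⁻¹) := by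
  have h := integrable_one_add_norm (E := ℝ × ℝ) (μ := volume) (r := 3) (by
    rw [Module.finrank_prod, Module.finrank_self]; norm_num)
  refine h.congr (Filter.Eventually.of_forall fun β => ?_)
  simp only
  rw [Real.rpow_neg (by positivity)]
  congr 1
  norm_cast

lemma continuous_singInt (M₁ M₂ : Matrix (Fin s) (Fin s) ℤ) {w : (Fin s → ℝ) → ℝ}
    (hw : Continuous w) (hwc : HasCompactSupport w) : Continuous (singInt M₁ M₂ w) := by
  unfold singInt
  refine continuous_of_dominated (bound := fun x => ‖w x‖) (fun β => ?_) (fun β => ?_)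
    (hw.norm.integrable_of_hasCompactSupport hwc.norm) (Filter.Eventually.of_forall fun x => ?_)
  · refine Continuous.aestronglyMeasurable ?_
    exact (Complex.continuous_ofReal.comp hw).mul ((contDiff_e2pi (n := 0)).continuous.comp
      (contDiff_phase (n := 0) M₁ M₂ β).continuous)
  · exact Filter.Eventually.of_forall fun x => by simp [norm_e2pi]
  · refine continuous_const.mul ((contDiff_e2pi (n := 0)).continuous.comp ?_)
    unfold phase
    fun_prop

end SingularIntegral

section Orthogonality

lemma setIntegral_e2pi_intCast_mul (η : ℝ) (n : ℤ) :
    ∫ t in Set.Ioc (-η) (1 - η), e2pi (t * n) = if n = 0 then 1 else 0 := by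
  rw [← intervalIntegral.integral_of_le (by linarith)]
  split_ifs with hn
  · subst hn
    simp [e2pi_zero]
  · have hc : (2 * π * Complex.I * n : ℂ) ≠ 0 :=
      mul_ne_zero Complex.two_pi_I_ne_zero (Int.cast_ne_zero.mpr hn)
    have h : ∀ t : ℝ, e2pi (t * n) = Complex.exp ((2 * π * Complex.I * n : ℂ) * t) := fun t => by
      unfold e2pi
      congr 1
      push_cast
      ring
    simp only [h]
    rw [integral_exp_mul_complex hc]
    have e : (2 * π * Complex.I * n : ℂ) * ((1 - η : ℝ) : ℂ) =
        (2 * π * Complex.I * n : ℂ) * ((-η : ℝ) : ℂ) + n * (2 * π * Complex.I) := by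
      push_cast; ring
    rw [e, Complex.exp_add, Complex.exp_int_mul_two_pi_mul_I, mul_one, sub_self, zero_div]

variable {s : ℕ}

lemma expSum_eq_sum (M₁ M₂ : Matrix (Fin s) (Fin s) ℤ) {w : (Fin s → ℝ) → ℝ} {ρ P : ℝ}
    (hP : 0 < P) (hρ : ∀ x, ρ < ‖x‖ → w x = 0) (α : ℝ × ℝ) :
    expSum M₁ M₂ w P α = ∑ x ∈ (finite_int_ball (s := s) (ρ * P)).toFinset,
      (w (P⁻¹ • realVec x) : ℂ) * e2pi (phase M₁ M₂ α (realVec x)) := by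
  refine (hasSum_int_ball fun x hx => ?_).tsum_eq
  rw [hρ _ (norm_inv_smul_gt hP hx), Complex.ofReal_zero, zero_mul]

lemma continuous_phase_left (M₁ M₂ : Matrix (Fin s) (Fin s) ℤ) (x : Fin s → ℝ) :
    Continuous fun α : ℝ × ℝ => e2pi (phase M₁ M₂ α x) := by
  refine (contDiff_e2pi (n := 0)).continuous.comp ?_
  unfold phase
  fun_prop

lemma continuous_expSum (M₁ M₂ : Matrix (Fin s) (Fin s) ℤ) {w : (Fin s → ℝ) → ℝ}
    (hwc : HasCompactSupport w) {P : ℝ} (hP : 0 < P) : Continuous (expSum M₁ M₂ w P) := by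
  obtain ⟨ρ, -, hρ⟩ := hwc.exists_ball
  rw [funext fun α => expSum_eq_sum M₁ M₂ hP hρ α]
  exact continuous_finsetSum _ fun x _ => continuous_const.mul (continuous_phase_left M₁ M₂ _)

/-- A fundamental domain for the torus. -/
def torusBox (η : ℝ) : Set (ℝ × ℝ) := Set.Ioc (-η) (1 - η) ×ˢ Set.Ioc (-η) (1 - η)

lemma measurableSet_torusBox (η : ℝ) : MeasurableSet (torusBox η) :=
  measurableSet_Ioc.prod measurableSet_Ioc

lemma volume_torusBox (η : ℝ) : volume (torusBox η) = 1 := by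
  rw [torusBox, Measure.volume_eq_prod, Measure.prod_prod, Real.volume_Ioc]
  norm_num

lemma integrableOn_torusBox {f : ℝ × ℝ → ℂ} (hf : Continuous f) (η : ℝ) :
    IntegrableOn f (torusBox η) :=
  (hf.continuousOn.integrableOn_compact (isCompact_Icc.prod isCompact_Icc)).mono_set
    (Set.prod_mono Set.Ioc_subset_Icc_self Set.Ioc_subset_Icc_self)

lemma setIntegral_e2pi_phase (M₁ M₂ : Matrix (Fin s) (Fin s) ℤ) (η : ℝ) (x : Fin s → ℤ) :
    ∫ α in torusBox η, e2pi (phase M₁ M₂ α (realVec x)) =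
      if quadEval M₁ x = 0 ∧ quadEval M₂ x = 0 then 1 else 0 := by
  have h : ∀ α : ℝ × ℝ, e2pi (phase M₁ M₂ α (realVec x)) =
      e2pi (α.1 * (quadEval M₁ x : ℤ)) * e2pi (α.2 * (quadEval M₂ x : ℤ)) := fun α => by
    rw [← e2pi_add]
    congr 1
    have e : realVec x = fun i => (x i : ℝ) := funext fun i => realVec_apply x i
    rw [phase, e, quadEval_intCast, quadEval_intCast]
  simp only [h]
  rw [torusBox, Measure.volume_eq_prod,
    setIntegral_prod_mul (fun t : ℝ => e2pi (t * (quadEval M₁ x : ℤ)))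
    (fun t : ℝ => e2pi (t * (quadEval M₂ x : ℤ))), setIntegral_e2pi_intCast_mul,
    setIntegral_e2pi_intCast_mul]
  split_ifs <;> simp_all

lemma setIntegral_expSum (M₁ M₂ : Matrix (Fin s) (Fin s) ℤ) {w : (Fin s → ℝ) → ℝ}
    (hwc : HasCompactSupport w) {P : ℝ} (hP : 0 < P) (η : ℝ) :
    ∫ α in torusBox η, expSum M₁ M₂ w P α =
      ∑' x : Fin s → ℤ, if quadEval M₁ x = 0 ∧ quadEval M₂ x = 0 then
        ((w (fun i => (x i : ℝ) / P) : ℝ) : ℂ) else 0 := by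
  obtain ⟨ρ, -, hρ⟩ := hwc.exists_ball
  have hw : ∀ x : Fin s → ℤ, w (fun i => (x i : ℝ) / P) = w (P⁻¹ • realVec x) := fun x => by
    congr 1
    ext i
    rw [Pi.smul_apply, realVec_apply, smul_eq_mul]
    ring
  have hsum := (hasSum_int_ball (R := ρ * P) (f := fun x : Fin s → ℤ =>
    if quadEval M₁ x = 0 ∧ quadEval M₂ x = 0 then
        ((w (fun i => (x i : ℝ) / P) : ℝ) : ℂ) else 0) fun x hx => by
      rw [hw, hρ _ (norm_inv_smul_gt hP hx), Complex.ofReal_zero, ite_self]).tsum_eq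
  rw [hsum]
  simp only [expSum_eq_sum M₁ M₂ hP hρ]
  have hi : ∀ x : Fin s → ℤ, IntegrableOn (fun α => (w (P⁻¹ • realVec x) : ℂ) *
      e2pi (phase M₁ M₂ α (realVec x))) (torusBox η) := fun x =>
    integrableOn_torusBox (continuous_const.mul (continuous_phase_left M₁ M₂ _)) η
  rw [integral_finsetSum _ fun x _ => hi x]
  refine Finset.sum_congr rfl fun x _ => ?_
  rw [integral_const_mul, setIntegral_e2pi_phase, hw]
  split_ifs <;> simp

end Orthogonality

section SingularIntegral

lemma integral_comp_smul_sub {E : Type*} [NormedAddCommGroup E] [NormedSpace ℝ E]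
    (f : ℝ × ℝ → E) (x : ℝ × ℝ) {t : ℝ} (ht : 0 < t) :
    ∫ α, f (t • (α - x)) = (t ^ 2)⁻¹ • ∫ β, f β := by
  rw [integral_sub_right_eq_self (fun α => f (t • α)) x, Measure.integral_comp_smul,
    Module.finrank_prod, Module.finrank_self, abs_of_pos (by positivity)]

lemma integrable_comp_smul_sub {E : Type*} [NormedAddCommGroup E] [NormedSpace ℝ E]
    {f : ℝ × ℝ → E} (hf : Integrable f) (x : ℝ × ℝ) {t : ℝ} (ht : 0 < t) :
    Integrable fun α => f (t • (α - x)) :=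
  ((integrable_comp_smul_iff volume f ht.ne').mpr hf).comp_sub_right x

/-- Truncation of an integral with decaying integrand to a ball. -/
lemma exists_truncation_bound {f : ℝ × ℝ → ℂ} (hf : Continuous f) {K : ℝ}
    (hK : ∀ β, ‖f β‖ ≤ K * ((1 + ‖β‖) ^ 4)⁻¹) : Integrable f ∧ ∃ K' : ℝ, 0 ≤ K' ∧
      ∀ (x : ℝ × ℝ) (t T : ℝ), 0 < t → 1 ≤ T →
        ‖(∫ α in Metric.closedBall x (T / t), f (t • (α - x))) - ((t ^ 2)⁻¹ : ℝ) * ∫ β, f β‖ ≤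
          K' * (t ^ 2)⁻¹ * T ^ (-(1 / 5) : ℝ) := by
  have hK0 : 0 ≤ K := by
    have := hK 0
    rw [norm_zero, add_zero, one_pow, inv_one, mul_one] at this
    exact (norm_nonneg _).trans this
  have h3 := integrable_one_add_norm_pow_inv
  have hpow : ∀ β : ℝ × ℝ,
      K * ((1 + ‖β‖) ^ 4)⁻¹ = K * (1 + ‖β‖)⁻¹ * ((1 + ‖β‖) ^ 3)⁻¹ := fun β => by
    have : 0 < 1 + ‖β‖ := by positivity
    field_simp
  have hfi : Integrable f := by
    refine (h3.const_mul K).mono' hf.aestronglyMeasurable (Filter.Eventually.of_forall fun β => ?_)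
    refine (hK β).trans ?_
    rw [hpow]
    refine mul_le_mul_of_nonneg_right ?_ (by positivity)
    exact mul_le_of_le_one_right hK0 (inv_le_one_of_one_le₀ (by linarith [norm_nonneg β]))
  have hc0 : 0 ≤ ∫ β : ℝ × ℝ, ((1 + ‖β‖) ^ 3)⁻¹ := integral_nonneg fun β => by positivity
  refine ⟨hfi, K * ∫ β : ℝ × ℝ, ((1 + ‖β‖) ^ 3)⁻¹, by positivity, fun x t T ht hT => ?_⟩
  have hT0 : 0 < T := by linarith
  have hInt := integrable_comp_smul_sub hfi x ht
  have hsplit := integral_add_compl (μ := volume) (s := Metric.closedBall x (T / t))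
    Metric.isClosed_closedBall.measurableSet hInt
  rw [integral_comp_smul_sub f x ht] at hsplit
  have e : (∫ α in Metric.closedBall x (T / t), f (t • (α - x))) - ((t ^ 2)⁻¹ : ℝ) * ∫ β, f β =
      - ∫ α in (Metric.closedBall x (T / t))ᶜ, f (t • (α - x)) := by
    rw [Complex.real_smul] at hsplit
    rw [← hsplit]
    ring
  rw [e, norm_neg]
  have hint3 := (integrable_comp_smul_sub h3 x ht).const_mul (K * T ^ (-(1 / 5) : ℝ))
  calc _ ≤ ∫ α in (Metric.closedBall x (T / t))ᶜ,
        K * T ^ (-(1 / 5) : ℝ) * ((1 + ‖t • (α - x)‖) ^ 3)⁻¹ := by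
        refine norm_integral_le_of_norm_le hint3.integrableOn ?_
        refine (ae_restrict_iff' Metric.isClosed_closedBall.measurableSet.compl).mpr
          (Filter.Eventually.of_forall fun α hα => ?_)
        rw [Set.mem_compl_iff, Metric.mem_closedBall, not_le, dist_eq_norm, div_lt_iff₀ ht] at hα
        refine (hK _).trans ?_
        rw [hpow]
        refine mul_le_mul_of_nonneg_right (mul_le_mul_of_nonneg_left ?_ hK0) (by positivity)
        have h1 : T ≤ 1 + ‖t • (α - x)‖ := by
          rw [norm_smul, Real.norm_of_nonneg ht.le]; linarith
        calc (1 + ‖t • (α - x)‖)⁻¹ ≤ T⁻¹ := inv_anti₀ hT0 h1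
          _ = T ^ (-1 : ℝ) := (Real.rpow_neg_one T).symm
          _ ≤ _ := Real.rpow_le_rpow_of_exponent_le hT (by norm_num)
    _ ≤ ∫ α, K * T ^ (-(1 / 5) : ℝ) * ((1 + ‖t • (α - x)‖) ^ 3)⁻¹ :=
        setIntegral_le_integral hint3 (Filter.Eventually.of_forall fun α => by positivity)
    _ = _ := by
        rw [integral_const_mul, integral_comp_smul_sub (fun β => ((1 + ‖β‖) ^ 3)⁻¹) x ht,
          smul_eq_mul]
        ring

end SingularIntegral

section Arcs

/-- Reduced fractions with denominator at most `Q`. -/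
noncomputable def arcIndex (Q : ℝ) : Finset (Σ _ : ℕ, ℕ × ℕ) :=
  (Finset.Icc 1 ⌊Q⌋₊).sigma fun q => residues q

/-- The rational point attached to a reduced fraction. -/
noncomputable def arcCenter (i : Σ _ : ℕ, ℕ × ℕ) : ℝ × ℝ := ((i.2.1 : ℝ) / i.1, (i.2.2 : ℝ) / i.1)

/-- The major arc attached to a reduced fraction. -/
def arc (P Q : ℝ) (i : Σ _ : ℕ, ℕ × ℕ) : Set (ℝ × ℝ) :=
  Metric.closedBall (arcCenter i) (Q / i.1 / P ^ 2)

lemma measurableSet_arc (P Q : ℝ) (i : Σ _ : ℕ, ℕ × ℕ) : MeasurableSet (arc P Q i) :=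
  Metric.isClosed_closedBall.measurableSet

lemma mem_arcIndex {Q : ℝ} (hQ : 0 ≤ Q) {i : Σ _ : ℕ, ℕ × ℕ} :
    i ∈ arcIndex Q ↔ 1 ≤ i.1 ∧ (i.1 : ℝ) ≤ Q ∧ i.2 ∈ residues i.1 := by
  rw [arcIndex, Finset.mem_sigma, Finset.mem_Icc, Nat.le_floor_iff hQ, and_assoc]

variable {P Q : ℝ}

lemma disjoint_arc (hQ : 1 ≤ Q) (hPQ : 4 * Q ^ 2 ≤ P ^ 2) {i j : Σ _ : ℕ, ℕ × ℕ}
    (hi : i ∈ arcIndex Q) (hj : j ∈ arcIndex Q) (hij : i ≠ j) :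
    Disjoint (arc P Q i) (arc P Q j) := by
  obtain ⟨hi1, hiQ, hir⟩ := (mem_arcIndex (by linarith)).mp hi
  obtain ⟨hj1, hjQ, hjr⟩ := (mem_arcIndex (by linarith)).mp hj
  have hi0 : (0 : ℝ) < i.1 := by exact_mod_cast hi1
  have hj0 : (0 : ℝ) < j.1 := by exact_mod_cast hj1
  refine Metric.closedBall_disjoint_closedBall ?_
  have hne : (i.1, i.2) ≠ (j.1, j.2) := fun h => by
    cases i; cases j
    simp only [Prod.mk.injEq] at h
    obtain ⟨rfl, rfl⟩ := h
    exact hij rfl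
  have h1 := one_div_le_norm_sub_of_ne hi1 hj1 hir hjr hne
  rw [dist_eq_norm]
  refine lt_of_lt_of_le ?_ h1
  have hP : 0 < P ^ 2 := by nlinarith
  have e : Q / i.1 / P ^ 2 + Q / j.1 / P ^ 2 = (Q * (i.1 + j.1) / P ^ 2) / (i.1 * j.1) := by
    field_simp
    ring
  rw [e]
  refine div_lt_div_of_pos_right ?_ (by positivity)
  rw [div_lt_one hP]
  nlinarith

lemma div_div_sq_le (hQ : 1 ≤ Q) (hPQ : 4 * Q ^ 2 ≤ P ^ 2) {q : ℕ} (hq : 1 ≤ q)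
    (hqQ : (q : ℝ) ≤ Q) : Q / q / P ^ 2 ≤ 1 / (4 * Q) ∧ Q / q / P ^ 2 ≤ 1 / (4 * q) := by
  have hq0 : (0 : ℝ) < q := by exact_mod_cast hq
  have hq1 : (1 : ℝ) ≤ q := by exact_mod_cast hq
  have hP : 0 < P ^ 2 := by nlinarith
  rw [div_div, div_le_div_iff₀ (by positivity) (by positivity),
    div_le_div_iff₀ (by positivity) (by positivity)]
  constructor
  · nlinarith
  · nlinarith [mul_le_mul_of_nonneg_left hPQ hq0.le, mul_le_mul_of_nonneg_left hQ hq0.le]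

lemma arc_subset_torusBox (hQ : 1 ≤ Q) (hPQ : 4 * Q ^ 2 ≤ P ^ 2) {i : Σ _ : ℕ, ℕ × ℕ}
    (hi : i ∈ arcIndex Q) : arc P Q i ⊆ torusBox (1 / (2 * Q)) := by
  obtain ⟨hi1, hiQ, hir⟩ := (mem_arcIndex (by linarith)).mp hi
  have hi0 : (0 : ℝ) < i.1 := by exact_mod_cast hi1
  have hQ0 : 0 < Q := by linarith
  obtain ⟨h1, h2⟩ := div_div_sq_le hQ hPQ hi1 hiQ
  have e1 : 1 / (2 * Q) = 2 * (1 / (4 * Q)) := by field_simp; norm_num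
  have e2 : (0 : ℝ) < 1 / (4 * Q) := by positivity
  have e3 : 1 / (4 * Q) ≤ 1 / (4 * (i.1 : ℝ)) :=
    one_div_le_one_div_of_le (by positivity) (by linarith)
  have e4 : (1 : ℝ) / i.1 = 4 * (1 / (4 * i.1)) := by field_simp
  have key : ∀ (m : ℕ) (t : ℝ), m < i.1 → |t - m / i.1| ≤ Q / i.1 / P ^ 2 →
      t ∈ Set.Ioc (-(1 / (2 * Q))) (1 - 1 / (2 * Q)) := by
    intro m t hm ht
    obtain ⟨h3, h4⟩ := abs_le.mp ht
    have h5 : (0 : ℝ) ≤ m / i.1 := by positivity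
    have h6 : (m : ℝ) / i.1 ≤ 1 - 1 / i.1 := by
      rw [le_sub_iff_add_le, ← add_div, div_le_one hi0]
      exact_mod_cast hm
    constructor <;> linarith
  intro α hα
  rw [arc, Metric.mem_closedBall, dist_eq_norm, Prod.norm_def] at hα
  obtain ⟨hm, hn, -⟩ := mem_residues.mp hir
  exact ⟨key _ _ hm ((le_max_left _ _).trans hα), key _ _ hn ((le_max_right _ _).trans hα)⟩

lemma exists_mem_arc (hQ : 1 ≤ Q) (hPQ : 4 * Q ^ 2 ≤ P ^ 2) {α : ℝ × ℝ}
    (hα : α ∈ torusBox (1 / (2 * Q))) {q : ℕ} {b₁ b₂ : ℤ} (hq : 1 ≤ q) (hqQ : (q : ℝ) ≤ Q)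
    (hgcd : Int.gcd (Int.gcd b₁ b₂) q = 1)
    (h : ‖α - ((b₁ : ℝ) / q, (b₂ : ℝ) / q)‖ ≤ Q / q / P ^ 2) :
    ∃ i ∈ arcIndex Q, α ∈ arc P Q i := by
  have hq0 : (0 : ℝ) < q := by exact_mod_cast hq
  have hQ0 : 0 < Q := by linarith
  obtain ⟨h1, h2⟩ := div_div_sq_le hQ hPQ hq hqQ
  have e1 : 1 / (2 * Q) = 2 * (1 / (4 * Q)) := by field_simp; norm_num
  have e2 : (0 : ℝ) < 1 / (4 * Q) := by positivity
  have e3 : 1 / (4 * Q) ≤ 1 / (4 * (q : ℝ)) :=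
    one_div_le_one_div_of_le (by positivity) (by linarith)
  have e4 : (1 : ℝ) / q = 4 * (1 / (4 * q)) := by field_simp
  have key : ∀ (b : ℤ) (t : ℝ), t ∈ Set.Ioc (-(1 / (2 * Q))) (1 - 1 / (2 * Q)) →
      |t - b / q| ≤ Q / q / P ^ 2 → ∃ m : ℕ, b = m ∧ m < q := by
    intro b t ht hb
    obtain ⟨h3, h4⟩ := abs_le.mp hb
    have h5 : (-1 : ℝ) < b := by
      have : (-1 : ℝ) / q < b / q := by rw [neg_div]; linarith [ht.1]
      exact (div_lt_div_iff_of_pos_right hq0).mp this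
    have h6 : (b : ℝ) < q := by
      rw [← div_lt_one hq0]; linarith [ht.2]
    have h5' : -1 < b := by exact_mod_cast h5
    have h6' : b < q := by exact_mod_cast h6
    exact ⟨b.toNat, by omega, by omega⟩
  rw [Prod.norm_def] at h
  obtain ⟨m, rfl, hm⟩ := key b₁ α.1 hα.1 ((le_max_left _ _).trans h)
  obtain ⟨n, rfl, hn⟩ := key b₂ α.2 hα.2 ((le_max_right _ _).trans h)
  rw [Int.gcd_natCast_natCast, Int.gcd_natCast_natCast] at hgcd
  refine ⟨⟨q, (m, n)⟩, (mem_arcIndex hQ0.le).mpr ⟨hq, hqQ, mem_residues.mpr ⟨hm, hn, hgcd⟩⟩, ?_⟩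
  rw [arc, Metric.mem_closedBall, dist_eq_norm, Prod.norm_def]
  simpa [arcCenter] using h

end Arcs

section MinorArcs

variable {s : ℕ}

/-- The union of the major arcs. -/
def majorArcs (P Q : ℝ) : Set (ℝ × ℝ) := ⋃ i ∈ arcIndex Q, arc P Q i

lemma measurableSet_majorArcs (P Q : ℝ) : MeasurableSet (majorArcs P Q) :=
  Finset.measurableSet_biUnion _ fun i _ => measurableSet_arc P Q i

lemma torusBox_subset_ball {η : ℝ} (hη : 0 ≤ η) (hη1 : η ≤ 1) :
    torusBox η ⊆ {α : ℝ × ℝ | ‖α‖ ≤ 2} := fun α hα => by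
  change ‖α‖ ≤ 2
  rw [Prod.norm_def]
  refine max_le (abs_le.mpr ?_) (abs_le.mpr ?_)
  · constructor <;> linarith [hα.1.1, hα.1.2]
  · constructor <;> linarith [hα.2.1, hα.2.2]

lemma Pencil.exists_minor_arc_bound {M₁ M₂ : Matrix (Fin s) (Fin s) ℤ}
    (D : Pencil s (2 • M₁) (2 • M₂)) (hs : 10 ≤ s) (hM₁ : M₁.IsSymm) (hM₂ : M₂.IsSymm)
    {w : (Fin s → ℝ) → ℝ} (hw : ContDiff ℝ (⊤ : ℕ∞) w) (hwc : HasCompactSupport w) :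
    ∃ K C : ℝ, 0 ≤ K ∧ 1 ≤ C ∧ ∀ P Q : ℝ, 1 ≤ P → C ≤ Q → 4 * Q ^ 2 ≤ P ^ 2 →
      Q = P ^ (9 / 10 : ℝ) →
      ‖∫ α in torusBox (1 / (2 * Q)) \ majorArcs P Q, expSum M₁ M₂ w P α‖ ≤
        K * P ^ ((s : ℝ) - 4 - 1 / 6) := by
  obtain ⟨c, C₀, C, hc, hc2, hC₀, hC, hdist⟩ := D.exists_weylSet_distribution (by omega)
  obtain ⟨K, hK, hlevel⟩ := exists_lintegral_level_le hs (2 • M₁) (2 • M₂) hC₀ hC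
    (fun P Z h1 h2 => (hdist P Z h1 h2).1)
  obtain ⟨G, hG, hweyl⟩ := exists_weyl_inequality (by omega) hM₁ hM₂ hw hwc hc (by linarith)
  set e : ℝ := ((s : ℝ) - 1) / 2 - 4 with he
  refine ⟨√G * K * C ^ (e / 2), C, by positivity, hC, fun P Q hP hCQ hPQ hQP => ?_⟩
  have hP0 : 0 < P := by linarith
  have hQ1 : 1 ≤ Q := hC.trans hCQ
  have hQ0 : 0 < Q := by linarith
  have hQleP : 2 * Q ≤ P := abs_le_of_sq_le_sq' (by nlinarith) hP0.le |>.2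
  set Z := √(C * P ^ 2 / Q) with hZ
  have hZ2 : Z ^ 2 = C * P ^ 2 / Q := Real.sq_sqrt (by positivity)
  have hZ0 : 0 < Z := Real.sqrt_pos.mpr (by positivity)
  have hZ2C : C * P ≤ Z ^ 2 := by
    rw [hZ2, le_div_iff₀ hQ0]
    have : 0 ≤ C * P := by positivity
    nlinarith
  have hZ1 : 1 ≤ Z := by
    refine Real.le_sqrt_of_sq_le ?_
    rw [← hZ2]
    nlinarith
  have hZP : Z ≤ P := by
    refine Real.sqrt_le_iff.mpr ⟨hP0.le, ?_⟩
    rw [div_le_iff₀ hQ0]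
    nlinarith [sq_nonneg P]
  have hZ3 : C * P ≤ Z ^ 3 := by
    refine hZ2C.trans ?_
    exact pow_le_pow_right₀ hZ1 (by norm_num)
  set A := torusBox (1 / (2 * Q)) \ majorArcs P Q with hA
  have hAm : MeasurableSet A := (measurableSet_torusBox _).diff (measurableSet_majorArcs P Q)
  have hA2 : A ⊆ {α : ℝ × ℝ | ‖α‖ ≤ 2} := Set.sdiff_subset.trans
    (torusBox_subset_ball (by positivity) (by
      rw [div_le_one (by positivity)]; linarith))
  have hsmall : ∀ α ∈ A, ((weylSet (2 • M₁) (2 • M₂) c P α).ncard : ℝ) ≤ C₀ * P * Z ^ (s - 1) := by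
    intro α hα
    by_contra! hcon
    obtain ⟨q, b₁, b₂, hq, hqC, hgcd, hb⟩ := (hdist P Z hZ1 hZP).2.1 α hZ3 hcon.le
    have e1 : C * (P / Z) ^ 2 = Q := by
      rw [div_pow, hZ2]; field_simp
    have e2 : C / (q * Z ^ 2) = Q / q / P ^ 2 := by
      have : (0 : ℝ) < q := by exact_mod_cast hq
      rw [hZ2]; field_simp
    rw [e1] at hqC
    rw [e2] at hb
    obtain ⟨i, hi, hiα⟩ := exists_mem_arc hQ1 hPQ hα.1 hq hqC hgcd hb
    exact hα.2 (Set.mem_biUnion hi hiα)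
  have hScont := continuous_expSum M₁ M₂ hwc hP0
  set F : ℝ := √(G * P ^ s) with hF
  have hF0 : 0 < F := Real.sqrt_pos.mpr (by positivity)
  have hSN : ∀ α, ‖expSum M₁ M₂ w P α‖ / F ≤ √(weylSet (2 • M₁) (2 • M₂) c P α).ncard := by
    intro α
    rw [div_le_iff₀ hF0, hF, ← Real.sqrt_mul (by positivity)]
    refine Real.le_sqrt_of_sq_le ((hweyl P hP α).trans (le_of_eq (by ring)))
  set g : ℝ × ℝ → ENNReal :=
    A.indicator fun α => ENNReal.ofReal (‖expSum M₁ M₂ w P α‖ / F) with hg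
  have hgm : Measurable g :=
    (ENNReal.measurable_ofReal.comp (hScont.norm.div_const F).measurable).indicator hAm
  have hInt := hlevel P Z hZ1 hZP g hgm (fun α _ => by
    by_cases hα : α ∈ A
    · rw [hg, Set.indicator_of_mem hα]
      exact ENNReal.ofReal_le_ofReal (hSN α)
    · rw [hg, Set.indicator_of_notMem hα]; exact zero_le) (fun α _ => by
    by_cases hα : α ∈ A
    · rw [hg, Set.indicator_of_mem hα]
      exact ENNReal.ofReal_le_ofReal ((hSN α).trans (Real.sqrt_le_sqrt (hsmall α hα)))
    · rw [hg, Set.indicator_of_notMem hα]; exact zero_le)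
  rw [hg, lintegral_indicator hAm, Measure.restrict_restrict hAm, Set.inter_eq_left.mpr hA2] at hInt
  have hSi : IntegrableOn (expSum M₁ M₂ w P) A :=
    (integrableOn_torusBox hScont _).mono_set Set.sdiff_subset
  have h1 : (∫ α in A, ‖expSum M₁ M₂ w P α‖ / F) ≤ K * P ^ (13 / 25 : ℝ) * Z ^ e := by
    rw [← ofReal_integral_eq_lintegral_ofReal (hSi.norm.div_const F)
      (Filter.Eventually.of_forall fun α => by positivity)] at hInt
    exact (ENNReal.ofReal_le_ofReal_iff (by positivity)).mp hInt
  rw [integral_div, div_le_iff₀ hF0] at h1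
  refine (norm_integral_le_integral_norm _).trans (h1.trans ?_)
  have hFe : F = √G * P ^ ((s : ℝ) / 2) := by
    rw [hF, Real.sqrt_mul (by linarith), Real.sqrt_eq_rpow (P ^ s), ← Real.rpow_natCast,
      ← Real.rpow_mul hP0.le]
    congr 2; ring
  have hZe : Z ^ e = C ^ (e / 2) * P ^ (11 / 10 * (e / 2)) := by
    have e1 : C * P ^ 2 / Q = C * P ^ (11 / 10 : ℝ) := by
      rw [hQP, mul_div_assoc, ← Real.rpow_natCast, ← Real.rpow_sub hP0]
      norm_num
    rw [hZ, e1, Real.sqrt_eq_rpow, ← Real.rpow_mul (by positivity),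
      Real.mul_rpow (by linarith) (by positivity), ← Real.rpow_mul hP0.le]
    congr 2 <;> ring
  rw [hFe, hZe]
  calc _ = √G * K * C ^ (e / 2) *
        (P ^ (13 / 25 : ℝ) * P ^ (11 / 10 * (e / 2)) * P ^ ((s : ℝ) / 2)) := by ring
    _ ≤ _ := by
      refine mul_le_mul_of_nonneg_left ?_ (by positivity)
      rw [← Real.rpow_add hP0, ← Real.rpow_add hP0]
      refine Real.rpow_le_rpow_of_exponent_le hP ?_
      have : (10 : ℝ) ≤ s := by exact_mod_cast hs
      rw [he]
      linarith

end MinorArcs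

section MajorArcs

variable {s : ℕ}

/-- The integral of the exponential sum over a single major arc. -/
lemma Pencil.exists_arc_integral_bound {M₁ M₂ : Matrix (Fin s) (Fin s) ℤ}
    (D : Pencil s (2 • M₁) (2 • M₂)) (hs : 10 ≤ s) (hM₁ : M₁.IsSymm) (hM₂ : M₂.IsSymm)
    {w : (Fin s → ℝ) → ℝ} (hw : ContDiff ℝ (⊤ : ℕ∞) w) (hwc : HasCompactSupport w) (L : ℕ) :
    ∃ C K : ℝ, 0 ≤ C ∧ 0 ≤ K ∧ ∀ (P Q : ℝ) (i : Σ _ : ℕ, ℕ × ℕ), 1 ≤ Q → Q ≤ P → i ∈ arcIndex Q →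
      ‖(∫ α in arc P Q i, expSum M₁ M₂ w P α) -
        ((P ^ s * ((i.1 : ℝ) ^ s)⁻¹ : ℝ) : ℂ) * gaussSum2 M₁ M₂ i.1 i.2 *
          (((P ^ 4)⁻¹ : ℝ) * ∫ β, singInt M₁ M₂ w β)‖ ≤
        C * P ^ s * (2 * Q / P) ^ (L + 1) * volume.real (arc P Q i) +
          K * (P ^ s * (P ^ 4)⁻¹) * Q ^ (-(1 / 5) : ℝ) *
            ((i.1 : ℝ) ^ (1 / 5 : ℝ) * seriesTerm M₁ M₂ i.1 i.2) := by
  obtain ⟨C, hC, happrox⟩ := exists_expSum_approx M₁ M₂ hw hwc L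
  obtain ⟨K₀, hK₀, hdecay⟩ := D.exists_singInt_le hs hM₁ hM₂ hw hwc
  have hcont := continuous_singInt M₁ M₂ hw.continuous hwc
  obtain ⟨-, K, hK, htrunc⟩ := exists_truncation_bound hcont hdecay
  refine ⟨C, K, hC, hK, fun P Q i hQ hQP hi => ?_⟩
  obtain ⟨hq1, hqQ, -⟩ := (mem_arcIndex (by linarith)).mp hi
  have hq0 : (0 : ℝ) < i.1 := by exact_mod_cast hq1
  have hP : 0 < P := by linarith
  have hQ0 : 0 < Q := by linarith
  set A : ℂ := ((P ^ s * ((i.1 : ℝ) ^ s)⁻¹ : ℝ) : ℂ) * gaussSum2 M₁ M₂ i.1 i.2 with hA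
  set S : ℝ × ℝ → ℂ := expSum M₁ M₂ w P with hS
  set I : ℝ × ℝ → ℂ := fun α => singInt M₁ M₂ w (P ^ 2 • (α - arcCenter i)) with hI
  have hIc : Continuous I := by rw [hI]; fun_prop
  have hSc : Continuous S := continuous_expSum M₁ M₂ hwc hP
  have hcomp : IsCompact (arc P Q i) := isCompact_closedBall _ _
  have hSi : IntegrableOn S (arc P Q i) := hSc.continuousOn.integrableOn_compact hcomp
  have hIi : IntegrableOn (fun α => A * I α) (arc P Q i) :=
    (continuous_const.mul hIc).continuousOn.integrableOn_compact hcomp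
  have hlocal : ‖∫ α in arc P Q i, (S α - A * I α)‖ ≤
      C * P ^ s * (2 * Q / P) ^ (L + 1) * volume.real (arc P Q i) := by
    refine norm_setIntegral_le_of_norm_le_const hcomp.measure_lt_top fun α hα => ?_
    have h := happrox P i.1 i.2 (α - arcCenter i) hq1 (hqQ.trans hQP)
    rw [show ((i.2.1 : ℝ) / i.1, (i.2.2 : ℝ) / i.1) + (α - arcCenter i) = α from
      add_sub_cancel (arcCenter i) α] at h
    refine h.trans ?_
    have hr : ‖α - arcCenter i‖ ≤ Q / i.1 / P ^ 2 := by
      rw [← dist_eq_norm]; exact hα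
    gcongr C * P ^ s * ?_ ^ (L + 1)
    calc (i.1 : ℝ) / P * (1 + P ^ 2 * ‖α - arcCenter i‖)
        ≤ (i.1 : ℝ) / P * (1 + P ^ 2 * (Q / i.1 / P ^ 2)) := by gcongr
      _ = ((i.1 : ℝ) + Q) / P := by field_simp
      _ ≤ 2 * Q / P := by gcongr; linarith
  have hT : 1 ≤ Q / (i.1 : ℝ) := by rwa [le_div_iff₀ hq0, one_mul]
  have hmain := htrunc (arcCenter i) (P ^ 2) (Q / i.1) (by positivity) hT
  rw [show (P ^ 2) ^ 2 = P ^ 4 by ring] at hmain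
  have hnA : ‖A‖ = P ^ s * seriesTerm M₁ M₂ i.1 i.2 := by
    rw [hA, norm_mul, Complex.norm_real, Real.norm_of_nonneg (by positivity), seriesTerm, mul_assoc]
  have hpow : (Q / (i.1 : ℝ)) ^ (-(1 / 5) : ℝ) = Q ^ (-(1 / 5) : ℝ) * (i.1 : ℝ) ^ (1 / 5 : ℝ) := by
    rw [Real.div_rpow hQ0.le hq0.le, Real.rpow_neg hq0.le, div_inv_eq_mul]
  have hsplit : (∫ α in arc P Q i, S α) - A * (((P ^ 4)⁻¹ : ℝ) * ∫ β, singInt M₁ M₂ w β) =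
      (∫ α in arc P Q i, (S α - A * I α)) +
        A * ((∫ α in arc P Q i, I α) - ((P ^ 4)⁻¹ : ℝ) * ∫ β, singInt M₁ M₂ w β) := by
    rw [integral_sub hSi hIi, integral_const_mul]
    ring
  rw [hsplit]
  refine (norm_add_le _ _).trans (add_le_add hlocal ?_)
  rw [norm_mul, hnA]
  calc _ ≤ P ^ s * seriesTerm M₁ M₂ i.1 i.2 * (K * (P ^ 4)⁻¹ * (Q / i.1) ^ (-(1 / 5) : ℝ)) :=
        mul_le_mul_of_nonneg_left hmain (mul_nonneg (by positivity) (seriesTerm_nonneg _ _ _ _))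
    _ = _ := by rw [hpow]; ring

/-- The partial sums of a series with weighted absolute convergence. -/
lemma norm_tsum_sub_sum_Icc_le {f : ℕ → ℂ} {g : ℕ → ℝ} (hfg : ∀ q, ‖f q‖ ≤ g q) (hf0 : f 0 = 0)
    {δ : ℝ} (hδ : 0 < δ) (hg : Summable fun q : ℕ => (q : ℝ) ^ δ * g q) {Q : ℝ} (hQ : 1 ≤ Q) :
    ‖∑' q, f q - ∑ q ∈ Finset.Icc 1 ⌊Q⌋₊, f q‖ ≤ Q ^ (-δ) * ∑' q : ℕ, (q : ℝ) ^ δ * g q := by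
  have hQ0 : 0 < Q := by linarith
  have hg0 : ∀ q, 0 ≤ g q := fun q => (norm_nonneg _).trans (hfg q)
  have hle : ∀ q, ‖f q‖ ≤ (q : ℝ) ^ δ * g q := fun q => by
    rcases Nat.eq_zero_or_pos q with rfl | hq
    · rw [hf0, norm_zero]
      exact mul_nonneg (by positivity) (hg0 _)
    · refine (hfg q).trans (le_mul_of_one_le_left (hg0 q) ?_)
      exact Real.one_le_rpow (by exact_mod_cast hq) hδ.le
  have hfs : Summable f := Summable.of_norm_bounded hg hle
  have hsum : HasSum (fun q => f q - if q ∈ Finset.Icc 1 ⌊Q⌋₊ then f q else 0)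
      (∑' q, f q - ∑ q ∈ Finset.Icc 1 ⌊Q⌋₊, f q) := by
    refine hfs.hasSum.sub ?_
    have h : HasSum (fun q => if q ∈ Finset.Icc 1 ⌊Q⌋₊ then f q else 0)
        (∑ q ∈ Finset.Icc 1 ⌊Q⌋₊, if q ∈ Finset.Icc 1 ⌊Q⌋₊ then f q else 0) :=
      hasSum_sum_of_ne_finset_zero fun q hq => by rw [if_neg hq]
    rwa [Finset.sum_congr rfl fun q hq => if_pos hq] at h
  refine hsum.norm_le_of_bounded (hg.hasSum.mul_left (Q ^ (-δ))) fun q => ?_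
  have hR : 0 ≤ Q ^ (-δ) * ((q : ℝ) ^ δ * g q) :=
    mul_nonneg (by positivity) (mul_nonneg (by positivity) (hg0 q))
  split_ifs with hq
  · rwa [sub_self, norm_zero]
  rw [sub_zero]
  rcases Nat.eq_zero_or_pos q with rfl | hq0
  · rwa [hf0, norm_zero]
  refine (hfg q).trans ?_
  rw [← mul_assoc]
  refine le_mul_of_one_le_left (hg0 q) ?_
  have hQq : Q < q := by
    rw [Finset.mem_Icc, not_and, not_le] at hq
    exact (Nat.floor_lt hQ0.le).mp (hq hq0)
  rw [Real.rpow_neg hQ0.le, inv_mul_eq_div, one_le_div (by positivity)]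
  exact Real.rpow_le_rpow hQ0.le hQq.le hδ.le

lemma sum_volume_arc_le {P Q : ℝ} (hQ : 1 ≤ Q) (hPQ : 4 * Q ^ 2 ≤ P ^ 2) :
    ∑ i ∈ arcIndex Q, volume.real (arc P Q i) ≤ 1 := by
  have hfin : ∀ i, volume (arc P Q i) ≠ ⊤ := fun i =>
    (isCompact_closedBall _ _ : IsCompact (arc P Q i)).measure_lt_top.ne
  have hdisj : Set.PairwiseDisjoint ((arcIndex Q : Finset _) : Set (Σ _ : ℕ, ℕ × ℕ)) (arc P Q) :=
    fun i hi j hj hij => disjoint_arc hQ hPQ hi hj hij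
  have h := measure_biUnion_finset (μ := volume) hdisj fun i _ => measurableSet_arc P Q i
  have hle : volume (⋃ i ∈ arcIndex Q, arc P Q i) ≤ 1 := by
    rw [← volume_torusBox (1 / (2 * Q))]
    exact measure_mono (Set.iUnion₂_subset fun i hi => arc_subset_torusBox hQ hPQ hi)
  rw [h] at hle
  have := ENNReal.toReal_mono ENNReal.one_ne_top hle
  rwa [ENNReal.toReal_sum fun i _ => hfin i, ENNReal.toReal_one] at this

lemma majorArcs_subset_torusBox {P Q : ℝ} (hQ : 1 ≤ Q) (hPQ : 4 * Q ^ 2 ≤ P ^ 2) :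
    majorArcs P Q ⊆ torusBox (1 / (2 * Q)) :=
  Set.iUnion₂_subset fun _ hi => arc_subset_torusBox hQ hPQ hi

/-- The contribution of the major arcs. -/
lemma Pencil.exists_major_arcs_bound {M₁ M₂ : Matrix (Fin s) (Fin s) ℤ}
    (D : Pencil s (2 • M₁) (2 • M₂)) (hs : 10 ≤ s) (hM₁ : M₁.IsSymm) (hM₂ : M₂.IsSymm)
    {w : (Fin s → ℝ) → ℝ} (hw : ContDiff ℝ (⊤ : ℕ∞) w) (hwc : HasCompactSupport w) (L : ℕ) :
    ∃ C K : ℝ, 0 ≤ C ∧ 0 ≤ K ∧ ∀ P Q : ℝ, 1 ≤ Q → 4 * Q ^ 2 ≤ P ^ 2 → Q ≤ P →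
      ‖(∫ α in majorArcs P Q, expSum M₁ M₂ w P α) -
        (∑' q : ℕ, ((q : ℂ) ^ (-(s : ℤ))) * Dq s M₁ M₂ q 0) * (∫ β, singInt M₁ M₂ w β) *
          ((P ^ s * (P ^ 4)⁻¹ : ℝ) : ℂ)‖ ≤
        C * P ^ s * (2 * Q / P) ^ (L + 1) +
          K * (P ^ s * (P ^ 4)⁻¹) * Q ^ (-(1 / 5) : ℝ) := by
  obtain ⟨C, K, hC, hK, harc⟩ := D.exists_arc_integral_bound hs hM₁ hM₂ hw hwc L
  have hsum := D.summable_seriesAbs hs hM₁ hM₂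
  set G : ℝ := ∑' q : ℕ, (q : ℝ) ^ (1 / 5 : ℝ) * seriesAbs M₁ M₂ q with hG
  have hterm : ∀ q : ℕ, 0 ≤ (q : ℝ) ^ (1 / 5 : ℝ) * seriesAbs M₁ M₂ q := fun q =>
    mul_nonneg (by positivity) (seriesAbs_nonneg _ _ _)
  have hG0 : 0 ≤ G := tsum_nonneg hterm
  set J : ℂ := ∫ β, singInt M₁ M₂ w β with hJ
  refine ⟨C, K * G + G * ‖J‖, hC, by positivity, fun P Q hQ hPQ hQP => ?_⟩
  have hP : 0 < P := by linarith
  set f : ℕ → ℂ := fun q => ((q : ℂ) ^ (-(s : ℤ))) * Dq s M₁ M₂ q 0 with hf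
  set V : ℝ := P ^ s * (P ^ 4)⁻¹ with hV
  have hV0 : 0 ≤ V := by positivity
  have hdisj : Set.Pairwise ((arcIndex Q : Finset _) : Set (Σ _ : ℕ, ℕ × ℕ))
      (Function.onFun Disjoint (arc P Q)) := fun i hi j hj hij => disjoint_arc hQ hPQ hi hj hij
  have hInt : (∫ α in majorArcs P Q, expSum M₁ M₂ w P α) =
      ∑ i ∈ arcIndex Q, ∫ α in arc P Q i, expSum M₁ M₂ w P α :=
    integral_biUnion_finset _ (fun i _ => measurableSet_arc P Q i) hdisj fun i _ =>
      (continuous_expSum M₁ M₂ hwc hP).continuousOn.integrableOn_compact (isCompact_closedBall _ _)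
  have hmain : ∑ i ∈ arcIndex Q, ((P ^ s * ((i.1 : ℝ) ^ s)⁻¹ : ℝ) : ℂ) *
      gaussSum2 M₁ M₂ i.1 i.2 * (((P ^ 4)⁻¹ : ℝ) * J) =
      (∑ q ∈ Finset.Icc 1 ⌊Q⌋₊, f q) * J * (V : ℂ) := by
    rw [arcIndex, Finset.sum_sigma, Finset.sum_mul, Finset.sum_mul]
    refine Finset.sum_congr rfl fun q _ => ?_
    rw [hf]
    simp only
    rw [Dq_zero_eq, _root_.zpow_neg, zpow_natCast, ← Finset.sum_mul, ← Finset.mul_sum, hV]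
    push_cast
    ring
  have htail : ‖(∑ q ∈ Finset.Icc 1 ⌊Q⌋₊, f q) - ∑' q, f q‖ ≤ Q ^ (-(1 / 5) : ℝ) * G := by
    rw [norm_sub_rev]
    refine norm_tsum_sub_sum_Icc_le (g := seriesAbs M₁ M₂) (fun q => ?_) ?_ (by norm_num) hsum hQ
    · refine le_of_eq_of_le ?_ (norm_Dq_le M₁ M₂ q)
      rw [hf]
      simp only
      rw [norm_mul, norm_zpow, Complex.norm_natCast]
    · rw [hf]
      simp only
      rw [Nat.cast_zero, _root_.zero_zpow _ (by omega), zero_mul]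
  have hsplit : (∫ α in majorArcs P Q, expSum M₁ M₂ w P α) - (∑' q, f q) * J * (V : ℂ) =
      ∑ i ∈ arcIndex Q, ((∫ α in arc P Q i, expSum M₁ M₂ w P α) -
        ((P ^ s * ((i.1 : ℝ) ^ s)⁻¹ : ℝ) : ℂ) * gaussSum2 M₁ M₂ i.1 i.2 * (((P ^ 4)⁻¹ : ℝ) * J)) +
      ((∑ q ∈ Finset.Icc 1 ⌊Q⌋₊, f q) - ∑' q, f q) * J * (V : ℂ) := by
    rw [Finset.sum_sub_distrib, hmain, hInt]
    ring
  rw [hsplit]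
  have h1 : ‖∑ i ∈ arcIndex Q, ((∫ α in arc P Q i, expSum M₁ M₂ w P α) -
        ((P ^ s * ((i.1 : ℝ) ^ s)⁻¹ : ℝ) : ℂ) * gaussSum2 M₁ M₂ i.1 i.2 *
          (((P ^ 4)⁻¹ : ℝ) * J))‖ ≤
      C * P ^ s * (2 * Q / P) ^ (L + 1) + K * V * Q ^ (-(1 / 5) : ℝ) * G := by
    refine (norm_sum_le _ _).trans ((Finset.sum_le_sum fun i hi => harc P Q i hQ hQP hi).trans ?_)
    rw [Finset.sum_add_distrib, ← Finset.mul_sum, ← Finset.mul_sum]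
    refine add_le_add (mul_le_of_le_one_right (by positivity) (sum_volume_arc_le hQ hPQ))
      (mul_le_mul_of_nonneg_left ?_ (by positivity))
    rw [arcIndex, Finset.sum_sigma]
    refine le_of_eq_of_le (Finset.sum_congr rfl fun q _ => ?_)
      (hsum.sum_le_tsum (Finset.Icc 1 ⌊Q⌋₊) fun q _ => hterm q)
    rw [seriesAbs, Finset.mul_sum]
  have h2 : ‖((∑ q ∈ Finset.Icc 1 ⌊Q⌋₊, f q) - ∑' q, f q) * J * (V : ℂ)‖ ≤
      Q ^ (-(1 / 5) : ℝ) * G * ‖J‖ * V := by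
    rw [norm_mul, norm_mul, Complex.norm_real, Real.norm_of_nonneg hV0]
    gcongr
  refine (norm_add_le _ _).trans ((add_le_add h1 h2).trans (le_of_eq ?_))
  ring

end MajorArcs

section Asymptotic

variable {s : ℕ}

/-- The asymptotic formula for large parameters. -/
lemma Pencil.exists_asymptotic_of_large {M₁ M₂ : Matrix (Fin s) (Fin s) ℤ}
    (D : Pencil s (2 • M₁) (2 • M₂)) (hs : 10 ≤ s) (hM₁ : M₁.IsSymm) (hM₂ : M₂.IsSymm)
    {w : (Fin s → ℝ) → ℝ} (hw : ContDiff ℝ (⊤ : ℕ∞) w) (hwc : HasCompactSupport w) :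
    ∃ K P₁ : ℝ, 0 ≤ K ∧ 1 ≤ P₁ ∧ ∀ P : ℝ, P₁ ≤ P →
      ‖(∑' x : Fin s → ℤ, if quadEval M₁ x = 0 ∧ quadEval M₂ x = 0 then
          ((w (fun i => (x i : ℝ) / P) : ℝ) : ℂ) else 0) -
        (∑' q : ℕ, ((q : ℂ) ^ (-(s : ℤ))) * Dq s M₁ M₂ q 0) * (∫ β, singInt M₁ M₂ w β) *
          ((P ^ (s - 4) : ℝ) : ℂ)‖ ≤ K * P ^ ((s : ℝ) - 4 - 1 / 6) := by
  obtain ⟨K₁, C₁, hK₁, hC₁, hminor⟩ := D.exists_minor_arc_bound hs hM₁ hM₂ hw hwc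
  obtain ⟨C, K₂, hC, hK₂, hmajor⟩ := D.exists_major_arcs_bound hs hM₁ hM₂ hw hwc 59
  refine ⟨C * 2 ^ 60 + K₂ + K₁, max (C₁ ^ (10 / 9 : ℝ)) 1024, by positivity,
    le_max_of_le_right (by norm_num), fun P hPP => ?_⟩
  have hP1024 : 1024 ≤ P := (le_max_right _ _).trans hPP
  have hP1 : 1 ≤ P := by linarith
  have hP : 0 < P := by linarith
  set Q : ℝ := P ^ (9 / 10 : ℝ) with hQ
  have hCQ : C₁ ≤ Q := by
    have h := Real.rpow_le_rpow (by positivity) ((le_max_left _ _).trans hPP)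
      (by norm_num : (0 : ℝ) ≤ 9 / 10)
    rwa [← Real.rpow_mul (by linarith), show (10 / 9 : ℝ) * (9 / 10) = 1 by norm_num,
      Real.rpow_one] at h
  have hQ1 : 1 ≤ Q := hC₁.trans hCQ
  have hQP : Q ≤ P := by
    conv_rhs => rw [← Real.rpow_one P]
    exact Real.rpow_le_rpow_of_exponent_le hP1 (by norm_num)
  have hPQ : 4 * Q ^ 2 ≤ P ^ 2 := by
    have h4 : (4 : ℝ) ≤ P ^ (1 / 5 : ℝ) := by
      have h := Real.rpow_le_rpow (by norm_num) hP1024 (by norm_num : (0 : ℝ) ≤ 1 / 5)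
      rwa [show (1024 : ℝ) = 4 ^ (5 : ℝ) by norm_num, ← Real.rpow_mul (by norm_num),
        show (5 : ℝ) * (1 / 5) = 1 by norm_num, Real.rpow_one] at h
    calc 4 * Q ^ 2 ≤ P ^ (1 / 5 : ℝ) * Q ^ 2 := by gcongr
      _ = P ^ 2 := by
        rw [hQ, ← Real.rpow_natCast, ← Real.rpow_mul hP.le, ← Real.rpow_add hP,
          ← Real.rpow_natCast]
        norm_num
  have hV : P ^ s * (P ^ 4)⁻¹ = P ^ (s - 4) := by
    rw [← div_eq_mul_inv, div_eq_iff (by positivity), ← pow_add]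
    congr 1; omega
  have hVr : P ^ s * (P ^ 4)⁻¹ = P ^ ((s : ℝ) - 4) := by
    rw [Real.rpow_sub hP, Real.rpow_natCast, div_eq_mul_inv]
    norm_cast
  have hM := hmajor P Q hQ1 hPQ hQP
  have hm := hminor P Q hP1 hCQ hPQ hQ
  have hSi := integrableOn_torusBox (continuous_expSum M₁ M₂ hwc hP) (1 / (2 * Q))
  have hsplit := integral_inter_add_sdiff (measurableSet_majorArcs P Q) hSi
  rw [Set.inter_eq_right.mpr (majorArcs_subset_torusBox hQ1 hPQ),
    setIntegral_expSum M₁ M₂ hwc hP] at hsplit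
  rw [← hsplit, ← hV, add_sub_right_comm]
  refine (norm_add_le _ _).trans ((add_le_add (hM.trans ?_) hm).trans_eq (add_mul _ _ _).symm)
  rw [add_mul]
  refine add_le_add ?_ ?_
  · have e : (2 * Q / P) ^ (59 + 1) = 2 ^ 60 * P ^ (-6 : ℝ) := by
      rw [mul_div_assoc, mul_pow, hQ]
      nth_rewrite 2 [← Real.rpow_one P]
      rw [← Real.rpow_sub hP, ← Real.rpow_natCast (P ^ _), ← Real.rpow_mul hP.le]
      norm_num
    rw [e, show C * P ^ s * (2 ^ 60 * P ^ (-6 : ℝ)) = C * 2 ^ 60 * (P ^ s * P ^ (-6 : ℝ)) by ring,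
      ← Real.rpow_natCast P s, ← Real.rpow_add hP]
    gcongr
    linarith
  · rw [hVr, hQ, ← Real.rpow_mul hP.le, mul_assoc, ← Real.rpow_add hP]
    gcongr
    linarith

/-- The asymptotic formula for bounded parameters. -/
lemma exists_asymptotic_of_bounded (M₁ M₂ : Matrix (Fin s) (Fin s) ℤ) {w : (Fin s → ℝ) → ℝ}
    (hw : Continuous w) (hwc : HasCompactSupport w) (z : ℂ) (P₁ : ℝ) :
    ∃ K : ℝ, 0 ≤ K ∧ ∀ P : ℝ, 1 ≤ P → P ≤ P₁ →
      ‖(∑' x : Fin s → ℤ, if quadEval M₁ x = 0 ∧ quadEval M₂ x = 0 then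
          ((w (fun i => (x i : ℝ) / P) : ℝ) : ℂ) else 0) - z * ((P ^ (s - 4) : ℝ) : ℂ)‖ ≤ K := by
  obtain ⟨ρ, hρ1, hρ⟩ := hwc.exists_ball
  obtain ⟨M, hM⟩ := hwc.exists_bound_of_continuous hw
  have hM0 : 0 ≤ M := (norm_nonneg _).trans (hM 0)
  refine ⟨(2 * (ρ * |P₁|) + 1) ^ s * M + ‖z‖ * |P₁| ^ (s - 4), by positivity, fun P hP hPP => ?_⟩
  have hP0 : 0 < P := by linarith
  have hPa : P ≤ |P₁| := hPP.trans (le_abs_self _)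
  refine (norm_sub_le _ _).trans (add_le_add ((norm_tsum_int_ball_le (R := ρ * P) (M := M)
    (by positivity) (fun x hx => ?_) fun x => ?_).trans ?_) ?_)
  · have e : (fun i => (x i : ℝ) / P) = P⁻¹ • realVec x := by
      ext i
      rw [Pi.smul_apply, realVec_apply, smul_eq_mul]
      ring
    rw [e, hρ _ (norm_inv_smul_gt hP0 hx), Complex.ofReal_zero, ite_self]
  · split_ifs
    · rw [Complex.norm_real]; exact hM _
    · rwa [norm_zero]
  · gcongr
  · rw [norm_mul, Complex.norm_real, Real.norm_of_nonneg (by positivity)]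
    gcongr

end Asymptotic

/-- the main theorem (Theorem 1.1, unconditional part, `s ≥ 10`). -/
theorem statement0 (s : ℕ) (hs : 10 ≤ s)
    (M₁ M₂ : Matrix (Fin s) (Fin s) ℤ) (hM₁ : M₁.IsSymm) (hM₂ : M₂.IsSymm)
    (hns : NonsingularPair s M₁ M₂)
    (w : (Fin s → ℝ) → ℝ) (hw_smooth : ContDiff ℝ (⊤ : ℕ∞) w) (hw_supp : HasCompactSupport w) :
    Summable (fun q : ℕ => (q : ℝ) ^ (-(s : ℤ)) * ‖Dq s M₁ M₂ q 0‖) ∧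
    Integrable (fun α : ℝ × ℝ =>
      ∫ x : Fin s → ℝ, ((w x : ℝ) : ℂ) *
        e2pi (α.1 * quadEval M₁ x + α.2 * quadEval M₂ x)) ∧
    ∀ Δ : ℝ, Δ < 1 / 6 → ∃ C : ℝ, ∀ P : ℝ, 1 ≤ P →
      ‖(∑' x : Fin s → ℤ,
          if quadEval M₁ x = 0 ∧ quadEval M₂ x = 0 then
            ((w (fun i => (x i : ℝ) / P) : ℝ) : ℂ)
          else 0) -
        (∑' q : ℕ, ((q : ℂ) ^ (-(s : ℤ))) * Dq s M₁ M₂ q 0) *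
          (∫ α : ℝ × ℝ, ∫ x : Fin s → ℝ, ((w x : ℝ) : ℂ) *
            e2pi (α.1 * quadEval M₁ x + α.2 * quadEval M₂ x)) *
          ((P ^ (s - 4) : ℝ) : ℂ)‖
        ≤ C * P ^ ((s : ℝ) - 4 - Δ) := by
  obtain ⟨D⟩ := exists_pencil hM₁ hM₂ hns
  obtain ⟨K₀, hK₀, hdecay⟩ := D.exists_singInt_le hs hM₁ hM₂ hw_smooth hw_supp
  refine ⟨?_, (exists_truncation_bound
    (continuous_singInt M₁ M₂ hw_smooth.continuous hw_supp) hdecay).1, fun Δ hΔ => ?_⟩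
  · refine Summable.of_nonneg_of_le (fun q => by positivity) (fun q => ?_)
      (D.summable_seriesAbs hs hM₁ hM₂)
    exact (norm_Dq_le M₁ M₂ q).trans (seriesAbs_le_rpow_mul M₁ M₂ q)
  obtain ⟨K, P₁, hK, hP₁, hlarge⟩ := D.exists_asymptotic_of_large hs hM₁ hM₂ hw_smooth hw_supp
  obtain ⟨K', hK', hsmall⟩ := exists_asymptotic_of_bounded M₁ M₂ hw_smooth.continuous hw_supp
    ((∑' q : ℕ, ((q : ℂ) ^ (-(s : ℤ))) * Dq s M₁ M₂ q 0) * ∫ β, singInt M₁ M₂ w β) P₁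
  have hs' : (10 : ℝ) ≤ s := by exact_mod_cast hs
  refine ⟨K + K', fun P hP => ?_⟩
  have hmono : P ^ ((s : ℝ) - 4 - 1 / 6) ≤ P ^ ((s : ℝ) - 4 - Δ) :=
    Real.rpow_le_rpow_of_exponent_le hP (by linarith)
  rcases le_total P₁ P with h | h
  · refine (hlarge P h).trans ?_
    exact mul_le_mul (by linarith) hmono (by positivity) (by positivity)
  · refine (hsmall P hP h).trans ?_
    have h1 : 1 ≤ P ^ ((s : ℝ) - 4 - Δ) := Real.one_le_rpow hP (by linarith)
    calc K' ≤ K + K' := by linarith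
      _ ≤ _ := le_mul_of_one_le_right (by positivity) h1
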